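/- Let F(s) = ξ(2)·ξ(s+2)ξ(2s)/(s−3) − ξ(2)·ξ(s−2)ξ(2s−1)/(s+2) + ξ(s−2)ξ(2s−1)/(2s−2) − ξ(s+2)ξ(2s)/(2s) − ξ(s−1)ξ(2s−1)/(s(s−3)) − ξ(s+1)ξ(2s)/((s−1)(s+2)) − ξ(s)ξ(2s)/((2s−2)(s+1)) − ξ(s)ξ(2s−1)/((2s)(s−2)). Then every zero of F lies on the central line: for every complex s with s ∉ {−2, −1, 0, 1/2, 1, 2, 3}, if F(s) = 0 then Re s = 1/2. -/

import Mathlib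

open Complex

local notation "ξ" => completedRiemannZeta

/-- Weng's zeta function `ξ_ℚ^{G₂/P_short}(s)`. -/
noncomputable def wengG2Pshort (s : ℂ) : ℂ :=
  ξ 2 * ξ (s + 2) * ξ (2*s) / (s - 3)
    - ξ 2 * ξ (s - 2) * ξ (2*s - 1) / (s + 2)
    + ξ (s - 2) * ξ (2*s - 1) / (2*s - 2)
    - ξ (s + 2) * ξ (2*s) / (2*s)
    - ξ (s - 1) * ξ (2*s - 1) / (s * (s - 3))
    - ξ (s + 1) * ξ (2*s) / ((s - 1) * (s + 2))
    - ξ s * ξ (2*s) / ((2*s - 2) * (s + 1))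
    - ξ s * ξ (2*s - 1) / ((2*s) * (s - 2))

open MeasureTheory Set in
/-- The theta kernel of the entire part of the completed zeta function is nonnegative. -/
lemma exists_thetaKernel : ∃ k : ℝ → ℝ, (∀ x, 0 ≤ k x) ∧
    (HurwitzZeta.hurwitzEvenFEPair 0).f_modif = fun x ↦ (k x : ℂ) := by
  refine ⟨(Ioi 1).indicator (fun x ↦ HurwitzZeta.evenKernel 0 x - 1) +
    (Ioo 0 1).indicator (fun x ↦ HurwitzZeta.evenKernel 0 x - x ^ (-(1 / 2) : ℝ)), ?_, ?_⟩
  · have key : ∀ x : ℝ, 0 < x → 1 ≤ HurwitzZeta.evenKernel 0 x := by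
      intro x hx
      have h := HurwitzZeta.hasSum_int_evenKernel₀ 0 hx
      simp only [QuotientAddGroup.mk_zero, if_true] at h
      have := h.nonneg (fun n ↦ by split_ifs <;> positivity)
      linarith
    intro x
    refine add_nonneg (indicator_nonneg (fun x hx ↦ ?_) x) (indicator_nonneg (fun x hx ↦ ?_) x)
    · linarith [key x (lt_trans one_pos hx)]
    · have hfe := HurwitzZeta.evenKernel_functional_equation 0 x
      rw [← HurwitzZeta.evenKernel_eq_cosKernel_of_zero] at hfe
      have h1 := key (1 / x) (one_div_pos.mpr hx.1)
      have hp : 0 < x ^ (-(1 / 2) : ℝ) := Real.rpow_pos_of_pos hx.1 _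
      rw [hfe, Real.rpow_neg hx.1.le, one_div]
      rw [Real.rpow_neg hx.1.le] at hp
      nlinarith
  · funext x
    simp only [WeakFEPair.f_modif, HurwitzZeta.hurwitzEvenFEPair, Pi.add_apply, ofReal_add]
    congr 1
    · by_cases hx : x ∈ Ioi (1 : ℝ) <;> simp [hx]
    · by_cases hx : x ∈ Ioo (0 : ℝ) 1
      · simp [hx]
      · simp [hx]

open MeasureTheory Set in
/-- The entire part of the completed zeta function is a two-sided Laplace transform of a
nonnegative density. -/
lemma exists_density : ∃ φ : ℝ → ℝ, (∀ x ∈ Ioi (0 : ℝ), 0 ≤ φ x) ∧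
    (∀ u : ℂ, IntegrableOn (fun x ↦ φ x * Complex.exp (u * (Real.log x / 2 : ℝ))) (Ioi 0)) ∧
    ∀ u : ℂ, completedRiemannZeta₀ (1 / 2 + u) =
      ∫ x in Ioi (0 : ℝ), φ x * Complex.exp (u * (Real.log x / 2 : ℝ)) := by
  obtain ⟨k, hk, hf⟩ := exists_thetaKernel
  have hcv : ∀ s : ℂ, MellinConvergent (HurwitzZeta.hurwitzEvenFEPair 0).f_modif s := fun s ↦
    ((WeakFEPair.isStrongFEPair_toStrongFEPair (HurwitzZeta.hurwitzEvenFEPair 0)).hasMellin s).1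
  have heq : ∀ u : ℂ, ∀ x ∈ Ioi (0 : ℝ),
      ((k x * x ^ (-(3 / 4) : ℝ) / 2 : ℝ) : ℂ) * Complex.exp (u * (Real.log x / 2 : ℝ)) =
      (x : ℂ) ^ ((1 / 2 + u) / 2 - 1) • (HurwitzZeta.hurwitzEvenFEPair 0).f_modif x / 2 := by
    intro u x hx
    have hx' : (x : ℂ) ≠ 0 := ofReal_ne_zero.mpr (ne_of_gt hx)
    rw [hf]
    have : (x : ℂ) ^ ((1 / 2 + u) / 2 - 1) = ((x ^ (-(3 / 4) : ℝ) : ℝ) : ℂ) *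
        Complex.exp (u * (Real.log x / 2 : ℝ)) := by
      rw [ofReal_cpow (le_of_lt hx), cpow_def_of_ne_zero hx', cpow_def_of_ne_zero hx',
        ← Complex.exp_add, ← ofReal_log (le_of_lt hx)]
      congr 1
      push_cast
      ring
    rw [this]
    push_cast
    simp only [smul_eq_mul]
    ring
  refine ⟨fun x ↦ k x * x ^ (-(3 / 4) : ℝ) / 2, fun x hx ↦ ?_, fun u ↦ ?_, fun u ↦ ?_⟩
  · have := Real.rpow_nonneg (le_of_lt (mem_Ioi.mp hx)) (-(3 / 4) : ℝ)
    have := hk x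
    positivity
  · exact IntegrableOn.congr_fun (Integrable.div_const (hcv ((1 / 2 + u) / 2)) 2)
      (fun x hx ↦ (heq u x hx).symm) measurableSet_Ioi
  · rw [setIntegral_congr_fun measurableSet_Ioi (heq u), integral_div]
    rfl

open MeasureTheory Set in
/-- The entire part of the completed zeta function has a power series in `(s - 1/2) ^ 2` with
nonnegative coefficients. -/
theorem exists_coeff : ∃ c : ℕ → ℝ, (∀ k, 0 ≤ c k) ∧
    (∀ u : ℂ, HasSum (fun k ↦ (c k : ℂ) * u ^ (2 * k)) (completedRiemannZeta₀ (1 / 2 + u))) ∧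
    ∀ u : ℂ, ‖completedRiemannZeta₀ (1 / 2 + u)‖ ≤ (completedRiemannZeta₀ (1 / 2 + u.re)).re := by
  obtain ⟨φ, hφ, hgi, hg⟩ := exists_density
  set L : ℝ → ℝ := fun x ↦ Real.log x / 2 with hL
  have hreal : ∀ r : ℝ, IntegrableOn (fun x ↦ φ x * Real.exp (r * L x)) (Ioi 0) := by
    intro r
    have := (hgi r).re
    refine IntegrableOn.congr_fun this (fun x _ ↦ ?_) measurableSet_Ioi
    simp only [← ofReal_mul, ← ofReal_exp, RCLike.re_to_complex, ofReal_re, hL]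
  have hφm : AEStronglyMeasurable φ (volume.restrict (Ioi 0)) := by
    have := (hreal 0).aestronglyMeasurable
    simpa using this
  have hLm : Measurable L := Real.measurable_log.div_const 2
  have hsymm : ∀ u : ℂ, completedRiemannZeta₀ (1 / 2 + u) =
      ∫ x in Ioi (0 : ℝ), φ x * Complex.cosh (u * L x) := by
    intro u
    have h1 : completedRiemannZeta₀ (1 / 2 + u) = completedRiemannZeta₀ (1 / 2 + -u) := by
      rw [← completedRiemannZeta₀_one_sub]
      congr 1
      ring
    have h2 : completedRiemannZeta₀ (1 / 2 + u) = (completedRiemannZeta₀ (1 / 2 + u) +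
        completedRiemannZeta₀ (1 / 2 + -u)) / 2 := by rw [← h1]; ring
    rw [h2, hg u, hg (-u), ← integral_add (hgi u) (hgi (-u)), ← integral_div]
    refine integral_congr_ae (Filter.Eventually.of_forall fun x ↦ ?_)
    simp only [Complex.cosh, hL]
    ring_nf
  have hcosh : ∀ r : ℝ, IntegrableOn (fun x ↦ φ x * Real.cosh (r * L x)) (Ioi 0) := by
    intro r
    have := ((hreal r).add (hreal (-r))).div_const 2
    refine IntegrableOn.congr_fun this (fun x _ ↦ ?_) measurableSet_Ioi
    simp only [Pi.add_apply, Real.cosh_eq]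
    ring_nf
  refine ⟨fun k ↦ ∫ x in Ioi (0 : ℝ), φ x * L x ^ (2 * k) / (2 * k).factorial, fun k ↦ ?_,
    fun u ↦ ?_, fun u ↦ ?_⟩
  · refine setIntegral_nonneg measurableSet_Ioi fun x hx ↦ ?_
    have h1 := hφ x hx
    have h2 : 0 ≤ L x ^ (2 * k) := by rw [pow_mul]; positivity
    positivity
  · rw [hsymm]
    have : ∀ k : ℕ, ((∫ x in Ioi (0 : ℝ), φ x * L x ^ (2 * k) / (2 * k).factorial : ℝ) : ℂ) *
        u ^ (2 * k) = ∫ x in Ioi (0 : ℝ), φ x * ((u * L x) ^ (2 * k) / (2 * k).factorial) := by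
      intro k
      rw [← integral_complex_ofReal, ← integral_mul_const]
      refine integral_congr_ae (Filter.Eventually.of_forall fun x ↦ ?_)
      push_cast
      ring
    simp_rw [this]
    have hs : ∀ x : ℝ, HasSum (fun k : ℕ ↦ φ x * ((‖u‖ * L x) ^ (2 * k) / (2 * k).factorial))
        (φ x * Real.cosh (‖u‖ * L x)) := fun x ↦ (Real.hasSum_cosh _).mul_left _
    refine hasSum_integral_of_dominated_convergence
      (fun k x ↦ φ x * ((‖u‖ * L x) ^ (2 * k) / (2 * k).factorial)) (fun k ↦ ?_) (fun k ↦ ?_)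
      (Filter.Eventually.of_forall fun x ↦ (hs x).summable) ?_
      (Filter.Eventually.of_forall fun x ↦ (Complex.hasSum_cosh _).mul_left _)
    · refine (continuous_ofReal.comp_aestronglyMeasurable hφm).mul ?_
      exact ((measurable_const.mul (measurable_ofReal.comp hLm)).pow_const _ |>.div_const
        _).aestronglyMeasurable
    · refine (ae_restrict_iff' measurableSet_Ioi).mpr (Filter.Eventually.of_forall fun x hx ↦ ?_)
      rw [norm_mul, norm_div, norm_pow, norm_mul, norm_real, norm_real, Real.norm_of_nonneg (hφ x hx),
        Complex.norm_natCast, pow_mul (‖u‖ * ‖L x‖), pow_mul (‖u‖ * L x), mul_pow, mul_pow,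
        Real.norm_eq_abs, sq_abs]
      exact le_of_eq (by ring)
    · exact (hcosh ‖u‖).congr (Filter.Eventually.of_forall fun x ↦ ((hs x).tsum_eq).symm)
  · have h1 : ∀ x ∈ Ioi (0 : ℝ), ‖φ x * Complex.exp (u * L x)‖ = φ x * Real.exp (u.re * L x) := by
      intro x hx
      rw [norm_mul, norm_real, Real.norm_of_nonneg (hφ x hx), norm_exp]
      simp
    rw [hg, hg]
    refine (norm_integral_le_integral_norm _).trans (le_of_eq ?_)
    rw [setIntegral_congr_fun measurableSet_Ioi h1]
    have : ∀ x, ((φ x * Real.exp (u.re * L x) : ℝ) : ℂ) =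
        φ x * Complex.exp (u.re * (Real.log x / 2 : ℝ)) := by intro x; push_cast [hL]; rfl
    simp_rw [← this, integral_complex_ofReal, ofReal_re]

lemma norm_riemannZeta_le {σ : ℝ} (hσ : 1 < σ) {w : ℂ} (hw : σ ≤ w.re) :
    ‖riemannZeta w‖ ≤ ∑' n : ℕ, 1 / (n : ℝ) ^ σ := by
  rw [zeta_eq_tsum_one_div_nat_cpow (hσ.trans_le hw)]
  refine tsum_of_norm_bounded (Real.summable_one_div_nat_rpow.mpr hσ).hasSum fun n ↦ ?_
  rcases Nat.eq_zero_or_pos n with rfl | hn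
  · have : w ≠ 0 := by rintro rfl; simp at hw; linarith
    simp [this, (by linarith : σ ≠ 0)]
  · rw [norm_div, norm_one, norm_natCast_cpow_of_pos hn]
    have : (1 : ℝ) ≤ n := by exact_mod_cast hn
    exact one_div_le_one_div_of_le (by positivity) (Real.rpow_le_rpow_of_exponent_le this hw)

lemma one_le_norm_riemannZeta_mul {σ : ℝ} (hσ : 1 < σ) {w : ℂ} (hw : σ ≤ w.re) :
    1 ≤ ‖riemannZeta w‖ * ∑' n : ℕ, 1 / (n : ℝ) ^ σ := by
  have h1 := hσ.trans_le hw
  have h := ArithmeticFunction.LSeries_zeta_mul_Lseries_moebius h1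
  rw [ArithmeticFunction.LSeries_zeta_eq_riemannZeta h1] at h
  have h2 : ‖LSeries (fun n ↦ ((ArithmeticFunction.moebius n : ℤ) : ℂ)) w‖ ≤
      ∑' n : ℕ, 1 / (n : ℝ) ^ σ := by
    refine tsum_of_norm_bounded (Real.summable_one_div_nat_rpow.mpr hσ).hasSum fun n ↦ ?_
    rcases Nat.eq_zero_or_pos n with rfl | hn
    · simp [(by linarith : σ ≠ 0)]
    · rw [LSeries.term_of_ne_zero hn.ne', norm_div, norm_natCast_cpow_of_pos hn]
      have : (1 : ℝ) ≤ n := by exact_mod_cast hn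
      have h3 : ‖((ArithmeticFunction.moebius n : ℤ) : ℂ)‖ ≤ 1 := by
        rw [Complex.norm_intCast]
        exact_mod_cast ArithmeticFunction.abs_moebius_le_one
      exact div_le_div₀ zero_le_one h3 (by positivity)
        (Real.rpow_le_rpow_of_exponent_le this hw)
  calc (1 : ℝ) = ‖riemannZeta w‖ * ‖LSeries (fun n ↦ ((ArithmeticFunction.moebius n : ℤ) : ℂ)) w‖ := by
        rw [← norm_mul, h, norm_one]
    _ ≤ _ := mul_le_mul_of_nonneg_left h2 (norm_nonneg _)

/-- `‖Γ(σ + iy)‖ / Γ(σ)` increases with `σ > 0`. -/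
lemma norm_Gamma_mul_le {a b : ℝ} (ha : 0 < a) (hab : a ≤ b) (y : ℝ) :
    ‖Gamma (a + y * I)‖ * ‖Gamma b‖ ≤ ‖Gamma (b + y * I)‖ * ‖Gamma a‖ := by
  refine le_of_tendsto_of_tendsto
    ((GammaSeq_tendsto_Gamma _).norm.mul (GammaSeq_tendsto_Gamma _).norm)
    ((GammaSeq_tendsto_Gamma _).norm.mul (GammaSeq_tendsto_Gamma _).norm) ?_
  filter_upwards [Filter.eventually_gt_atTop 0] with n hn
  simp only [GammaSeq, norm_div, norm_mul, norm_prod, norm_natCast_cpow_of_pos hn]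
  simp only [add_re, ofReal_re, mul_re, I_re, mul_zero, ofReal_im, I_im, mul_one, sub_self,
    add_zero, div_mul_div_comm]
  have hpos : ∀ c : ℝ, 0 < c → ∀ y : ℝ, ∀ j : ℕ, 0 < ‖(c : ℂ) + y * I + j‖ := by
    intro c hc y j
    rw [norm_pos_iff]
    intro h
    have := congrArg re h
    simp at this
    have hj : (0 : ℝ) ≤ j := Nat.cast_nonneg j
    linarith
  have hpos' : ∀ c : ℝ, 0 < c → ∀ j : ℕ, 0 < ‖(c : ℂ) + j‖ := by
    intro c hc j
    simpa using hpos c hc 0 j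
  have hb := ha.trans_le hab
  rw [show ((n : ℝ) ^ a * ‖((n.factorial : ℕ) : ℂ)‖ * ((n : ℝ) ^ b * ‖((n.factorial : ℕ) : ℂ)‖)) =
    ((n : ℝ) ^ b * ‖((n.factorial : ℕ) : ℂ)‖ * ((n : ℝ) ^ a * ‖((n.factorial : ℕ) : ℂ)‖)) by ring]
  rw [← Finset.prod_mul_distrib, ← Finset.prod_mul_distrib]
  refine div_le_div_of_nonneg_left (by positivity)
    (Finset.prod_pos fun j _ ↦ mul_pos (hpos b hb y j) (hpos' a ha j)) ?_
  refine Finset.prod_le_prod (fun j _ ↦ by positivity) fun j _ ↦ ?_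
  have e1 : ∀ c : ℝ, ‖(c : ℂ) + y * I + j‖ = Real.sqrt ((c + j) ^ 2 + y ^ 2) := by
    intro c
    rw [norm_eq_sqrt_sq_add_sq]
    simp
  have e2 : ∀ c : ℝ, 0 < c → ‖(c : ℂ) + j‖ = Real.sqrt ((c + j) ^ 2) := by
    intro c hc
    rw [norm_eq_sqrt_sq_add_sq]
    simp
  rw [e1, e1, e2 a ha, e2 b hb, ← Real.sqrt_mul (by positivity), ← Real.sqrt_mul (by positivity)]
  refine Real.sqrt_le_sqrt ?_
  have hj : (0 : ℝ) ≤ j := Nat.cast_nonneg j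
  have : (a + j) ^ 2 ≤ (b + j) ^ 2 := by gcongr
  nlinarith [sq_nonneg y]

lemma norm_Gamma_half_sq (y : ℝ) :
    ‖Gamma ((1 / 2 : ℝ) + y * I)‖ ^ 2 = Real.pi / Real.cosh (Real.pi * y) := by
  have h := Complex.Gamma_mul_Gamma_one_sub ((1 / 2 : ℝ) + y * I)
  have h1 : (1 : ℂ) - ((1 / 2 : ℝ) + y * I) = (starRingEnd ℂ) ((1 / 2 : ℝ) + y * I) := by
    simp only [map_add, map_mul, conj_ofReal, conj_I]
    push_cast
    ring
  rw [h1, Gamma_conj, mul_conj, normSq_eq_norm_sq] at h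
  have h2 : sin (Real.pi * ((1 / 2 : ℝ) + y * I)) = (Real.cosh (Real.pi * y) : ℝ) := by
    rw [show (Real.pi : ℂ) * ((1 / 2 : ℝ) + y * I) = (Real.pi * y : ℝ) * I + Real.pi / 2 by
      push_cast; ring, sin_add_pi_div_two, cos_mul_I]
    simp
  rw [h2] at h
  exact_mod_cast h

/-- A lower bound for the Gamma function on vertical lines. -/
lemma norm_Gamma_ge {σ : ℝ} (hσ : 1 / 2 ≤ σ) (y : ℝ) :
    ‖Gamma σ‖ ≤ ‖Gamma (σ + y * I)‖ * Real.exp (Real.pi * |y|) := by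
  have h := norm_Gamma_mul_le (by norm_num : (0 : ℝ) < 1 / 2) hσ y
  have h1 := norm_Gamma_half_sq y
  have h0 := norm_Gamma_half_sq 0
  simp only [ofReal_zero, zero_mul, add_zero, mul_zero, Real.cosh_zero, div_one] at h0
  have hc : Real.cosh (Real.pi * y) ≤ Real.exp (Real.pi * |y|) := by
    rw [← Real.cosh_abs, abs_mul, abs_of_pos Real.pi_pos, Real.cosh_eq]
    have : Real.exp (-(Real.pi * |y|)) ≤ Real.exp (Real.pi * |y|) :=
      Real.exp_le_exp.mpr (by have := abs_nonneg y; nlinarith [Real.pi_pos])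
    linarith
  have hc0 : 1 ≤ Real.exp (Real.pi * |y|) := Real.one_le_exp (by positivity)
  set A := ‖Gamma ((1 / 2 : ℝ) + y * I)‖
  set B := ‖Gamma ((1 / 2 : ℝ) : ℂ)‖
  have hB : B ≤ A * Real.exp (Real.pi * |y|) := by
    rw [← sq_le_sq₀ (norm_nonneg _) (by positivity), h0, mul_pow, h1, div_mul_eq_mul_div,
      le_div_iff₀ (Real.cosh_pos _)]
    have := Real.pi_pos
    gcongr
    nlinarith
  have hBpos : 0 < B := by
    refine norm_pos_iff.mpr (Gamma_ne_zero_of_re_pos ?_)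
    simp
  have h3 : A * ‖Gamma σ‖ ≤ ‖Gamma (σ + y * I)‖ * (A * Real.exp (Real.pi * |y|)) :=
    h.trans (by gcongr)
  have hApos : 0 < A := by
    by_contra hA
    have : A = 0 := le_antisymm (not_lt.mp hA) (norm_nonneg _)
    rw [this] at hB
    linarith
  have h4 : A * ‖Gamma σ‖ ≤ A * (‖Gamma (σ + y * I)‖ * Real.exp (Real.pi * |y|)) := by
    linarith [h3]
  exact le_of_mul_le_mul_left h4 hApos

/-- The entire function `s (s - 1) ξ(s)`. -/
noncomputable def entireXi (w : ℂ) : ℂ := 1 + w * (w - 1) * completedRiemannZeta₀ w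

lemma entireXi_eq {w : ℂ} (h0 : w ≠ 0) (h1 : w ≠ 1) :
    entireXi w = w * (w - 1) * completedRiemannZeta w := by
  have h2 : 1 - w ≠ 0 := sub_ne_zero.mpr h1.symm
  rw [completedRiemannZeta_eq, entireXi]
  field_simp
  ring

lemma differentiable_entireXi : Differentiable ℂ entireXi := by
  have := differentiable_completedZeta₀
  unfold entireXi
  fun_prop

lemma entireXi_one_sub (w : ℂ) : entireXi (1 - w) = entireXi w := by
  rw [entireXi, entireXi, completedRiemannZeta₀_one_sub]
  ring

lemma completedRiemannZeta₀_conj (w : ℂ) : completedRiemannZeta₀ ((starRingEnd ℂ) w) =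
    (starRingEnd ℂ) (completedRiemannZeta₀ w) := by
  obtain ⟨c, -, hc, -⟩ := exists_coeff
  have h1 := hasSum_conj'.mpr (hc (w - 1 / 2))
  have h2 := hc ((starRingEnd ℂ) w - 1 / 2)
  simp only [map_mul, map_pow, conj_ofReal, map_sub, map_div₀, map_one, map_ofNat] at h1
  rw [add_sub_cancel] at h1 h2
  exact h2.unique h1

lemma entireXi_conj (w : ℂ) : entireXi ((starRingEnd ℂ) w) = (starRingEnd ℂ) (entireXi w) := by
  simp [entireXi, completedRiemannZeta₀_conj]

lemma norm_entireXi_one_sub_conj (w : ℂ) : ‖entireXi (1 - (starRingEnd ℂ) w)‖ = ‖entireXi w‖ := by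
  rw [entireXi_one_sub, entireXi_conj, norm_conj]

lemma entireXi_eq_Gammaℝ {w : ℂ} (hw : 1 < w.re) :
    entireXi w = w * (w - 1) * (Gammaℝ w * riemannZeta w) := by
  have h0 : w ≠ 0 := by rintro rfl; simp at hw; linarith
  have h1 : w ≠ 1 := by rintro rfl; simp at hw
  have : Gammaℝ w ≠ 0 := Gammaℝ_ne_zero_of_re_pos (by linarith)
  rw [entireXi_eq h0 h1, riemannZeta_def_of_ne_zero h0, mul_div_cancel₀ _ this]

lemma entireXi_zero : entireXi 0 = 1 := by simp [entireXi]

lemma entireXi_one : entireXi 1 = 1 := by simp [entireXi]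

lemma entireXi_ne_zero {w : ℂ} (hw : 1 ≤ w.re) : entireXi w ≠ 0 := by
  by_cases h1 : w = 1
  · simp [h1, entireXi_one]
  have h0 : w ≠ 0 := by rintro rfl; simp at hw; linarith
  have h2 := riemannZeta_ne_zero_of_one_le_re hw
  rw [riemannZeta_def_of_ne_zero h0, div_ne_zero_iff] at h2
  rw [entireXi_eq h0 h1]
  exact mul_ne_zero (mul_ne_zero h0 (sub_ne_zero.mpr h1)) h2.1

lemma norm_Gammaℝ (w : ℂ) : ‖Gammaℝ w‖ =
    Real.pi ^ (-w.re / 2) * ‖Gamma ((w.re / 2 : ℝ) + (w.im / 2 : ℝ) * I)‖ := by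
  rw [Gammaℝ_def, norm_mul, norm_cpow_eq_rpow_re_of_pos Real.pi_pos]
  congr 2
  · simp
  · congr 1
    nth_rewrite 1 [← re_add_im w]
    push_cast
    ring

lemma norm_entireXi_le_of_re_mem (a b : ℝ) : ∃ C, 0 < C ∧ ∀ w : ℂ, a ≤ w.re → w.re ≤ b →
    ‖entireXi w‖ ≤ C * (1 + ‖w‖) ^ 2 := by
  obtain ⟨c, -, -, hc⟩ := exists_coeff
  obtain ⟨K, hK⟩ := (isCompact_Icc (a := a) (b := b)).exists_bound_of_continuousOn
    (f := fun x : ℝ ↦ completedRiemannZeta₀ (x : ℂ))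
    (differentiable_completedZeta₀.continuous.comp continuous_ofReal).continuousOn
  refine ⟨1 + |K|, by positivity, fun w ha hb ↦ ?_⟩
  have h1 : ‖completedRiemannZeta₀ w‖ ≤ |K| := by
    have h2 := hc (w - 1 / 2)
    have h3 : (1 / 2 : ℂ) + ((w - 1 / 2).re : ℝ) = (w.re : ℝ) := by
      simp
    rw [add_sub_cancel, h3] at h2
    exact h2.trans ((re_le_norm _).trans ((hK _ ⟨ha, hb⟩).trans (le_abs_self K)))
  have h4 : ‖w - 1‖ ≤ 1 + ‖w‖ := by
    have := norm_sub_le w 1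
    rw [norm_one] at this
    linarith
  calc ‖entireXi w‖ ≤ 1 + ‖w‖ * ‖w - 1‖ * ‖completedRiemannZeta₀ w‖ := by
        refine (norm_add_le _ _).trans ?_
        rw [norm_one, norm_mul, norm_mul]
    _ ≤ 1 + ‖w‖ * (1 + ‖w‖) * |K| := by gcongr
    _ ≤ (1 + |K|) * (1 + ‖w‖) ^ 2 := by
        have := norm_nonneg w
        have := abs_nonneg K
        nlinarith [mul_nonneg this (norm_nonneg w)]

lemma norm_entireXi_ge_of_re_mem {a : ℝ} (ha : 1 < a) (b : ℝ) : ∃ c, 0 < c ∧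
    ∀ w : ℂ, a ≤ w.re → w.re ≤ b → c ≤ ‖entireXi w‖ * Real.exp (Real.pi * ‖w‖) := by
  rcases lt_or_ge b a with hab | hab
  · exact ⟨1, one_pos, fun w h1 h2 ↦ absurd (h1.trans h2) (not_le.mpr hab)⟩
  have hcont : ContinuousOn (fun x : ℝ ↦ Real.pi ^ (-x / 2) * ‖Gamma ((x / 2 : ℝ) : ℂ)‖)
      (Set.Icc a b) := by
    refine ContinuousOn.mul ?_ ?_
    · refine Continuous.continuousOn ?_
      exact Continuous.rpow continuous_const (by fun_prop) fun x ↦ Or.inl Real.pi_ne_zero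
    · intro x hx
      have hx0 : 0 < x := by linarith [hx.1]
      refine ContinuousAt.continuousWithinAt (ContinuousAt.norm ?_)
      have h1 : ContinuousAt Gamma ((x / 2 : ℝ) : ℂ) := by
        refine (differentiableAt_Gamma _ fun m h ↦ ?_).continuousAt
        have := congrArg re h
        simp at this
        have hm : (0 : ℝ) ≤ m := Nat.cast_nonneg m
        linarith
      exact ContinuousAt.comp (f := fun x : ℝ ↦ ((x / 2 : ℝ) : ℂ)) h1 (by fun_prop)
  obtain ⟨x₀, hx₀, hmin⟩ := isCompact_Icc.exists_isMinOn (Set.nonempty_Icc.mpr hab) hcont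
  have hm : 0 < Real.pi ^ (-x₀ / 2) * ‖Gamma ((x₀ / 2 : ℝ) : ℂ)‖ := by
    refine mul_pos (Real.rpow_pos_of_pos Real.pi_pos _)
      (norm_pos_iff.mpr (Gamma_ne_zero_of_re_pos ?_))
    rw [ofReal_re]
    linarith [hx₀.1]
  set m := Real.pi ^ (-x₀ / 2) * ‖Gamma ((x₀ / 2 : ℝ) : ℂ)‖
  set Z := ∑' n : ℕ, 1 / (n : ℝ) ^ a
  have hZ : 0 < Z := by
    have := one_le_norm_riemannZeta_mul ha (w := (a : ℂ)) (by simp)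
    by_contra hZ
    nlinarith [norm_nonneg (riemannZeta a)]
  refine ⟨(a - 1) * m / Z, by have := sub_pos.mpr ha; positivity, fun w h1 h2 ↦ ?_⟩
  have hw1 : a - 1 ≤ ‖w - 1‖ := by
    have := re_le_norm (w - 1)
    simp at this
    linarith
  have hw : 1 ≤ ‖w‖ := by
    have := re_le_norm w
    linarith
  have hz := one_le_norm_riemannZeta_mul ha h1
  have hg : m ≤ ‖Gammaℝ w‖ * Real.exp (Real.pi * ‖w‖) := by
    have h3 := hmin (Set.mem_Icc.mpr ⟨h1, h2⟩)
    have h4 := norm_Gamma_ge (σ := w.re / 2) (by linarith) (w.im / 2)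
    have h5 : Real.exp (Real.pi * |w.im / 2|) ≤ Real.exp (Real.pi * ‖w‖) := by
      refine Real.exp_le_exp.mpr (mul_le_mul_of_nonneg_left ?_ Real.pi_pos.le)
      rw [abs_div, abs_two]
      have := abs_im_le_norm w
      have := abs_nonneg w.im
      linarith
    rw [norm_Gammaℝ]
    refine le_trans h3 ?_
    change _ * _ ≤ _
    rw [mul_assoc]
    refine mul_le_mul_of_nonneg_left (h4.trans ?_) (Real.rpow_nonneg Real.pi_pos.le _)
    gcongr
  rw [div_le_iff₀ hZ, entireXi_eq_Gammaℝ (ha.trans_le h1), norm_mul, norm_mul, norm_mul]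
  have h6 : (a - 1) * m ≤ (‖w‖ * ‖w - 1‖) * (‖Gammaℝ w‖ * Real.exp (Real.pi * ‖w‖)) := by
    refine mul_le_mul ?_ hg hm.le (by positivity)
    nlinarith
  calc (a - 1) * m ≤ (a - 1) * m * (‖riemannZeta w‖ * Z) :=
        le_mul_of_one_le_right (mul_nonneg (sub_pos.mpr ha).le hm.le) hz
    _ ≤ (‖w‖ * ‖w - 1‖) * (‖Gammaℝ w‖ * Real.exp (Real.pi * ‖w‖)) * (‖riemannZeta w‖ * Z) := by
        gcongr
    _ = _ := by ring

lemma norm_entireXi_le_mul_norm_add {δ : ℝ} (hδ : 0 ≤ δ) : ∃ C, 0 < C ∧ ∀ w : ℂ, 4 ≤ w.re →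
    ‖entireXi w‖ ≤ C * ‖entireXi (w + δ)‖ := by
  set Z := ∑' n : ℕ, 1 / (n : ℝ) ^ (4 : ℝ)
  have hZ : 0 < Z := by
    have := one_le_norm_riemannZeta_mul (σ := 4) (by norm_num) (w := (4 : ℂ)) (by simp)
    by_contra hZ
    nlinarith [norm_nonneg (riemannZeta 4)]
  refine ⟨Real.pi ^ (δ / 2) * Z ^ 2, by have := Real.pi_pos; positivity, fun w hw ↦ ?_⟩
  have hre : (w + δ).re = w.re + δ := by simp
  rw [entireXi_eq_Gammaℝ (by linarith), entireXi_eq_Gammaℝ (by rw [hre]; linarith)]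
  simp only [norm_mul]
  have hshift : ∀ x : ℝ, x ≤ w.re → ‖w - x‖ ≤ ‖w + δ - x‖ := by
    intro x hx
    rw [norm_eq_sqrt_sq_add_sq, norm_eq_sqrt_sq_add_sq]
    refine Real.sqrt_le_sqrt ?_
    simp
    nlinarith
  have h1 : ‖w‖ ≤ ‖w + δ‖ := by simpa using hshift 0 (by linarith)
  have h2 : ‖w - 1‖ ≤ ‖w + δ - 1‖ := by simpa using hshift 1 (by linarith)
  have h3 : ‖Gammaℝ w‖ ≤ Real.pi ^ (δ / 2) * ‖Gammaℝ (w + δ)‖ := by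
    rw [norm_Gammaℝ, norm_Gammaℝ, hre, ← mul_assoc, ← Real.rpow_add Real.pi_pos]
    have e : δ / 2 + -(w.re + δ) / 2 = -w.re / 2 := by ring
    rw [e]
    refine mul_le_mul_of_nonneg_left ?_ (Real.rpow_nonneg Real.pi_pos.le _)
    have h := norm_Gamma_mul_le (a := w.re / 2) (b := (w.re + δ) / 2) (by linarith) (by linarith)
      (w.im / 2)
    have hmono : ‖Gamma (w.re / 2 : ℝ)‖ ≤ ‖Gamma ((w.re + δ) / 2 : ℝ)‖ := by
      have hp : ∀ x : ℝ, 0 < x → ‖Gamma (x : ℂ)‖ = Real.Gamma x := fun x hx ↦ by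
        rw [Gamma_ofReal, norm_real, Real.norm_of_nonneg (Real.Gamma_pos_of_pos hx).le]
      rw [hp _ (by linarith), hp _ (by linarith)]
      exact Real.Gamma_strictMonoOn_Ici.monotoneOn (Set.mem_Ici.mpr (by linarith))
        (Set.mem_Ici.mpr (by linarith)) (by linarith)
    have him : (w + δ).im = w.im := by simp
    rw [him]
    have hpos : 0 < ‖Gamma ((w.re + δ) / 2 : ℝ)‖ := by
      refine norm_pos_iff.mpr (Gamma_ne_zero_of_re_pos ?_)
      rw [ofReal_re]
      linarith
    refine le_of_mul_le_mul_right (h.trans ?_) hpos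
    gcongr
  have h4 := norm_riemannZeta_le (σ := 4) (by norm_num) hw
  have h5 := one_le_norm_riemannZeta_mul (σ := 4) (by norm_num) (w := w + δ)
    (by rw [hre]; linarith)
  have h6 : ‖riemannZeta w‖ ≤ Z ^ 2 * ‖riemannZeta (w + δ)‖ := by
    calc ‖riemannZeta w‖ ≤ Z * 1 := by rw [mul_one]; exact h4
      _ ≤ Z * (‖riemannZeta (w + δ)‖ * Z) := by gcongr
      _ = _ := by ring
  have := Real.pi_pos
  calc ‖w‖ * ‖w - 1‖ * (‖Gammaℝ w‖ * ‖riemannZeta w‖) ≤ ‖w + δ‖ * ‖w + δ - 1‖ *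
        ((Real.pi ^ (δ / 2) * ‖Gammaℝ (w + δ)‖) * (Z ^ 2 * ‖riemannZeta (w + δ)‖)) := by gcongr
    _ = _ := by ring

lemma diffContOnCl_rightHalfPlane {f : ℂ → ℂ} (hd : ∀ z : ℂ, 0 ≤ z.re → DifferentiableAt ℂ f z) :
    DiffContOnCl ℂ f {z | 0 < z.re} := by
  refine DifferentiableOn.diffContOnCl fun z hz ↦ (hd z ?_).differentiableWithinAt
  have := closure_mono (t := {z : ℂ | 0 ≤ z.re}) (fun z (hz : 0 < z.re) ↦ hz.le) hz
  rwa [IsClosed.closure_eq (isClosed_le continuous_const continuous_re)] at this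

/-- Phragmén–Lindelöf in the right half-plane for functions of exponential type which are bounded
on the positive real axis. -/
lemma norm_le_of_exp_type {f : ℂ → ℂ} {A B X K C : ℝ}
    (hd : ∀ z : ℂ, 0 ≤ z.re → DifferentiableAt ℂ f z)
    (hgrow : ∀ z : ℂ, 0 < z.re → ‖f z‖ ≤ A * Real.exp (B * ‖z‖))
    (hre : ∀ x : ℝ, X ≤ x → ‖f x‖ ≤ K) (him : ∀ y : ℝ, ‖f (y * I)‖ ≤ C) {z : ℂ} (hz : 0 ≤ z.re) :
    ‖f z‖ ≤ C := by
  refine PhragmenLindelof.right_half_plane_of_bounded_on_real (diffContOnCl_rightHalfPlane hd)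
    ⟨1, by norm_num, B, ?_⟩ ?_ him hz
  · refine Asymptotics.IsBigO.of_bound A ?_
    filter_upwards [Filter.mem_inf_of_right (Filter.mem_principal_self _)] with w hw
    rw [Real.rpow_one, Real.norm_of_nonneg (Real.exp_pos _).le]
    exact hgrow w hw
  · refine ⟨K, Filter.eventually_map.mpr ?_⟩
    filter_upwards [Filter.eventually_ge_atTop X] with x hx using hre x hx

lemma norm_entireXi_le_norm_add_of_one_lt {δ : ℝ} (hδ : 1 < δ) {w : ℂ} (hw : (1 - δ) / 2 ≤ w.re) :
    ‖entireXi w‖ ≤ ‖entireXi (w + δ)‖ := by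
  obtain ⟨C₁, hC₁, h1⟩ := norm_entireXi_le_of_re_mem ((1 - δ) / 2) 4
  obtain ⟨c, hc, h2⟩ := norm_entireXi_ge_of_re_mem (a := (1 + δ) / 2) (by linarith) (4 + δ)
  obtain ⟨C₃, hC₃, h3⟩ := norm_entireXi_le_mul_norm_add (δ := δ) (by linarith)
  have hne : ∀ z : ℂ, (1 - δ) / 2 ≤ z.re → entireXi (z + δ) ≠ 0 := fun z hz ↦
    entireXi_ne_zero (by rw [add_re, ofReal_re]; linarith)
  set f : ℂ → ℂ := fun z ↦ entireXi (z + ((1 - δ) / 2 : ℝ)) / entireXi (z + ((1 - δ) / 2 : ℝ) + δ)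
    with hf
  have hre : ∀ z : ℂ, (z + ((1 - δ) / 2 : ℝ)).re = z.re + (1 - δ) / 2 := fun z ↦ by
    rw [add_re, ofReal_re]
  have hlarge : ∀ z : ℂ, 4 ≤ z.re + (1 - δ) / 2 → ‖f z‖ ≤ C₃ := fun z hz ↦ by
    rw [hf, norm_div, div_le_iff₀ (norm_pos_iff.mpr (hne _ (by rw [hre]; linarith)))]
    exact h3 _ (by rw [hre]; linarith)
  have key := norm_le_of_exp_type (f := f) (A := C₁ / c * Real.exp ((2 + Real.pi) * δ) + C₃)
    (B := 2 + Real.pi) (X := 4 + δ) (K := C₃) (C := 1) (z := w - ((1 - δ) / 2 : ℝ))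
    (fun z hz ↦ ?_) (fun z hz ↦ ?_) (fun x hx ↦ ?_) (fun y ↦ ?_)
    (by rw [sub_re, ofReal_re]; linarith)
  · rwa [hf, norm_div, sub_add_cancel, div_le_one (norm_pos_iff.mpr (hne _ hw))] at key
  · refine DifferentiableAt.div ?_ ?_ (hne _ (by rw [hre]; linarith))
    · exact (differentiable_entireXi _).comp _ (by fun_prop)
    · exact (differentiable_entireXi _).comp _ (by fun_prop)
  · have hexp : 1 ≤ Real.exp ((2 + Real.pi) * ‖z‖) := Real.one_le_exp (by
      have := Real.pi_pos
      positivity)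
    rcases le_total 4 (z.re + (1 - δ) / 2) with h | h
    · calc ‖f z‖ ≤ (0 + C₃) * 1 := by rw [zero_add, mul_one]; exact hlarge z h
        _ ≤ _ := by gcongr; positivity
    set v := z + ((1 - δ) / 2 : ℝ) with hv
    have hvre : v.re = z.re + (1 - δ) / 2 := hre z
    have g1 := h1 v (by linarith) (by linarith)
    have g2 := h2 (v + δ) (by rw [add_re, ofReal_re]; linarith) (by rw [add_re, ofReal_re]; linarith)
    have n1 : ‖v‖ ≤ ‖z‖ + δ := by
      refine (norm_add_le _ _).trans ?_
      rw [norm_real, Real.norm_eq_abs, abs_of_nonpos (by linarith)]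
      linarith
    have n2 : ‖v + δ‖ ≤ ‖z‖ + δ := by
      have : v + δ = z + ((1 + δ) / 2 : ℝ) := by rw [hv]; push_cast; ring
      rw [this]
      refine (norm_add_le _ _).trans ?_
      rw [norm_real, Real.norm_eq_abs, abs_of_nonneg (by linarith)]
      linarith
    have g3 : (1 + ‖v‖) ^ 2 ≤ Real.exp (2 * (‖z‖ + δ)) := by
      have := Real.add_one_le_exp (‖z‖ + δ)
      calc (1 + ‖v‖) ^ 2 ≤ (Real.exp (‖z‖ + δ)) ^ 2 := by
            gcongr
            linarith
        _ = _ := by rw [← Real.exp_nat_mul]; norm_num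
    have g4 : Real.exp (Real.pi * ‖v + δ‖) ≤ Real.exp (Real.pi * (‖z‖ + δ)) :=
      Real.exp_le_exp.mpr (mul_le_mul_of_nonneg_left n2 Real.pi_pos.le)
    have hpos : 0 < ‖entireXi (v + δ)‖ := norm_pos_iff.mpr (hne _ (by linarith))
    change ‖entireXi v / entireXi (v + δ)‖ ≤ _
    rw [norm_div, div_le_iff₀ hpos]
    have g5 : 1 ≤ ‖entireXi (v + δ)‖ * Real.exp (Real.pi * (‖z‖ + δ)) / c := by
      rw [le_div_iff₀ hc, one_mul]
      exact g2.trans (by gcongr)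
    calc ‖entireXi v‖ ≤ C₁ * Real.exp (2 * (‖z‖ + δ)) * 1 := by
          rw [mul_one]; exact g1.trans (by gcongr)
      _ ≤ C₁ * Real.exp (2 * (‖z‖ + δ)) *
          (‖entireXi (v + δ)‖ * Real.exp (Real.pi * (‖z‖ + δ)) / c) := by gcongr
      _ = (C₁ / c * Real.exp ((2 + Real.pi) * δ) + 0) * Real.exp ((2 + Real.pi) * ‖z‖) *
          ‖entireXi (v + δ)‖ := by
        have e : Real.exp (2 * (‖z‖ + δ)) * Real.exp (Real.pi * (‖z‖ + δ)) =
            Real.exp ((2 + Real.pi) * δ) * Real.exp ((2 + Real.pi) * ‖z‖) := by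
          rw [← Real.exp_add, ← Real.exp_add]
          ring_nf
        linear_combination (C₁ * ‖entireXi (v + δ)‖ / c) * e
      _ ≤ _ := by gcongr
  · exact hlarge _ (by rw [ofReal_re]; linarith)
  · rw [hf, norm_div, ← norm_entireXi_one_sub_conj]
    refine (div_le_one (norm_pos_iff.mpr (hne _ (by simp)))).mpr (le_of_eq ?_)
    congr 2
    simp only [map_add, map_mul, conj_ofReal, conj_I]
    push_cast
    ring

/-- Horizontal monotonicity of the modulus of the entire function `s (s - 1) ξ(s)`. -/
lemma norm_entireXi_le_norm_add {δ : ℝ} (hδ : 1 ≤ δ) {w : ℂ} (hw : (1 - δ) / 2 ≤ w.re) :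
    ‖entireXi w‖ ≤ ‖entireXi (w + δ)‖ := by
  refine ge_of_tendsto (f := fun r : ℝ ↦ ‖entireXi (w + r)‖) (x := nhdsWithin δ (Set.Ioi δ)) ?_ ?_
  · have : Continuous fun r : ℝ ↦ ‖entireXi (w + r)‖ :=
      (differentiable_entireXi.continuous.comp (by fun_prop)).norm
    exact (this.tendsto δ).mono_left nhdsWithin_le_nhds
  · filter_upwards [self_mem_nhdsWithin] with r hr
    have hr : δ < r := hr
    exact norm_entireXi_le_norm_add_of_one_lt (by linarith) (by linarith)

lemma exists_bound_of_decay {Φ : ℂ → ℂ} {C R : ℝ}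
    (hd : ∀ s : ℂ, 1 / 2 ≤ s.re → DifferentiableAt ℂ Φ s)
    (hO : ∀ s : ℂ, 1 / 2 ≤ s.re → R ≤ ‖s‖ → ‖Φ s‖ * ‖s‖ ^ 2 ≤ C) :
    ∃ M, ∀ s : ℂ, 1 / 2 ≤ s.re → ‖Φ s‖ ≤ M := by
  obtain ⟨M, hM⟩ := ((isCompact_closedBall (0 : ℂ) R).inter_right
    (isClosed_le continuous_const continuous_re : IsClosed {s : ℂ | 1 / 2 ≤ s.re})
    ).exists_bound_of_continuousOn (f := Φ)
    fun s hs ↦ (hd s hs.2).continuousAt.continuousWithinAt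
  refine ⟨max M (4 * C), fun s hs ↦ ?_⟩
  rcases le_total ‖s‖ R with h | h
  · exact (hM s ⟨by simpa using h, hs⟩).trans (le_max_left _ _)
  · have h1 := hO s hs h
    have h2 : 1 / 2 ≤ ‖s‖ := hs.trans (re_le_norm s)
    refine le_trans ?_ (le_max_right _ _)
    nlinarith [norm_nonneg (Φ s), mul_le_mul h2 h2 (by norm_num) (norm_nonneg s)]

lemma re_nonneg_of_boundary {Φ : ℂ → ℂ} {C R : ℝ}
    (hd : ∀ s : ℂ, 1 / 2 ≤ s.re → DifferentiableAt ℂ Φ s)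
    (hO : ∀ s : ℂ, 1 / 2 ≤ s.re → R ≤ ‖s‖ → ‖Φ s‖ * ‖s‖ ^ 2 ≤ C)
    (hpos : ∀ s : ℂ, s.re = 1 / 2 → 0 ≤ (Φ s).re) {s : ℂ} (hs : 1 / 2 ≤ s.re) :
    0 ≤ (Φ s).re := by
  obtain ⟨M, hM⟩ := exists_bound_of_decay hd hO
  have hre : ∀ z : ℂ, ((1 / 2 : ℝ) + z).re = 1 / 2 + z.re := fun z ↦ by rw [add_re, ofReal_re]
  have hb : ∀ z : ℂ, 0 ≤ z.re → ‖exp (-Φ ((1 / 2 : ℝ) + z))‖ ≤ Real.exp M := fun z hz ↦ by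
    rw [norm_exp]
    refine Real.exp_le_exp.mpr ((re_le_norm _).trans ?_)
    rw [norm_neg]
    exact hM _ (by rw [hre]; linarith)
  have key := norm_le_of_exp_type (f := fun z ↦ exp (-Φ ((1 / 2 : ℝ) + z))) (A := Real.exp M)
    (B := 0) (X := 0) (K := Real.exp M) (C := 1) (z := s - (1 / 2 : ℝ))
    (fun z hz ↦ ?_) (fun z hz ↦ ?_) (fun x hx ↦ ?_) (fun y ↦ ?_)
    (by rw [sub_re, ofReal_re]; linarith)
  · rw [add_sub_cancel, norm_exp, Real.exp_le_one_iff, neg_re] at key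
    linarith
  · exact (DifferentiableAt.comp z (hd _ (by rw [hre]; linarith)) (by fun_prop)).neg.cexp
  · rw [zero_mul, Real.exp_zero, mul_one]
    exact hb z hz.le
  · exact hb x (by simpa using hx)
  · rw [norm_exp, Real.exp_le_one_iff, neg_re]
    have := hpos ((1 / 2 : ℝ) + y * I) (by simp)
    linarith

/-- A function in the half-plane `1/2 ≤ Re s` with non-negative real part on the boundary and
decaying like `s⁻²` vanishes. -/
lemma eq_zero_of_re_nonneg_of_decay {Φ : ℂ → ℂ} {C R : ℝ}
    (hd : ∀ s : ℂ, 1 / 2 ≤ s.re → DifferentiableAt ℂ Φ s)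
    (hO : ∀ s : ℂ, 1 / 2 ≤ s.re → R ≤ ‖s‖ → ‖Φ s‖ * ‖s‖ ^ 2 ≤ C)
    (hpos : ∀ s : ℂ, s.re = 1 / 2 → 0 ≤ (Φ s).re) {s : ℂ} (hs : 1 / 2 < s.re) : Φ s = 0 := by
  set σ := s.re - 1 / 2 with hσ
  have hσ0 : 0 < σ := by linarith
  have key : ∀ x : ℝ, 0 < x → R ≤ x → σ ^ 2 + s.im ^ 2 ≤ x * σ → ‖Φ s‖ ≤ 4 * |C| / σ * x⁻¹ := by
    intro x hx hRx hx2
    set z : ℂ := s - (1 / 2 + x : ℝ) with hz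
    have hz2 : ‖z‖ ^ 2 = (σ - x) ^ 2 + s.im ^ 2 := by
      rw [hz, ← normSq_eq_norm_sq, normSq_apply]
      simp only [sub_re, sub_im, ofReal_re, ofReal_im]
      rw [hσ]
      ring
    have hzx2 : x * σ ≤ x ^ 2 - ‖z‖ ^ 2 := by rw [hz2]; nlinarith
    have hzx : ‖z‖ < x := by
      have : 0 < x * σ := mul_pos hx hσ0
      exact lt_of_pow_lt_pow_left₀ 2 hx.le (by linarith)
    have hc : ∀ M : ℝ, 0 < M → ‖Φ s‖ ≤ 2 * M * ‖z‖ / (x - ‖z‖) +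
        ‖Φ (1 / 2 + x : ℝ)‖ * (x + ‖z‖) / (x - ‖z‖) := by
      intro M hM
      have hball : ∀ w ∈ Metric.ball (0 : ℂ) x, 1 / 2 ≤ ((1 / 2 + x : ℝ) + w).re := fun w hw ↦ by
        have h1 : ‖w‖ < x := by simpa using hw
        have h2 := abs_re_le_norm w
        have h3 := neg_abs_le w.re
        rw [add_re, ofReal_re]
        linarith
      have := borelCaratheodory (f := fun w ↦ -Φ ((1 / 2 + x : ℝ) + w)) hM
        (fun w hw ↦ ?_) (fun w hw ↦ ?_) hx (z := z) (by simpa using hzx)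
      · simpa only [norm_neg, add_zero, hz, add_sub_cancel] using this
      · exact (DifferentiableAt.comp w (hd _ (hball w hw)) (by fun_prop)
          ).neg.differentiableWithinAt
      · have := re_nonneg_of_boundary hd hO hpos (hball w hw)
        change (-Φ _).re ≤ M
        rw [neg_re]
        linarith
    have hc0 : ‖Φ s‖ ≤ ‖Φ (1 / 2 + x : ℝ)‖ * (x + ‖z‖) / (x - ‖z‖) := by
      refine le_of_forall_pos_le_add fun ε hε ↦ ?_
      have hd0 : 0 < x - ‖z‖ := by linarith
      refine (hc (ε * (x - ‖z‖) / (2 * (‖z‖ + 1))) (by positivity)).trans ?_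
      rw [add_comm]
      gcongr
      rw [div_le_iff₀ hd0]
      have h1 : 0 ≤ ‖z‖ := norm_nonneg z
      have : 2 * (ε * (x - ‖z‖) / (2 * (‖z‖ + 1))) * ‖z‖ =
        ε * (x - ‖z‖) * (‖z‖ / (‖z‖ + 1)) := by field_simp
      rw [this]
      exact mul_le_of_le_one_right (by positivity) ((div_le_one (by positivity)).mpr (by linarith))
    have hΦ : ‖Φ (1 / 2 + x : ℝ)‖ ≤ |C| / x ^ 2 := by
      have hn : ‖((1 / 2 + x : ℝ) : ℂ)‖ = 1 / 2 + x := by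
        rw [norm_real, Real.norm_of_nonneg (by linarith)]
      have h1 := hO (1 / 2 + x : ℝ) (by rw [ofReal_re]; linarith) (by rw [hn]; linarith)
      rw [hn] at h1
      rw [le_div_iff₀ (by positivity)]
      refine le_trans ?_ (h1.trans (le_abs_self C))
      gcongr
      linarith
    have hq : (x + ‖z‖) / (x - ‖z‖) ≤ 4 * x / σ := by
      rw [div_le_div_iff₀ (by linarith) hσ0]
      have h1 : 0 ≤ ‖z‖ := norm_nonneg z
      have h2 : (x + ‖z‖) * (x * σ) ≤ (x + ‖z‖) * ((x - ‖z‖) * (2 * x)) := by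
        refine mul_le_mul_of_nonneg_left ?_ (by linarith)
        nlinarith
      have h3 : x * ((x + ‖z‖) * σ) ≤ x * (2 * (x ^ 2 - ‖z‖ ^ 2)) := by nlinarith
      have h4 := le_of_mul_le_mul_left h3 hx
      nlinarith
    calc ‖Φ s‖ ≤ ‖Φ (1 / 2 + x : ℝ)‖ * ((x + ‖z‖) / (x - ‖z‖)) := by rwa [← mul_div_assoc]
      _ ≤ |C| / x ^ 2 * (4 * x / σ) := mul_le_mul hΦ hq
          (div_nonneg (by positivity) (by linarith)) (by positivity)
      _ = _ := by field_simp
  have hlim : Filter.Tendsto (fun x : ℝ ↦ 4 * |C| / σ * x⁻¹) Filter.atTop (nhds 0) := by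
    simpa using tendsto_inv_atTop_zero.const_mul (4 * |C| / σ)
  have : ‖Φ s‖ ≤ 0 := by
    refine ge_of_tendsto hlim ?_
    filter_upwards [Filter.eventually_gt_atTop 0, Filter.eventually_ge_atTop R,
      Filter.eventually_ge_atTop ((σ ^ 2 + s.im ^ 2) / σ)] with x h1 h2 h3
    exact key x h1 h2 ((div_le_iff₀ hσ0).mp h3)
  exact norm_le_zero_iff.mp this

lemma exists_factor_of_eq_zero {f : ℂ → ℂ} (hf : Differentiable ℂ f) {p : ℂ} (hp : f p = 0) :
    ∃ f₁ : ℂ → ℂ, Differentiable ℂ f₁ ∧ ∀ s, f s = (s - p) * f₁ s := by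
  refine ⟨dslope f p, ?_, fun s ↦ ?_⟩
  · have := (differentiableOn_dslope (Filter.univ_mem : Set.univ ∈ nhds p)).mpr hf.differentiableOn
    exact differentiableOn_univ.mp this
  · rw [← smul_eq_mul, sub_smul_dslope, hp, sub_zero]

/-- An entire function without zeros on the line `Re s = 1/2` either has three zeros to the right
of this line, or a quadratic polynomial is a multiple of it in the right half-plane. -/
lemma exists_three_zeros_or_mul_eq {f : ℂ → ℂ} (hf : Differentiable ℂ f)
    (h0 : ∀ s : ℂ, s.re = 1 / 2 → f s ≠ 0) :
    (∃ z₀ z₁ z₂ : ℂ, 1 / 2 < z₀.re ∧ 1 / 2 < z₁.re ∧ 1 / 2 < z₂.re ∧ ∃ f₃ : ℂ → ℂ,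
      Differentiable ℂ f₃ ∧ ∀ s, f s = (s - z₀) * (s - z₁) * (s - z₂) * f₃ s) ∨
    ∃ p₁ p₂ : ℂ, 1 / 2 < p₁.re ∧ 1 / 2 < p₂.re ∧ ∃ G : ℂ → ℂ,
      (∀ s : ℂ, 1 / 2 ≤ s.re → DifferentiableAt ℂ G s) ∧
      ∀ s : ℂ, 1 / 2 ≤ s.re → G s * f s = (s - p₁) * (s - p₂) := by
  have h1re : (1 / 2 : ℝ) < (1 : ℂ).re := by norm_num
  have split : ∀ g : ℂ → ℂ, (∀ s : ℂ, s.re = 1 / 2 → g s ≠ 0) →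
      (∃ z : ℂ, 1 / 2 < z.re ∧ g z = 0) ∨ ∀ s : ℂ, 1 / 2 ≤ s.re → g s ≠ 0 := by
    intro g hg
    by_cases h : ∃ z : ℂ, 1 / 2 < z.re ∧ g z = 0
    · exact .inl h
    · refine .inr fun s hs ↦ ?_
      rcases hs.lt_or_eq with h1 | h1
      · exact fun h2 ↦ h ⟨s, h1, h2⟩
      · exact hg s h1.symm
  rcases split f h0 with ⟨z₀, hz₀, hfz⟩ | hne
  swap
  · refine .inr ⟨1, 1, h1re, h1re, fun s ↦ (s - 1) * (s - 1) / f s, fun s hs ↦ ?_, fun s hs ↦ ?_⟩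
    · exact DifferentiableAt.div (by fun_prop) (hf s) (hne s hs)
    · exact div_mul_cancel₀ _ (hne s hs)
  obtain ⟨f₁, hf₁, e₁⟩ := exists_factor_of_eq_zero hf hfz
  rcases split f₁ (fun s hs h ↦ h0 s hs (by rw [e₁, h, mul_zero])) with ⟨z₁, hz₁, hfz₁⟩ | hne
  swap
  · refine .inr ⟨z₀, 1, hz₀, h1re, fun s ↦ (s - 1) / f₁ s, fun s hs ↦ ?_, fun s hs ↦ ?_⟩
    · exact DifferentiableAt.div (by fun_prop) (hf₁ s) (hne s hs)
    · have := hne s hs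
      rw [e₁]
      field_simp
  obtain ⟨f₂, hf₂, e₂⟩ := exists_factor_of_eq_zero hf₁ hfz₁
  rcases split f₂ (fun s hs h ↦ h0 s hs (by rw [e₁, e₂, h, mul_zero, mul_zero]))
    with ⟨z₂, hz₂, hfz₂⟩ | hne
  swap
  · refine .inr ⟨z₀, z₁, hz₀, hz₁, fun s ↦ 1 / f₂ s, fun s hs ↦ ?_, fun s hs ↦ ?_⟩
    · exact DifferentiableAt.div (by fun_prop) (hf₂ s) (hne s hs)
    · have := hne s hs
      rw [e₁, e₂]
      field_simp
  obtain ⟨f₃, hf₃, e₃⟩ := exists_factor_of_eq_zero hf₂ hfz₂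
  exact .inl ⟨z₀, z₁, z₂, hz₀, hz₁, hz₂, f₃, hf₃, fun s ↦ by rw [e₁, e₂, e₃]; ring⟩

lemma completedRiemannZeta_two : completedRiemannZeta 2 = (Real.pi / 6 : ℝ) := by
  have h : (Gammaℝ 2) = (Real.pi : ℂ)⁻¹ := by
    rw [Gammaℝ_def]
    norm_num [cpow_neg_one]
  have h0 : Gammaℝ 2 ≠ 0 := Gammaℝ_ne_zero_of_re_pos (by norm_num)
  have h1 := riemannZeta_def_of_ne_zero (two_ne_zero' ℂ)
  rw [riemannZeta_two, eq_div_iff h0, h] at h1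
  rw [← h1]
  have : (Real.pi : ℂ) ≠ 0 := by exact_mod_cast Real.pi_ne_zero
  push_cast
  field_simp

lemma entireXi_two : entireXi 2 = (Real.pi / 3 : ℝ) := by
  rw [entireXi_eq two_ne_zero (by norm_num), completedRiemannZeta_two]
  push_cast
  ring

/-- The coefficient of `E(2 s)` in `4 (s - 2)⁻¹ P(s) F(s)`, where `P` is the polynomial clearing the
denominators of `F = wengG2Pshort`. -/
noncomputable def wengW (s : ℂ) : ℂ :=
  (((Real.pi / 3 - 1 : ℝ) : ℂ) * s + 3) * (s - 1) ^ 2 * entireXi (s + 2)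
    - 2 * (s - 1) * (s - 3) * entireXi (s + 1) - (s + 2) * (s - 3) * entireXi s

noncomputable def wengV : ℂ → ℂ := dslope wengW (-1)

noncomputable def wengY (s : ℂ) : ℂ :=
  entireXi (2 * s) * wengV s - entireXi (2 * s - 1) * wengV (1 - s)

lemma differentiable_wengW : Differentiable ℂ wengW := by
  have := differentiable_entireXi
  unfold wengW
  fun_prop

lemma differentiable_wengV : Differentiable ℂ wengV := by
  have := (differentiableOn_dslope (c := (-1 : ℂ)) (Filter.univ_mem : Set.univ ∈ nhds (-1 : ℂ))).mpr
    differentiable_wengW.differentiableOn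
  exact differentiableOn_univ.mp this

lemma differentiable_wengY : Differentiable ℂ wengY := by
  have := differentiable_entireXi
  have := differentiable_wengV
  unfold wengY
  fun_prop

lemma entireXi_neg_one : entireXi (-1) = (Real.pi / 3 : ℝ) := by
  rw [← entireXi_two, ← entireXi_one_sub 2]
  norm_num

lemma wengW_eq (s : ℂ) : wengW s = (s + 1) * wengV s := by
  have h : wengW (-1) = 0 := by
    rw [wengW, entireXi_neg_one]
    norm_num [entireXi_zero, entireXi_one]
    ring
  have := sub_smul_dslope wengW (-1) s
  rw [h, sub_zero, smul_eq_mul, sub_neg_eq_add] at this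
  exact this.symm

lemma wengW_one_sub (s : ℂ) : wengW (1 - s) =
    (((Real.pi / 3 - 1 : ℝ) : ℂ) * (1 - s) + 3) * s ^ 2 * entireXi (s - 2)
    - 2 * s * (s + 2) * entireXi (s - 1) - (s - 3) * (s + 2) * entireXi s := by
  rw [wengW, ← entireXi_one_sub (1 - s + 2), ← entireXi_one_sub (1 - s + 1),
    ← entireXi_one_sub (1 - s)]
  ring_nf

lemma wengG2Pshort_mul_eq {s : ℂ} (hs : s ∉ ({-2, -1, 0, 1/2, 1, 2, 3} : Set ℂ)) :
    4 * (s ^ 2 * (s - 1) ^ 2 * (s + 2) * (s - 3) * (2 * s - 1)) * wengG2Pshort s = wengY s := by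
  simp only [Set.mem_insert_iff, Set.mem_singleton_iff, not_or] at hs
  obtain ⟨h1, h2, h3, h4, h5, h6, h7⟩ := hs
  have k1 : s + 2 ≠ 0 := fun h ↦ h1 (by linear_combination h)
  have k2 : s + 1 ≠ 0 := fun h ↦ h2 (by linear_combination h)
  have k3 : 2 * s - 1 ≠ 0 := fun h ↦ h4 (by linear_combination h / 2)
  have k4 : s - 1 ≠ 0 := sub_ne_zero.mpr h5
  have k5 : s - 2 ≠ 0 := sub_ne_zero.mpr h6
  have k6 : s - 3 ≠ 0 := sub_ne_zero.mpr h7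
  have e1 : wengV s = wengW s / (s + 1) := by rw [wengW_eq, mul_div_cancel_left₀ _ k2]
  have e2 : wengV (1 - s) = wengW (1 - s) / (2 - s) := by
    have : 2 - s ≠ 0 := fun h ↦ k5 (by linear_combination -h)
    rw [wengW_eq, show 1 - s + 1 = 2 - s by ring, mul_div_cancel_left₀ _ this]
  have k7 : 2 - s ≠ 0 := fun h ↦ k5 (by linear_combination -h)
  have k8 : 2 * s - 2 ≠ 0 := fun h ↦ k4 (by linear_combination h / 2)
  rw [wengY, e1, e2, wengW_one_sub, wengW, entireXi_eq k1 (fun h ↦ h2 (by linear_combination h)),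
    entireXi_eq k2 (fun h ↦ h3 (by linear_combination h)), entireXi_eq h3 h5,
    entireXi_eq k4 (fun h ↦ h6 (by linear_combination h)),
    entireXi_eq k5 (fun h ↦ h7 (by linear_combination h)),
    entireXi_eq (w := 2 * s) (mul_ne_zero two_ne_zero h3) (fun h ↦ k3 (by linear_combination h)),
    entireXi_eq k3 (fun h ↦ k8 (by linear_combination h)), wengG2Pshort, completedRiemannZeta_two]
  push_cast
  generalize completedRiemannZeta (s + 2) = x1
  generalize completedRiemannZeta (s + 1) = x2
  generalize completedRiemannZeta s = x3
  generalize completedRiemannZeta (s - 1) = x4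
  generalize completedRiemannZeta (s - 2) = x5
  generalize completedRiemannZeta (2 * s) = x6
  generalize completedRiemannZeta (2 * s - 1) = x7
  rw [show 2 - s = -(s - 2) by ring, show 2 * s - 2 = 2 * (s - 1) by ring]
  field_simp
  ring

lemma wengG2Pshort_one_sub (s : ℂ) : wengG2Pshort (1 - s) = wengG2Pshort s := by
  have f := completedRiemannZeta_one_sub
  have e1 : ξ (1 - s + 2) = ξ (s - 2) := by rw [← f (s - 2)]; ring_nf
  have e2 : ξ (1 - s + 1) = ξ (s - 1) := by rw [← f (s - 1)]; ring_nf
  have e3 : ξ (1 - s - 1) = ξ (s + 1) := by rw [← f (s + 1)]; ring_nf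
  have e4 : ξ (1 - s - 2) = ξ (s + 2) := by rw [← f (s + 2)]; ring_nf
  have e5 : ξ (2 * (1 - s)) = ξ (2 * s - 1) := by rw [← f (2 * s - 1)]; ring_nf
  have e6 : ξ (2 * (1 - s) - 1) = ξ (2 * s) := by rw [← f (2 * s)]; ring_nf
  rw [wengG2Pshort, wengG2Pshort, e1, e2, e3, e4, e5, e6, f]
  rw [show 1 - s - 3 = -(s + 2) by ring, show 1 - s + 2 = -(s - 3) by ring,
    show 2 * (1 - s) - 2 = -(2 * s) by ring, show 2 * (1 - s) = -(2 * s - 2) by ring,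
    show 1 - s - 1 = -s by ring, show 1 - s + 1 = -(s - 2) by ring,
    show 1 - s - 2 = -(s + 1) by ring, show (1 - s) * -(s + 2) = (s - 1) * (s + 2) by ring,
    show -s * -(s - 3) = s * (s - 3) by ring]
  simp only [div_neg, neg_mul, mul_neg]
  ring

lemma pi_div_three_sub_one_mem : (0.047197 : ℝ) < Real.pi / 3 - 1 ∧ Real.pi / 3 - 1 < 0.0471977 := by
  have := Real.pi_gt_d6
  have := Real.pi_lt_d6
  constructor <;> linarith

lemma norm_entireXi_add_one_le {s : ℂ} (hs : 1 / 2 ≤ s.re) :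
    ‖entireXi (s + 1)‖ ≤ ‖entireXi (s + 2)‖ := by
  have := norm_entireXi_le_norm_add (δ := 1) le_rfl (w := s + 1) (by simp; linarith)
  rwa [ofReal_one, add_assoc, one_add_one_eq_two] at this

lemma norm_entireXi_self_le {s : ℂ} (hs : 1 / 2 ≤ s.re) :
    ‖entireXi s‖ ≤ ‖entireXi (s + 2)‖ := by
  simpa using norm_entireXi_le_norm_add (δ := 2) (by norm_num) (w := s) (by norm_num; linarith)

lemma norm_entireXi_sub_one_le {s : ℂ} (hs : 1 / 2 ≤ s.re) :
    ‖entireXi (s - 1)‖ ≤ ‖entireXi (s + 2)‖ := by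
  have := norm_entireXi_le_norm_add (δ := 3) (by norm_num) (w := s - 1) (by simp; linarith)
  rwa [show s - 1 + (3 : ℝ) = s + 2 by push_cast; ring] at this

lemma norm_entireXi_sub_two_le {s : ℂ} (hs : 1 / 2 ≤ s.re) :
    ‖entireXi (s - 2)‖ ≤ ‖entireXi (s + 2)‖ := by
  have := norm_entireXi_le_norm_add (δ := 4) (by norm_num) (w := s - 2) (by simp; linarith)
  rwa [show s - 2 + (4 : ℝ) = s + 2 by push_cast; ring] at this

lemma norm_add_natCast_le {s : ℂ} (hs : 1 ≤ ‖s‖) (n : ℕ) : ‖s + n‖ ≤ (n + 1) * ‖s‖ := by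
  refine (norm_add_le _ _).trans ?_
  rw [norm_natCast]
  nlinarith [n.cast_nonneg (α := ℝ)]

lemma norm_sub_natCast_le {s : ℂ} (hs : 1 ≤ ‖s‖) (n : ℕ) : ‖s - n‖ ≤ (n + 1) * ‖s‖ := by
  refine (norm_sub_le _ _).trans ?_
  rw [norm_natCast]
  nlinarith [n.cast_nonneg (α := ℝ)]

lemma norm_wengW_sub_le {s : ℂ} (hs : 1 / 2 ≤ s.re) (h1 : 1 ≤ ‖s‖) :
    ‖wengW s - ((Real.pi / 3 - 1 : ℝ) : ℂ) * s ^ 3 * entireXi (s + 2)‖ ≤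
      43 * ‖s‖ ^ 2 * ‖entireXi (s + 2)‖ := by
  obtain ⟨ha, hb⟩ := pi_div_three_sub_one_mem
  set c := Real.pi / 3 - 1 with hc
  have e : wengW s - (c : ℂ) * s ^ 3 * entireXi (s + 2) =
      (((3 - 2 * c : ℝ) : ℂ) * s ^ 2 + ((c - 6 : ℝ) : ℂ) * s + 3) * entireXi (s + 2)
      - 2 * (s - 1) * (s - 3) * entireXi (s + 1) - (s + 2) * (s - 3) * entireXi s := by
    rw [wengW, ← hc]
    push_cast
    ring
  have n1 := norm_sub_natCast_le h1 1
  have n3 := norm_sub_natCast_le h1 3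
  have n2 := norm_add_natCast_le h1 2
  norm_num at n1 n2 n3
  have q1 : ‖((3 - 2 * c : ℝ) : ℂ) * s ^ 2 + ((c - 6 : ℝ) : ℂ) * s + 3‖ ≤ 12 * ‖s‖ ^ 2 := by
    refine (norm_add₃_le).trans ?_
    rw [norm_mul, norm_mul, norm_pow, norm_real, norm_real, Real.norm_of_nonneg (by linarith),
      Real.norm_of_nonpos (by linarith)]
    norm_num
    nlinarith
  have q2 : ‖2 * (s - 1) * (s - 3)‖ ≤ 16 * ‖s‖ ^ 2 := by
    rw [norm_mul, norm_mul]
    norm_num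
    nlinarith [mul_le_mul n1 n3 (norm_nonneg _) (by positivity)]
  have q3 : ‖(s + 2) * (s - 3)‖ ≤ 12 * ‖s‖ ^ 2 := by
    rw [norm_mul]
    nlinarith [mul_le_mul n2 n3 (norm_nonneg _) (by positivity)]
  rw [e]
  refine (norm_sub_le _ _).trans ((add_le_add (norm_sub_le _ _) le_rfl).trans ?_)
  rw [norm_mul _ (entireXi (s + 2)), norm_mul _ (entireXi (s + 1)), norm_mul _ (entireXi s)]
  have := mul_le_mul_of_nonneg_right q1 (norm_nonneg (entireXi (s + 2)))
  have := mul_le_mul q2 (norm_entireXi_add_one_le hs) (norm_nonneg _) (by positivity)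
  have := mul_le_mul q3 (norm_entireXi_self_le hs) (norm_nonneg _) (by positivity)
  have := mul_nonneg (sq_nonneg ‖s‖) (norm_nonneg (entireXi (s + 2)))
  linarith

lemma norm_wengW_one_sub_add_le {s : ℂ} (hs : 1 / 2 ≤ s.re) (h1 : 1 ≤ ‖s‖) :
    ‖wengW (1 - s) + ((Real.pi / 3 - 1 : ℝ) : ℂ) * s ^ 3 * entireXi (s - 2)‖ ≤
      22 * ‖s‖ ^ 2 * ‖entireXi (s + 2)‖ := by
  obtain ⟨ha, hb⟩ := pi_div_three_sub_one_mem
  set c := Real.pi / 3 - 1 with hc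
  have e : wengW (1 - s) + (c : ℂ) * s ^ 3 * entireXi (s - 2) =
      (((c + 3 : ℝ) : ℂ) * s ^ 2) * entireXi (s - 2)
      - 2 * s * (s + 2) * entireXi (s - 1) - (s - 3) * (s + 2) * entireXi s := by
    rw [wengW_one_sub, ← hc]
    push_cast
    ring
  have n3 := norm_sub_natCast_le h1 3
  have n2 := norm_add_natCast_le h1 2
  norm_num at n2 n3
  have q1 : ‖((c + 3 : ℝ) : ℂ) * s ^ 2‖ ≤ 4 * ‖s‖ ^ 2 := by
    rw [norm_mul, norm_pow, norm_real, Real.norm_of_nonneg (by linarith)]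
    nlinarith [sq_nonneg ‖s‖]
  have q2 : ‖2 * s * (s + 2)‖ ≤ 6 * ‖s‖ ^ 2 := by
    rw [norm_mul, norm_mul]
    norm_num
    nlinarith
  have q3 : ‖(s - 3) * (s + 2)‖ ≤ 12 * ‖s‖ ^ 2 := by
    rw [norm_mul]
    nlinarith [mul_le_mul n2 n3 (norm_nonneg _) (by positivity)]
  rw [e]
  refine (norm_sub_le _ _).trans ((add_le_add (norm_sub_le _ _) le_rfl).trans ?_)
  rw [norm_mul _ (entireXi (s - 2)), norm_mul _ (entireXi (s - 1)), norm_mul _ (entireXi s)]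
  have := mul_le_mul q1 (norm_entireXi_sub_two_le hs) (norm_nonneg _) (by positivity)
  have := mul_le_mul q2 (norm_entireXi_sub_one_le hs) (norm_nonneg _) (by positivity)
  have := mul_le_mul q3 (norm_entireXi_self_le hs) (norm_nonneg _) (by positivity)
  linarith

lemma norm_wengW_le {s : ℂ} (hs : 1 / 2 ≤ s.re) (h1 : 1 ≤ ‖s‖) :
    ‖wengW s‖ ≤ 44 * ‖s‖ ^ 3 * ‖entireXi (s + 2)‖ := by
  obtain ⟨ha, hb⟩ := pi_div_three_sub_one_mem
  have h := norm_wengW_sub_le hs h1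
  set c := Real.pi / 3 - 1
  have h2 := norm_le_norm_sub_add (wengW s) ((c : ℂ) * s ^ 3 * entireXi (s + 2))
  rw [norm_mul _ (entireXi (s + 2)), norm_mul, norm_pow, norm_real,
    Real.norm_of_nonneg (by linarith)] at h2
  have h3 : ‖s‖ ^ 2 ≤ ‖s‖ ^ 3 := pow_le_pow_right₀ h1 (by norm_num)
  have h4 := mul_le_mul_of_nonneg_right h3 (norm_nonneg (entireXi (s + 2)))
  have h5 : c * (‖s‖ ^ 3 * ‖entireXi (s + 2)‖) ≤ 1 * (‖s‖ ^ 3 * ‖entireXi (s + 2)‖) := by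
    gcongr
    linarith
  linarith

lemma norm_wengW_ge {s : ℂ} (hs : 1 / 2 ≤ s.re) (h1 : 2000 ≤ ‖s‖) :
    0.02 * ‖s‖ ^ 3 * ‖entireXi (s + 2)‖ ≤ ‖wengW s‖ := by
  obtain ⟨ha, hb⟩ := pi_div_three_sub_one_mem
  have h := norm_wengW_sub_le hs (by linarith)
  set c := Real.pi / 3 - 1
  have h2 := norm_le_norm_sub_add ((c : ℂ) * s ^ 3 * entireXi (s + 2)) (wengW s)
  rw [norm_sub_rev, norm_mul _ (entireXi (s + 2)), norm_mul, norm_pow, norm_real,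
    Real.norm_of_nonneg (by linarith)] at h2
  have h5 : 43 * ‖s‖ ^ 2 + 0.02 * ‖s‖ ^ 3 ≤ c * ‖s‖ ^ 3 := by
    have h6 : 43 + 0.02 * ‖s‖ ≤ c * ‖s‖ := by nlinarith
    have := mul_le_mul_of_nonneg_right h6 (sq_nonneg ‖s‖)
    linarith
  have h6 := mul_le_mul_of_nonneg_right h5 (norm_nonneg (entireXi (s + 2)))
  linarith

lemma norm_wengW_one_sub_le {s : ℂ} (hs : 1 / 2 ≤ s.re) (h1 : 1 ≤ ‖s‖) :
    ‖wengW (1 - s)‖ ≤ 23 * ‖s‖ ^ 3 * ‖entireXi (s + 2)‖ := by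
  obtain ⟨ha, hb⟩ := pi_div_three_sub_one_mem
  have h := norm_wengW_one_sub_add_le hs h1
  set c := Real.pi / 3 - 1
  have h2 := norm_le_norm_sub_add (wengW (1 - s)) (-((c : ℂ) * s ^ 3 * entireXi (s - 2)))
  rw [sub_neg_eq_add, norm_neg, norm_mul _ (entireXi (s - 2)), norm_mul, norm_pow, norm_real,
    Real.norm_of_nonneg (by linarith)] at h2
  have h3 : ‖s‖ ^ 2 ≤ ‖s‖ ^ 3 := pow_le_pow_right₀ h1 (by norm_num)
  have h4 := mul_le_mul_of_nonneg_right h3 (norm_nonneg (entireXi (s + 2)))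
  have h5 : c * ‖s‖ ^ 3 * ‖entireXi (s - 2)‖ ≤ 1 * ‖s‖ ^ 3 * ‖entireXi (s + 2)‖ := by
    gcongr
    · linarith
    · exact norm_entireXi_sub_two_le hs
  linarith

lemma entireXi_add_two_ne_zero {s : ℂ} (hs : 1 / 2 ≤ s.re) : entireXi (s + 2) ≠ 0 :=
  entireXi_ne_zero (by simp; linarith)

lemma entireXi_two_mul_ne_zero {s : ℂ} (hs : 1 / 2 ≤ s.re) : entireXi (2 * s) ≠ 0 :=
  entireXi_ne_zero (by simp; linarith)

lemma wengW_ne_zero_of_large {s : ℂ} (hs : 1 / 2 ≤ s.re) (h1 : 2000 ≤ ‖s‖) : wengW s ≠ 0 := by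
  intro h
  have h2 := norm_wengW_ge hs h1
  have h3 := norm_pos_iff.mpr (entireXi_add_two_ne_zero hs)
  have : 0 < ‖s‖ := by linarith
  rw [h, norm_zero] at h2
  have : 0 < 0.02 * ‖s‖ ^ 3 * ‖entireXi (s + 2)‖ := by positivity
  linarith

lemma norm_entireXi_two_mul_sub_one_le {s : ℂ} (hs : 1 / 2 ≤ s.re) :
    ‖entireXi (2 * s - 1)‖ ≤ ‖entireXi (2 * s)‖ := by
  have := norm_entireXi_le_norm_add (δ := 1) le_rfl (w := 2 * s - 1) (by simp; linarith)
  rwa [ofReal_one, sub_add_cancel] at this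

lemma norm_wengV_one_sub_le {s : ℂ} (hs : 1 / 2 ≤ s.re) (h1 : 2000 ≤ ‖s‖) :
    ‖wengV (1 - s)‖ ≤ 2300 * ‖wengV s‖ := by
  have h2 := norm_wengW_one_sub_le hs (by linarith)
  have h3 := norm_wengW_ge hs h1
  rw [wengW_eq, norm_mul] at h2 h3
  have h4 : ‖s‖ - 2 ≤ ‖1 - s + 1‖ := by
    have := norm_sub_norm_le s 2
    rw [norm_sub_rev, show (2 : ℂ) - s = 1 - s + 1 by ring] at this
    simpa using this
  have h5 : ‖s + 1‖ ≤ ‖s‖ + 1 := by simpa using norm_add_le s 1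
  have h6 : (‖s‖ - 2) * ‖wengV (1 - s)‖ ≤ 1150 * ((‖s‖ + 1) * ‖wengV s‖) := by
    have := mul_le_mul_of_nonneg_right h4 (norm_nonneg (wengV (1 - s)))
    have := mul_le_mul_of_nonneg_right h5 (norm_nonneg (wengV s))
    linarith
  have h7 : 1150 * ((‖s‖ + 1) * ‖wengV s‖) ≤ (‖s‖ - 2) * (2300 * ‖wengV s‖) := by
    nlinarith [norm_nonneg (wengV s)]
  exact le_of_mul_le_mul_left (h6.trans h7) (by linarith)

lemma norm_wengY_le {s : ℂ} (hs : 1 / 2 ≤ s.re) (h1 : 2000 ≤ ‖s‖) :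
    ‖wengY s‖ ≤ 2301 * (‖entireXi (2 * s)‖ * ‖wengV s‖) := by
  refine (norm_sub_le _ _).trans ?_
  rw [norm_mul, norm_mul]
  have := mul_le_mul (norm_entireXi_two_mul_sub_one_le hs) (norm_wengV_one_sub_le hs h1)
    (norm_nonneg _) (norm_nonneg _)
  linarith

lemma wengW_conj (s : ℂ) : wengW ((starRingEnd ℂ) s) = (starRingEnd ℂ) (wengW s) := by
  simp only [wengW, map_sub, map_mul, map_add, map_pow, conj_ofReal, map_one, map_ofNat,
    ← entireXi_conj]

lemma wengV_conj {s : ℂ} (hs : s ≠ -1) : wengV ((starRingEnd ℂ) s) = (starRingEnd ℂ) (wengV s) := by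
  have h1 : s + 1 ≠ 0 := fun h ↦ hs (by linear_combination h)
  have h2 : (starRingEnd ℂ) s + 1 ≠ 0 := fun h ↦ h1 (by
    have := congrArg (starRingEnd ℂ) h
    simpa using this)
  have h3 := wengW_conj s
  rw [wengW_eq, wengW_eq, map_mul, map_add, map_one] at h3
  exact mul_left_cancel₀ h2 h3

lemma wengY_eq (s : ℂ) : wengY s =
    entireXi (2 * s) * wengV s - entireXi (2 * (1 - s)) * wengV (1 - s) := by
  rw [wengY, ← entireXi_one_sub (2 * s - 1)]
  ring_nf

lemma wengY_conj {s : ℂ} (h1 : s ≠ -1) (h2 : s ≠ 2) :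
    wengY ((starRingEnd ℂ) s) = (starRingEnd ℂ) (wengY s) := by
  have e1 : 2 * (starRingEnd ℂ) s = (starRingEnd ℂ) (2 * s) := by rw [map_mul, map_ofNat]
  have e2 : 1 - (starRingEnd ℂ) s = (starRingEnd ℂ) (1 - s) := by simp
  have e3 : 2 * (starRingEnd ℂ) (1 - s) = (starRingEnd ℂ) (2 * (1 - s)) := by
    rw [map_mul, map_ofNat]
  rw [wengY_eq, wengY_eq, e2, e1, e3, entireXi_conj, entireXi_conj, wengV_conj h1,
    wengV_conj fun h ↦ h2 (by linear_combination -h), ← map_mul, ← map_mul, ← map_sub]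

lemma wengW_one : wengW 1 = 6 := by
  norm_num [wengW, entireXi_one]

lemma wengY_one : wengY 1 = 0 := by
  have h1 := wengW_eq 1
  have h0 := wengW_eq 0
  rw [wengW_one] at h1
  rw [wengW] at h0
  norm_num [entireXi_zero, entireXi_one, entireXi_two] at h0 h1
  rw [wengY]
  norm_num [entireXi_one, entireXi_two]
  linear_combination (-(Real.pi : ℂ) / 6) * h1 + h0

lemma exists_entireXi_ofReal_eq {x : ℝ} (hx : 1 ≤ x) : ∃ e : ℝ, 1 ≤ e ∧ entireXi x = e := by
  obtain ⟨c, hc0, hc, -⟩ := exists_coeff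
  have h := hc (x - 1 / 2)
  rw [add_sub_cancel] at h
  have h1 : HasSum (fun k ↦ c k * (x - 1 / 2) ^ (2 * k)) (completedRiemannZeta₀ x).re := by
    have := hasSum_re h
    convert this using 2 with k
    have : (c k : ℂ) * ((x : ℂ) - 1 / 2) ^ (2 * k) = ((c k * (x - 1 / 2) ^ (2 * k) : ℝ) : ℂ) := by
      push_cast; rfl
    rw [this, ofReal_re]
  have h2 : 0 ≤ (completedRiemannZeta₀ x).re :=
    h1.nonneg fun k ↦ mul_nonneg (hc0 k) (by rw [pow_mul]; positivity)
  have h3 : completedRiemannZeta₀ x = ((completedRiemannZeta₀ x).re : ℂ) :=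
    (conj_eq_iff_re.mp (by rw [← completedRiemannZeta₀_conj, conj_ofReal])).symm
  refine ⟨1 + x * (x - 1) * (completedRiemannZeta₀ x).re, ?_, ?_⟩
  · have : 0 ≤ x * (x - 1) := mul_nonneg (by linarith) (by linarith)
    nlinarith [mul_nonneg this h2]
  · rw [entireXi, h3]
    push_cast
    simp

/-- The function `s (s - 1) ξ(s)` grows under a shift by `2`. -/
lemma exists_norm_entireXi_mul_norm_le : ∃ K, 0 < K ∧ ∀ w : ℂ, 4 ≤ w.re →
    ‖entireXi w‖ * ‖w‖ ≤ K * ‖entireXi (w + 2)‖ := by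
  set Z := ∑' n : ℕ, 1 / (n : ℝ) ^ (4 : ℝ)
  have hZ : 0 < Z := by
    have := one_le_norm_riemannZeta_mul (σ := 4) (by norm_num) (w := (4 : ℂ)) (by simp)
    by_contra hZ
    nlinarith [norm_nonneg (riemannZeta 4)]
  refine ⟨2 * Real.pi * Z ^ 2, by have := Real.pi_pos; positivity, fun w hw ↦ ?_⟩
  have hw0 : w ≠ 0 := by rintro rfl; norm_num at hw
  have hshift : ∀ x y : ℝ, y ≤ w.re → x ≤ y → ‖w - y‖ ≤ ‖w - x‖ := by
    intro x y hx hxy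
    rw [norm_eq_sqrt_sq_add_sq, norm_eq_sqrt_sq_add_sq]
    refine Real.sqrt_le_sqrt ?_
    simp
    nlinarith
  have n1 : ‖w‖ ≤ ‖w + 2‖ := by
    have := hshift (-2) 0 (by linarith) (by norm_num)
    push_cast at this
    simpa using this
  have n2 : ‖w - 1‖ ≤ ‖w + 2 - 1‖ := by
    have := hshift (-1) 1 (by linarith) (by norm_num)
    rw [show w + 2 - 1 = w + 1 by ring]
    push_cast at this
    simpa using this
  have h4 := norm_riemannZeta_le (σ := 4) (by norm_num) hw
  have h5 := one_le_norm_riemannZeta_mul (σ := 4) (by norm_num) (w := w + 2)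
    (by rw [add_re]; norm_num; linarith)
  have h6 : ‖riemannZeta w‖ ≤ Z ^ 2 * ‖riemannZeta (w + 2)‖ := by
    calc ‖riemannZeta w‖ ≤ Z * 1 := by rw [mul_one]; exact h4
      _ ≤ Z * (‖riemannZeta (w + 2)‖ * Z) := by gcongr
      _ = _ := by ring
  have hpi : (Real.pi : ℂ) ≠ 0 := by exact_mod_cast Real.pi_ne_zero
  have h7 : ‖Gammaℝ w‖ * ‖w‖ = 2 * Real.pi * ‖Gammaℝ (w + 2)‖ := by
    rw [Gammaℝ_add_two hw0]
    simp only [norm_mul, norm_div, norm_real, Real.norm_of_nonneg Real.pi_pos.le, norm_ofNat]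
    have := Real.pi_ne_zero
    field_simp
  rw [entireXi_eq_Gammaℝ (by linarith), entireXi_eq_Gammaℝ (by rw [add_re]; norm_num; linarith)]
  simp only [norm_mul]
  have := Real.pi_pos
  calc ‖w‖ * ‖w - 1‖ * (‖Gammaℝ w‖ * ‖riemannZeta w‖) * ‖w‖ =
      ‖w‖ * ‖w - 1‖ * ((‖Gammaℝ w‖ * ‖w‖) * ‖riemannZeta w‖) := by ring
    _ ≤ ‖w + 2‖ * ‖w + 2 - 1‖ *
        ((2 * Real.pi * ‖Gammaℝ (w + 2)‖) * (Z ^ 2 * ‖riemannZeta (w + 2)‖)) := by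
        rw [h7]; gcongr
    _ = _ := by ring

lemma eventually_wengY_pos : ∃ X : ℝ, ∀ x : ℝ, X ≤ x → 0 < (wengY x).re := by
  obtain ⟨ha, hb⟩ := pi_div_three_sub_one_mem
  obtain ⟨K, hK, hKle⟩ := exists_norm_entireXi_mul_norm_le
  refine ⟨6000 + 2 * K, fun x hx ↦ ?_⟩
  have hnx : ‖(x : ℂ)‖ = x := by rw [norm_real, Real.norm_of_nonneg (by linarith)]
  have hxre : 1 / 2 ≤ (x : ℂ).re := by rw [ofReal_re]; linarith
  obtain ⟨e, he1, he⟩ := exists_entireXi_ofReal_eq (x := x + 2) (by linarith)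
  obtain ⟨e', he1', he'⟩ := exists_entireXi_ofReal_eq (x := 2 * x) (by linarith)
  push_cast at he he'
  have hW := norm_wengW_sub_le hxre (by rw [hnx]; linarith)
  have hW' := norm_wengW_one_sub_add_le hxre (by rw [hnx]; linarith)
  have hQ := norm_entireXi_two_mul_sub_one_le hxre
  have hsm := hKle (x - 2 : ℝ) (by rw [ofReal_re]; linarith)
  have hself := norm_entireXi_self_le hxre
  set c := Real.pi / 3 - 1
  rw [he, hnx, norm_real, Real.norm_of_nonneg (by linarith)] at hW hW'
  rw [he, norm_real e, Real.norm_of_nonneg (by linarith)] at hself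
  rw [he', norm_real, Real.norm_of_nonneg (by linarith)] at hQ
  rw [norm_real, Real.norm_of_nonneg (by linarith)] at hsm
  push_cast at hsm
  rw [sub_add_cancel] at hsm
  have hE2 : ‖entireXi (x - 2)‖ ≤ e / 2 := by
    have : ‖entireXi (x - 2)‖ * (x - 2) ≤ K * e := hsm.trans (by gcongr)
    nlinarith [norm_nonneg (entireXi ((x : ℂ) - 2))]
  have hWre : (c * x ^ 3 - 43 * x ^ 2) * e ≤ (wengW x).re := by
    have h1 := (abs_le.mp ((abs_re_le_norm _).trans hW)).1
    have h2 : (c : ℂ) * (x : ℂ) ^ 3 * (e : ℂ) = ((c * x ^ 3 * e : ℝ) : ℂ) := by push_cast; rfl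
    rw [h2, sub_re, ofReal_re] at h1
    linarith
  have hWn : ‖wengW (1 - x)‖ ≤ (c * x ^ 3 / 2 + 22 * x ^ 2) * e := by
    have h2 := norm_le_norm_sub_add (wengW (1 - x)) (-((c : ℂ) * (x : ℂ) ^ 3 * entireXi (x - 2)))
    rw [sub_neg_eq_add, norm_neg, norm_mul _ (entireXi (x - 2)), norm_mul, norm_pow, norm_real,
      norm_real, Real.norm_of_nonneg (by linarith), Real.norm_of_nonneg (by linarith)] at h2
    have h3 : c * x ^ 3 * ‖entireXi (x - 2)‖ ≤ c * x ^ 3 * (e / 2) := by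
      have : 0 ≤ c * x ^ 3 := mul_nonneg (by linarith) (pow_nonneg (by linarith) 3)
      gcongr
    linarith
  rw [wengW_eq] at hWre hWn
  have h1 : (((x : ℂ) + 1) * wengV x).re = (x + 1) * (wengV x).re := by
    rw [← ofReal_one, ← ofReal_add, re_ofReal_mul]
  rw [h1] at hWre
  rw [norm_mul, show (1 : ℂ) - x + 1 = -((x - 2 : ℝ) : ℂ) by push_cast; ring, norm_neg, norm_real,
    Real.norm_of_nonneg (by linarith)] at hWn
  have hmain : ‖wengV (1 - x)‖ < (wengV x).re := by
    have h2 : (x + 1) * ((c * x ^ 3 / 2 + 22 * x ^ 2) * e) <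
        (x - 2) * ((c * x ^ 3 - 43 * x ^ 2) * e) := by
      have hx2 : 0 < x ^ 2 * e := by
        have : 0 < x := by linarith
        positivity
      have h3 : (x + 1) * (c * x / 2 + 22) < (x - 2) * (c * x - 43) := by
        have : 282 ≤ c * x := by nlinarith
        nlinarith
      nlinarith [mul_lt_mul_of_pos_right h3 hx2]
    have h3 : (x + 1) * ((x - 2) * ‖wengV (1 - x)‖) < (x - 2) * ((x + 1) * (wengV x).re) := by
      refine (mul_le_mul_of_nonneg_left hWn (by linarith)).trans_lt (h2.trans_le ?_)
      exact mul_le_mul_of_nonneg_left hWre (by linarith)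
    have h4 : 0 < (x + 1) * (x - 2) := mul_pos (by linarith) (by linarith)
    nlinarith
  rw [wengY, sub_re, he', re_ofReal_mul]
  have h5 := (re_le_norm (entireXi (2 * x - 1) * wengV (1 - x)))
  rw [norm_mul] at h5
  have h6 : ‖entireXi (2 * x - 1)‖ * ‖wengV (1 - x)‖ ≤ e' * ‖wengV (1 - x)‖ := by gcongr
  have h7 : e' * ‖wengV (1 - x)‖ < e' * (wengV x).re := by
    have : 0 < e' := by linarith
    gcongr
  linarith

/-- The product of three linear factors. -/
def linProd (z₀ z₁ z₂ s : ℂ) : ℂ := (s - z₀) * (s - z₁) * (s - z₂)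

lemma linProd_ne_zero {z₀ z₁ z₂ s : ℂ} (h₀ : s ≠ z₀) (h₁ : s ≠ z₁) (h₂ : s ≠ z₂) :
    linProd z₀ z₁ z₂ s ≠ 0 :=
  mul_ne_zero (mul_ne_zero (sub_ne_zero.mpr h₀) (sub_ne_zero.mpr h₁)) (sub_ne_zero.mpr h₂)

lemma one_sub_ne_conj {s z : ℂ} (hs : 1 / 2 ≤ s.re) (hz : 1 / 2 < z.re) :
    1 - s ≠ (starRingEnd ℂ) z := fun h ↦ by
  have := congrArg re h
  simp at this
  linarith

lemma half_norm_le_norm_sub {s z : ℂ} (h : 2 * ‖z‖ ≤ ‖s‖) : ‖s‖ / 2 ≤ ‖s - z‖ := by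
  have := norm_sub_norm_le s z
  linarith

lemma half_norm_le_norm_one_sub_sub {s z : ℂ} (h : 2 * (‖z‖ + 1) ≤ ‖s‖) :
    ‖s‖ / 2 ≤ ‖1 - s - (starRingEnd ℂ) z‖ := by
  have h1 : 1 - s - (starRingEnd ℂ) z = -(s - (1 - (starRingEnd ℂ) z)) := by ring
  rw [h1, norm_neg]
  refine half_norm_le_norm_sub ?_
  have := norm_sub_le 1 ((starRingEnd ℂ) z)
  rw [norm_conj, norm_one] at this
  linarith

lemma norm_linProd_mul_ge {z₀ z₁ z₂ s : ℂ} (h₀ : 2 * (‖z₀‖ + 1) ≤ ‖s‖) (h₁ : 2 * (‖z₁‖ + 1) ≤ ‖s‖)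
    (h₂ : 2 * (‖z₂‖ + 1) ≤ ‖s‖) : ‖s‖ ^ 6 / 64 ≤ ‖linProd z₀ z₁ z₂ s‖ *
      ‖linProd ((starRingEnd ℂ) z₀) ((starRingEnd ℂ) z₁) ((starRingEnd ℂ) z₂) (1 - s)‖ := by
  simp only [linProd, norm_mul]
  calc ‖s‖ ^ 6 / 64 = ((‖s‖ / 2) * (‖s‖ / 2) * (‖s‖ / 2)) * ((‖s‖ / 2) * (‖s‖ / 2) * (‖s‖ / 2)) := by
        ring
    _ ≤ _ := by
      gcongr
      · exact half_norm_le_norm_sub (by linarith)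
      · exact half_norm_le_norm_sub (by linarith)
      · exact half_norm_le_norm_sub (by linarith)
      · exact half_norm_le_norm_one_sub_sub h₀
      · exact half_norm_le_norm_one_sub_sub h₁
      · exact half_norm_le_norm_one_sub_sub h₂

lemma one_sub_eq_conj {s : ℂ} (hs : s.re = 1 / 2) : 1 - s = (starRingEnd ℂ) s := by
  apply Complex.ext
  · simp [hs]; norm_num
  · simp

lemma linProd_conj (z₀ z₁ z₂ s : ℂ) : linProd ((starRingEnd ℂ) z₀) ((starRingEnd ℂ) z₁)
    ((starRingEnd ℂ) z₂) ((starRingEnd ℂ) s) = (starRingEnd ℂ) (linProd z₀ z₁ z₂ s) := by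
  simp [linProd]

lemma differentiable_linProd (z₀ z₁ z₂ : ℂ) : Differentiable ℂ (linProd z₀ z₁ z₂) := by
  unfold linProd
  fun_prop

lemma ne_of_two_norm_add_one_le {s z : ℂ} (h : 2 * (‖z‖ + 1) ≤ ‖s‖) : s ≠ z := by
  rintro rfl
  linarith [norm_nonneg s]

/-- The factor `V` of `wengW` has at most two zeros in the half-plane `1/2 < Re s`. -/
lemma not_exists_wengV_eq_linProd_mul {p : ℂ → ℂ} (hp : Differentiable ℂ p) {D : ℝ}
    (hpD : ∀ s : ℂ, 1 ≤ ‖s‖ → ‖p (1 - s)‖ ≤ D * ‖s‖ ^ 2)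
    (hpc : ∀ s, p ((starRingEnd ℂ) s) = (starRingEnd ℂ) (p s))
    (hline : ∀ s : ℂ, s.re = 1 / 2 → 0 ≤ (wengW s * (starRingEnd ℂ)
      (entireXi (s + 2) * (((Real.pi / 3 - 1 : ℝ) : ℂ) * s + 3) * p s)).re)
    (hp0 : ∀ s : ℂ, 1 / 2 ≤ s.re → p (1 - s) ≠ 0)
    {z₀ z₁ z₂ : ℂ} (h₀ : 1 / 2 < z₀.re) (h₁ : 1 / 2 < z₁.re) (h₂ : 1 / 2 < z₂.re) {f : ℂ → ℂ}
    (hf : Differentiable ℂ f) (hV : ∀ s, wengV s = linProd z₀ z₁ z₂ s * f s) : False := by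
  obtain ⟨ha, hb⟩ := pi_div_three_sub_one_mem
  set c := Real.pi / 3 - 1
  set Zc := linProd ((starRingEnd ℂ) z₀) ((starRingEnd ℂ) z₁) ((starRingEnd ℂ) z₂) with hZc
  have hZc0 : ∀ s : ℂ, 1 / 2 ≤ s.re → Zc (1 - s) ≠ 0 := fun s hs ↦
    linProd_ne_zero (one_sub_ne_conj hs h₀) (one_sub_ne_conj hs h₁) (one_sub_ne_conj hs h₂)
  have hc0 : ∀ s : ℂ, 1 / 2 ≤ s.re → (c : ℂ) * s + 3 ≠ 0 := fun s hs h ↦ by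
    have := congrArg re h
    rw [add_re, re_ofReal_mul] at this
    norm_num at this
    nlinarith
  set Φ : ℂ → ℂ := fun s ↦ (s + 1) * f s * p (1 - s) /
    (entireXi (s + 2) * ((c : ℂ) * s + 3) * Zc (1 - s)) with hΦ
  have hden : ∀ s : ℂ, 1 / 2 ≤ s.re → entireXi (s + 2) * ((c : ℂ) * s + 3) * Zc (1 - s) ≠ 0 :=
    fun s hs ↦ mul_ne_zero (mul_ne_zero (entireXi_add_two_ne_zero hs) (hc0 s hs)) (hZc0 s hs)
  set R := 2000 + 2 * (‖z₀‖ + 1) + 2 * (‖z₁‖ + 1) + 2 * (‖z₂‖ + 1) with hR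
  have n₀ := norm_nonneg z₀
  have n₁ := norm_nonneg z₁
  have n₂ := norm_nonneg z₂
  have hzero := fun s hs ↦ eq_zero_of_re_nonneg_of_decay (Φ := Φ) (C := 64 * 44 * D / c) (R := R)
    (fun s hs ↦ ?_) (fun s hs hRs ↦ ?_) (fun s hs ↦ ?_) (s := s) hs
  · have hRre : 1 / 2 < (R : ℂ).re := by rw [ofReal_re]; linarith
    have hRn : ‖(R : ℂ)‖ = R := by rw [norm_real, Real.norm_of_nonneg (by linarith)]
    have h := hzero R hRre
    rw [hΦ, div_eq_zero_iff, or_iff_left (hden _ hRre.le), mul_eq_zero,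
      or_iff_left (hp0 _ hRre.le)] at h
    refine wengW_ne_zero_of_large hRre.le (by rw [hRn]; linarith) ?_
    rw [wengW_eq, hV]
    linear_combination linProd z₀ z₁ z₂ R * h
  · have := differentiable_entireXi
    have := differentiable_linProd ((starRingEnd ℂ) z₀) ((starRingEnd ℂ) z₁) ((starRingEnd ℂ) z₂)
    refine DifferentiableAt.div ?_ ?_ (hden s hs)
    · exact (by fun_prop : Differentiable ℂ fun s ↦ (s + 1) * f s * p (1 - s)) s
    · exact (by fun_prop : Differentiable ℂ fun s ↦
        entireXi (s + 2) * ((c : ℂ) * s + 3) * Zc (1 - s)) s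
  · have hs1 : 2000 ≤ ‖s‖ := by linarith
    have hs0 : 0 < ‖s‖ := by linarith
    have hZ := norm_linProd_mul_ge (s := s) (z₀ := z₀) (z₁ := z₁) (z₂ := z₂) (by linarith)
      (by linarith) (by linarith)
    have hW := norm_wengW_le hs (by linarith)
    have hpD' := hpD s (by linarith)
    have hcs : c * ‖s‖ ≤ ‖(c : ℂ) * s + 3‖ := by
      have hcs' : c * ‖s‖ = ‖(c : ℂ) * s‖ := by
        rw [norm_mul, norm_real, Real.norm_of_nonneg (by linarith)]
      rw [hcs', ← sq_le_sq₀ (norm_nonneg _) (norm_nonneg _), ← normSq_eq_norm_sq, ← normSq_eq_norm_sq,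
        normSq_apply, normSq_apply]
      simp only [add_re, add_im, re_ofReal_mul, im_ofReal_mul]
      norm_num
      nlinarith
    have hE := norm_pos_iff.mpr (entireXi_add_two_ne_zero hs)
    rw [wengW_eq, hV] at hW
    simp only [norm_mul] at hW
    set Z := linProd z₀ z₁ z₂ s
    have hZpos : 0 < ‖Z‖ := norm_pos_iff.mpr (linProd_ne_zero
      (ne_of_two_norm_add_one_le (by linarith)) (ne_of_two_norm_add_one_le (by linarith))
      (ne_of_two_norm_add_one_le (by linarith)))
    have hcpos : 0 < c := by linarith
    change ‖(s + 1) * f s * p (1 - s) / (entireXi (s + 2) * ((c : ℂ) * s + 3) * Zc (1 - s))‖ *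
      ‖s‖ ^ 2 ≤ _
    rw [norm_div, div_mul_eq_mul_div, div_le_iff₀ (norm_pos_iff.mpr (hden s hs))]
    simp only [norm_mul]
    refine le_of_mul_le_mul_left (a := ‖Z‖) ?_ hZpos
    have hD : 0 ≤ D := by
      by_contra hD
      nlinarith [norm_nonneg (p (1 - s)), mul_pos hs0 hs0]
    calc ‖Z‖ * (‖s + 1‖ * ‖f s‖ * ‖p (1 - s)‖ * ‖s‖ ^ 2) =
        (‖s + 1‖ * (‖Z‖ * ‖f s‖)) * ‖p (1 - s)‖ * ‖s‖ ^ 2 := by ring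
      _ ≤ (44 * ‖s‖ ^ 3 * ‖entireXi (s + 2)‖) * (D * ‖s‖ ^ 2) * ‖s‖ ^ 2 := by gcongr
      _ = 64 * 44 * D / c * (‖entireXi (s + 2)‖ * (c * ‖s‖) * (‖s‖ ^ 6 / 64)) := by
        field_simp
      _ ≤ 64 * 44 * D / c * (‖entireXi (s + 2)‖ * ‖(c : ℂ) * s + 3‖ * (‖Z‖ * ‖Zc (1 - s)‖)) := by
        gcongr
      _ = _ := by ring
  · have hZ0 : linProd z₀ z₁ z₂ s ≠ 0 := by
      refine linProd_ne_zero ?_ ?_ ?_ <;> rintro rfl <;> linarith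
    have hA := mul_ne_zero (entireXi_add_two_ne_zero hs.ge) (hc0 s hs.ge)
    have hl := hline s hs
    have e : Φ s = wengW s * (starRingEnd ℂ) (entireXi (s + 2) * (c * s + 3) * p s) *
        ((1 / (normSq (linProd z₀ z₁ z₂ s) * normSq (entireXi (s + 2) * (c * s + 3))) : ℝ) : ℂ) := by
      have hA' : (starRingEnd ℂ) (entireXi (s + 2) * (c * s + 3)) ≠ 0 :=
        (map_ne_zero _).mpr hA
      have hZ' : (starRingEnd ℂ) (linProd z₀ z₁ z₂ s) ≠ 0 := (map_ne_zero _).mpr hZ0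
      push_cast
      rw [← mul_conj, ← mul_conj, map_mul _ _ (p s), hΦ]
      simp only
      rw [wengW_eq, hV, hZc, one_sub_eq_conj hs, linProd_conj, hpc]
      generalize (starRingEnd ℂ) (entireXi (s + 2) * (c * s + 3)) = A' at *
      generalize (starRingEnd ℂ) (linProd z₀ z₁ z₂ s) = Z' at *
      generalize linProd z₀ z₁ z₂ s = Z at *
      generalize entireXi (s + 2) * (c * s + 3) = A at *
      field_simp
    rw [e, re_mul_ofReal]
    refine mul_nonneg hl (one_div_nonneg.mpr (mul_nonneg (normSq_nonneg _) (normSq_nonneg _)))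

/-- If a quadratic polynomial is a multiple of `wengV` in the right half-plane, then `wengY` has at
most two zeros there. -/
lemma not_exists_wengY_eq_linProd_mul {p₁ p₂ : ℂ} (hp₁ : 1 / 2 < p₁.re) (hp₂ : 1 / 2 < p₂.re)
    {G : ℂ → ℂ} (hG : ∀ s : ℂ, 1 / 2 ≤ s.re → DifferentiableAt ℂ G s)
    (hGV : ∀ s : ℂ, 1 / 2 ≤ s.re → G s * wengV s = (s - p₁) * (s - p₂))
    {z₀ z₁ z₂ : ℂ} (h₀ : 1 / 2 < z₀.re) (h₁ : 1 / 2 < z₁.re) (h₂ : 1 / 2 < z₂.re) {y : ℂ → ℂ}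
    (hy : Differentiable ℂ y) (hY : ∀ s, wengY s = linProd z₀ z₁ z₂ s * y s) : False := by
  set Zc := linProd ((starRingEnd ℂ) z₀) ((starRingEnd ℂ) z₁) ((starRingEnd ℂ) z₂) with hZc
  have hZc0 : ∀ s : ℂ, 1 / 2 ≤ s.re → Zc (1 - s) ≠ 0 := fun s hs ↦
    linProd_ne_zero (one_sub_ne_conj hs h₀) (one_sub_ne_conj hs h₁) (one_sub_ne_conj hs h₂)
  set Pc : ℂ → ℂ := fun s ↦ (1 - s - (starRingEnd ℂ) p₁) * (1 - s - (starRingEnd ℂ) p₂) with hPc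
  set Φ : ℂ → ℂ := fun s ↦ y s * G s * Pc s / (entireXi (2 * s) * Zc (1 - s)) with hΦ
  have hden : ∀ s : ℂ, 1 / 2 ≤ s.re → entireXi (2 * s) * Zc (1 - s) ≠ 0 :=
    fun s hs ↦ mul_ne_zero (entireXi_two_mul_ne_zero hs) (hZc0 s hs)
  obtain ⟨X, hX⟩ := eventually_wengY_pos
  set R := 2000 + |X| + 2 * (‖z₀‖ + 1) + 2 * (‖z₁‖ + 1) + 2 * (‖z₂‖ + 1) + 2 * (‖p₁‖ + 1) +
    2 * (‖p₂‖ + 1) with hR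
  have n₀ := norm_nonneg z₀
  have n₁ := norm_nonneg z₁
  have n₂ := norm_nonneg z₂
  have n₃ := norm_nonneg p₁
  have n₄ := norm_nonneg p₂
  have n₅ := abs_nonneg X
  have hzero := fun s hs ↦ eq_zero_of_re_nonneg_of_decay (Φ := Φ) (C := 64 * 16 * 2301) (R := R)
    (fun s hs ↦ ?_) (fun s hs hRs ↦ ?_) (fun s hs ↦ ?_) (s := s) hs
  · have hRre : 1 / 2 < (R : ℂ).re := by rw [ofReal_re]; linarith
    have hRn : ‖(R : ℂ)‖ = R := by rw [norm_real, Real.norm_of_nonneg (by linarith)]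
    have h := hzero R hRre
    have hGR : G R ≠ 0 := by
      intro h1
      have h2 := hGV R hRre.le
      rw [h1, zero_mul] at h2
      refine mul_ne_zero (sub_ne_zero.mpr ?_) (sub_ne_zero.mpr ?_) h2.symm <;>
        exact ne_of_two_norm_add_one_le (by rw [hRn]; linarith)
    have hPcR : Pc R ≠ 0 := mul_ne_zero (sub_ne_zero.mpr (one_sub_ne_conj hRre.le hp₁))
      (sub_ne_zero.mpr (one_sub_ne_conj hRre.le hp₂))
    rw [hΦ, div_eq_zero_iff, or_iff_left (hden _ hRre.le), mul_eq_zero, or_iff_left hPcR,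
      mul_eq_zero, or_iff_left hGR] at h
    have := hX R (by linarith [le_abs_self X])
    rw [hY, h, mul_zero] at this
    simp at this
  · have := differentiable_entireXi
    have := differentiable_linProd ((starRingEnd ℂ) z₀) ((starRingEnd ℂ) z₁) ((starRingEnd ℂ) z₂)
    refine DifferentiableAt.div ?_ ?_ (hden s hs)
    · exact ((hy s).mul (hG s hs)).mul (by rw [hPc]; fun_prop)
    · exact (by fun_prop : Differentiable ℂ fun s ↦ entireXi (2 * s) * Zc (1 - s)) s
  · have hs1 : 2000 ≤ ‖s‖ := by linarith
    have hs0 : 0 < ‖s‖ := by linarith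
    have hZ := norm_linProd_mul_ge (s := s) (z₀ := z₀) (z₁ := z₁) (z₂ := z₂) (by linarith)
      (by linarith) (by linarith)
    have hYle := norm_wengY_le hs hs1
    have hE := norm_pos_iff.mpr (entireXi_two_mul_ne_zero hs)
    have hV : 0 < ‖wengV s‖ := by
      refine norm_pos_iff.mpr fun h ↦ wengW_ne_zero_of_large hs hs1 ?_
      rw [wengW_eq, h, mul_zero]
    have hP : ‖G s‖ * ‖wengV s‖ ≤ (2 * ‖s‖) * (2 * ‖s‖) := by
      rw [← norm_mul, hGV s hs, norm_mul]
      gcongr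
      · linarith [norm_sub_le s p₁]
      · linarith [norm_sub_le s p₂]
    have hPcle : ‖Pc s‖ ≤ (2 * ‖s‖) * (2 * ‖s‖) := by
      rw [hPc, norm_mul]
      have h1 := norm_sub_le 1 s
      rw [norm_one] at h1
      gcongr
      · have := norm_sub_le (1 - s) ((starRingEnd ℂ) p₁)
        rw [norm_conj] at this
        linarith
      · have := norm_sub_le (1 - s) ((starRingEnd ℂ) p₂)
        rw [norm_conj] at this
        linarith
    rw [hY, norm_mul] at hYle
    set Z := linProd z₀ z₁ z₂ s
    have hZpos : 0 < ‖Z‖ := norm_pos_iff.mpr (linProd_ne_zero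
      (ne_of_two_norm_add_one_le (by linarith)) (ne_of_two_norm_add_one_le (by linarith))
      (ne_of_two_norm_add_one_le (by linarith)))
    change ‖y s * G s * Pc s / (entireXi (2 * s) * Zc (1 - s))‖ * ‖s‖ ^ 2 ≤ _
    rw [norm_div, div_mul_eq_mul_div, div_le_iff₀ (norm_pos_iff.mpr (hden s hs))]
    simp only [norm_mul]
    refine le_of_mul_le_mul_left (a := ‖Z‖ * ‖wengV s‖) ?_ (by positivity)
    calc ‖Z‖ * ‖wengV s‖ * (‖y s‖ * ‖G s‖ * ‖Pc s‖ * ‖s‖ ^ 2) =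
        (‖Z‖ * ‖y s‖) * (‖G s‖ * ‖wengV s‖) * ‖Pc s‖ * ‖s‖ ^ 2 := by ring
      _ ≤ (2301 * (‖entireXi (2 * s)‖ * ‖wengV s‖)) * ((2 * ‖s‖) * (2 * ‖s‖)) *
          ((2 * ‖s‖) * (2 * ‖s‖)) * ‖s‖ ^ 2 := by gcongr
      _ = 64 * 16 * 2301 * (‖wengV s‖ * ‖entireXi (2 * s)‖ * (‖s‖ ^ 6 / 64)) := by ring
      _ ≤ 64 * 16 * 2301 * (‖wengV s‖ * ‖entireXi (2 * s)‖ * (‖Z‖ * ‖Zc (1 - s)‖)) := by gcongr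
      _ = _ := by ring
  · have hZ0 : linProd z₀ z₁ z₂ s ≠ 0 := by
      refine linProd_ne_zero ?_ ?_ ?_ <;> rintro rfl <;> linarith
    have hE := entireXi_two_mul_ne_zero hs.ge
    have hGVs := hGV s hs.ge
    have hP0 : (s - p₁) * (s - p₂) ≠ 0 := by
      refine mul_ne_zero (sub_ne_zero.mpr ?_) (sub_ne_zero.mpr ?_) <;> rintro rfl <;> linarith
    have hV0 : wengV s ≠ 0 := by
      intro h
      rw [h, mul_zero] at hGVs
      exact hP0 hGVs.symm
    have hPcs : Pc s = (starRingEnd ℂ) ((s - p₁) * (s - p₂)) := by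
      simp only [hPc, one_sub_eq_conj hs, map_mul, map_sub]
    have hsne : s ≠ -1 := by rintro rfl; norm_num at hs
    set x := entireXi (2 * s) * wengV s with hx
    have hx0 : x ≠ 0 := mul_ne_zero hE hV0
    have hYx : wengY s = x - (starRingEnd ℂ) x := by
      have : 2 * (starRingEnd ℂ) s = (starRingEnd ℂ) (2 * s) := by rw [map_mul, map_ofNat]
      rw [wengY_eq, one_sub_eq_conj hs, this, entireXi_conj, wengV_conj hsne, ← map_mul]
    have e : Φ s = (wengY s * (starRingEnd ℂ) x) *
        ((normSq ((s - p₁) * (s - p₂)) / (normSq (linProd z₀ z₁ z₂ s) * normSq x) : ℝ) : ℂ) := by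
      have hx' : (starRingEnd ℂ) x ≠ 0 := (map_ne_zero _).mpr hx0
      have hZ' : (starRingEnd ℂ) (linProd z₀ z₁ z₂ s) ≠ 0 := (map_ne_zero _).mpr hZ0
      have hGs : G s = (s - p₁) * (s - p₂) / wengV s := (eq_div_iff hV0).mpr hGVs
      push_cast only [ofReal_div, ofReal_mul]
      rw [← mul_conj, ← mul_conj, ← mul_conj, hΦ]
      simp only
      rw [hY, hZc, hPcs, one_sub_eq_conj hs, linProd_conj, hGs]
      generalize (starRingEnd ℂ) x = x' at *
      generalize (starRingEnd ℂ) (linProd z₀ z₁ z₂ s) = Z' at *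
      generalize linProd z₀ z₁ z₂ s = Z at *
      generalize (starRingEnd ℂ) ((s - p₁) * (s - p₂)) = P' at *
      rw [hx]
      field_simp
    rw [e, re_mul_ofReal]
    refine mul_nonneg ?_ (div_nonneg (normSq_nonneg _)
      (mul_nonneg (normSq_nonneg _) (normSq_nonneg _)))
    rw [hYx]
    simp only [mul_re, sub_re, sub_im, conj_re, conj_im]
    nlinarith [sq_nonneg x.im]

lemma wengY_half : wengY (1 / 2) = 0 := by
  rw [wengY_eq]
  norm_num

/-- If `wengY` has at most two zeros in `1/2 < Re s` and decreases at `1/2`, then its only zero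
there is `1`. -/
lemma wengY_ne_zero_of_le_two_zeros
    (hY : ∀ z₀ z₁ z₂ : ℂ, 1 / 2 < z₀.re → 1 / 2 < z₁.re → 1 / 2 < z₂.re → ∀ y : ℂ → ℂ,
      Differentiable ℂ y → ¬ ∀ s, wengY s = linProd z₀ z₁ z₂ s * y s)
    (hder : (deriv wengY (1 / 2)).re < 0) {s : ℂ} (hs : 1 / 2 < s.re) (hs1 : s ≠ 1) :
    wengY s ≠ 0 := by
  intro h0
  obtain ⟨f₁, hf₁, e₁⟩ := exists_factor_of_eq_zero differentiable_wengY wengY_one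
  have hs1' : s - 1 ≠ 0 := sub_ne_zero.mpr hs1
  have hf₁s : f₁ s = 0 := by
    rw [e₁] at h0
    exact (mul_eq_zero.mp h0).resolve_left hs1'
  obtain ⟨f₂, hf₂, e₂⟩ := exists_factor_of_eq_zero hf₁ hf₁s
  have hf₂ne : ∀ z : ℂ, 1 / 2 < z.re → f₂ z ≠ 0 := fun z hz h ↦ by
    obtain ⟨f₃, hf₃, e₃⟩ := exists_factor_of_eq_zero hf₂ h
    refine hY 1 s z (by norm_num) hs hz f₃ hf₃ fun w ↦ ?_
    rw [e₁, e₂, e₃, linProd]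
    ring
  by_cases him : s.im = 0
  swap
  · have hc1 : (starRingEnd ℂ) s - 1 ≠ 0 := fun h ↦ hs1' (by
      have := congrArg (starRingEnd ℂ) h
      simpa using this)
    have hcs : (starRingEnd ℂ) s - s ≠ 0 := fun h ↦ him (conj_eq_iff_im.mp (sub_eq_zero.mp h))
    refine hf₂ne ((starRingEnd ℂ) s) (by simpa using hs) ?_
    have h1 : wengY ((starRingEnd ℂ) s) = 0 := by
      rw [wengY_conj, h0, map_zero]
      · rintro rfl; norm_num at hs
      · rintro rfl; norm_num at him
    rw [e₁, e₂] at h1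
    exact (mul_eq_zero.mp ((mul_eq_zero.mp h1).resolve_left hc1)).resolve_left hcs
  have hsr : s = (s.re : ℂ) := (conj_eq_iff_re.mp (conj_eq_iff_im.mpr him)).symm
  set r := s.re with hr
  have hYr : ∀ x : ℝ, wengY x = ((x - 1) * (x - r) : ℝ) * f₂ x := fun x ↦ by
    rw [e₁, e₂, hsr]
    push_cast
    ring
  have hf₂cont : Continuous fun x : ℝ ↦ f₂ x := hf₂.continuous.comp continuous_ofReal
  have hreal : ∀ x : ℝ, (f₂ x).im = 0 := by
    have hS : Dense ({-1, 2, 1, r} : Set ℝ)ᶜ :=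
      (Set.toFinite ({-1, 2, 1, r} : Set ℝ)).countable.dense_compl ℝ
    have := Continuous.ext_on hS (continuous_im.comp hf₂cont)
      (continuous_const : Continuous fun _ : ℝ ↦ (0 : ℝ)) fun x hx ↦ ?_
    · exact fun x ↦ congrFun this x
    simp only [Set.mem_compl_iff, Set.mem_insert_iff, Set.mem_singleton_iff, not_or] at hx
    obtain ⟨hx1, hx2, hx3, hx4⟩ := hx
    have h1 := wengY_conj (s := x) (by exact_mod_cast hx1) (by exact_mod_cast hx2)
    rw [conj_ofReal] at h1
    have h2 := conj_eq_iff_im.mp h1.symm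
    rw [hYr, im_ofReal_mul] at h2
    exact (mul_eq_zero.mp h2).resolve_left
      (mul_ne_zero (sub_ne_zero.mpr hx3) (sub_ne_zero.mpr hx4))
  have hk : ∀ x : ℝ, 1 / 2 < x → (f₂ x).re ≠ 0 := fun x hx h ↦
    hf₂ne x (by simpa using hx) (Complex.ext h (hreal x))
  obtain ⟨X, hX⟩ := eventually_wengY_pos
  have hpos : ∀ x : ℝ, 1 / 2 < x → 0 < (f₂ x).re := by
    intro x hx
    by_contra hneg
    set t := |X| + |r| + 1 + x with ht
    have n1 := abs_nonneg X
    have n2 := abs_nonneg r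
    have h1 := hX t (by linarith [le_abs_self X])
    rw [hYr, re_ofReal_mul] at h1
    have h2 : 0 < (t - 1) * (t - r) := mul_pos (by linarith) (by linarith [le_abs_self r])
    have h3 : 0 < (f₂ t).re := pos_of_mul_pos_right h1 h2.le
    have h4 := intermediate_value_Icc (show x ≤ t by linarith)
      (continuous_re.comp hf₂cont).continuousOn
    obtain ⟨y, hy, hy0⟩ := h4 ⟨not_lt.mp hneg, h3.le⟩
    exact hk y (by linarith [hy.1]) hy0
  have hd : HasDerivAt (fun x : ℝ ↦ (wengY x).re) (deriv wengY (1 / 2)).re (1 / 2) := by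
    have h1 : HasDerivAt wengY (deriv wengY (1 / 2)) ((1 / 2 : ℝ) : ℂ) := by
      push_cast
      exact (differentiable_wengY _).hasDerivAt
    exact h1.real_of_complex
  have hslope := hd.tendsto_slope
  have hev := (hslope.mono_left (nhdsWithin_mono _
    fun y (hy : y ∈ Set.Ioi (1 / 2 : ℝ)) ↦ ne_of_gt hy)).eventually
    (eventually_lt_nhds hder)
  have hlt : (1 / 2 : ℝ) < min 1 r := lt_min (by norm_num) hs
  obtain ⟨x, hx1, hx2⟩ := (hev.and (Ioo_mem_nhdsGT hlt)).exists
  rw [slope_def_field] at hx1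
  push_cast at hx1
  rw [wengY_half, zero_re, sub_zero] at hx1
  have hYpos : 0 < (wengY x).re := by
    rw [hYr, re_ofReal_mul]
    have := hx2.2
    rw [lt_min_iff] at this
    exact mul_pos (mul_pos_of_neg_of_neg (by linarith [this.1]) (by linarith [this.2]))
      (hpos x hx2.1)
  have := div_pos hYpos (sub_pos.mpr hx2.1)
  linarith

lemma wengY_ne_zero_of_line {p : ℂ → ℂ} (hp : Differentiable ℂ p) {D : ℝ}
    (hpD : ∀ s : ℂ, 1 ≤ ‖s‖ → ‖p (1 - s)‖ ≤ D * ‖s‖ ^ 2)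
    (hpc : ∀ s, p ((starRingEnd ℂ) s) = (starRingEnd ℂ) (p s))
    (hline : ∀ s : ℂ, s.re = 1 / 2 → 0 < (wengW s * (starRingEnd ℂ)
      (entireXi (s + 2) * (((Real.pi / 3 - 1 : ℝ) : ℂ) * s + 3) * p s)).re)
    (hp0 : ∀ s : ℂ, 1 / 2 ≤ s.re → p (1 - s) ≠ 0)
    (hder : (deriv wengY (1 / 2)).re < 0) {s : ℂ} (hs : 1 / 2 < s.re) (hs1 : s ≠ 1) :
    wengY s ≠ 0 := by
  refine wengY_ne_zero_of_le_two_zeros (fun z₀ z₁ z₂ h₀ h₁ h₂ y hy h ↦ ?_) hder hs hs1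
  have hV0 : ∀ s : ℂ, s.re = 1 / 2 → wengV s ≠ 0 := fun s hs h ↦ by
    have := hline s hs
    rw [wengW_eq, h, mul_zero, zero_mul, zero_re] at this
    exact lt_irrefl _ this
  rcases exists_three_zeros_or_mul_eq differentiable_wengV hV0 with
    ⟨v₀, v₁, v₂, k₀, k₁, k₂, f, hf, e⟩ | ⟨p₁, p₂, k₁, k₂, G, hG, e⟩
  · exact not_exists_wengV_eq_linProd_mul hp hpD hpc (fun s hs ↦ (hline s hs).le) hp0 k₀ k₁ k₂ hf e
  · exact not_exists_wengY_eq_linProd_mul k₁ k₂ hG e h₀ h₁ h₂ hy h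

lemma re_eq_half_of_wengG2Pshort_eq_zero
    (hY : ∀ s : ℂ, 1 / 2 < s.re → s ≠ 1 → wengY s ≠ 0) {s : ℂ}
    (hs : s ∉ ({-2, -1, 0, 1/2, 1, 2, 3} : Set ℂ)) (hzero : wengG2Pshort s = 0) :
    s.re = 1 / 2 := by
  have main : ∀ s : ℂ, s ∉ ({-2, -1, 0, 1/2, 1, 2, 3} : Set ℂ) → wengG2Pshort s = 0 →
      s.re ≤ 1 / 2 := by
    intro s hs h
    by_contra hre
    have h1 := wengG2Pshort_mul_eq hs
    rw [h, mul_zero] at h1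
    refine hY s (not_le.mp hre) ?_ h1.symm
    rintro rfl
    simp at hs
  refine le_antisymm (main s hs hzero) ?_
  have h2 := main (1 - s) ?_ (by rw [wengG2Pshort_one_sub, hzero])
  · rw [sub_re, one_re] at h2
    linarith
  · simp only [Set.mem_insert_iff, Set.mem_singleton_iff, not_or] at hs ⊢
    obtain ⟨h1, h2, h3, h4, h5, h6, h7⟩ := hs
    exact ⟨fun h ↦ h7 (by linear_combination -h), fun h ↦ h6 (by linear_combination -h),
      fun h ↦ h5 (by linear_combination -h), fun h ↦ h4 (by linear_combination -h),
      fun h ↦ h3 (by linear_combination -h), fun h ↦ h2 (by linear_combination -h),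
      fun h ↦ h1 (by linear_combination -h)⟩

lemma bernoulli'_six : bernoulli' 6 = 1 / 42 := by
  have h := sum_bernoulli' 7
  have h5 := bernoulli'_eq_zero_of_odd (n := 5) (by decide) (by norm_num)
  norm_num [Finset.sum_range_succ, Nat.choose_eq_factorial_div_factorial, Nat.factorial,
    h5] at h
  linarith

lemma bernoulli'_eight : bernoulli' 8 = -1 / 30 := by
  have h := sum_bernoulli' 9
  have h5 := bernoulli'_eq_zero_of_odd (n := 5) (by decide) (by norm_num)
  have h7 := bernoulli'_eq_zero_of_odd (n := 7) (by decide) (by norm_num)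
  norm_num [Finset.sum_range_succ, Nat.choose_eq_factorial_div_factorial, Nat.factorial,
    h5, h7, bernoulli'_six] at h
  linarith

lemma bernoulli'_ten : bernoulli' 10 = 5 / 66 := by
  have h := sum_bernoulli' 11
  have h5 := bernoulli'_eq_zero_of_odd (n := 5) (by decide) (by norm_num)
  have h7 := bernoulli'_eq_zero_of_odd (n := 7) (by decide) (by norm_num)
  have h9 := bernoulli'_eq_zero_of_odd (n := 9) (by decide) (by norm_num)
  norm_num [Finset.sum_range_succ, Nat.choose_eq_factorial_div_factorial, Nat.factorial,
    h5, h7, h9, bernoulli'_six, bernoulli'_eight] at h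
  linarith

lemma bernoulli'_twelve : bernoulli' 12 = -691 / 2730 := by
  have h := sum_bernoulli' 13
  have h5 := bernoulli'_eq_zero_of_odd (n := 5) (by decide) (by norm_num)
  have h7 := bernoulli'_eq_zero_of_odd (n := 7) (by decide) (by norm_num)
  have h9 := bernoulli'_eq_zero_of_odd (n := 9) (by decide) (by norm_num)
  have h11 := bernoulli'_eq_zero_of_odd (n := 11) (by decide) (by norm_num)
  norm_num [Finset.sum_range_succ, Nat.choose_eq_factorial_div_factorial, Nat.factorial,
    h5, h7, h9, h11, bernoulli'_six, bernoulli'_eight, bernoulli'_ten] at h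
  linarith

lemma bernoulli'_fourteen : bernoulli' 14 = 7 / 6 := by
  have h := sum_bernoulli' 15
  have h5 := bernoulli'_eq_zero_of_odd (n := 5) (by decide) (by norm_num)
  have h7 := bernoulli'_eq_zero_of_odd (n := 7) (by decide) (by norm_num)
  have h9 := bernoulli'_eq_zero_of_odd (n := 9) (by decide) (by norm_num)
  have h11 := bernoulli'_eq_zero_of_odd (n := 11) (by decide) (by norm_num)
  have h13 := bernoulli'_eq_zero_of_odd (n := 13) (by decide) (by norm_num)
  norm_num [Finset.sum_range_succ, Nat.choose_eq_factorial_div_factorial, Nat.factorial,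
    h5, h7, h9, h11, h13, bernoulli'_six, bernoulli'_eight, bernoulli'_ten, bernoulli'_twelve] at h
  linarith

lemma bernoulli'_sixteen : bernoulli' 16 = -3617 / 510 := by
  have h := sum_bernoulli' 17
  have h5 := bernoulli'_eq_zero_of_odd (n := 5) (by decide) (by norm_num)
  have h7 := bernoulli'_eq_zero_of_odd (n := 7) (by decide) (by norm_num)
  have h9 := bernoulli'_eq_zero_of_odd (n := 9) (by decide) (by norm_num)
  have h11 := bernoulli'_eq_zero_of_odd (n := 11) (by decide) (by norm_num)
  have h13 := bernoulli'_eq_zero_of_odd (n := 13) (by decide) (by norm_num)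
  have h15 := bernoulli'_eq_zero_of_odd (n := 15) (by decide) (by norm_num)
  norm_num [Finset.sum_range_succ, Nat.choose_eq_factorial_div_factorial, Nat.factorial,
    h5, h7, h9, h11, h13, h15, bernoulli'_six, bernoulli'_eight, bernoulli'_ten, bernoulli'_twelve, bernoulli'_fourteen] at h
  linarith

lemma bernoulli'_eighteen : bernoulli' 18 = 43867 / 798 := by
  have h := sum_bernoulli' 19
  have h5 := bernoulli'_eq_zero_of_odd (n := 5) (by decide) (by norm_num)
  have h7 := bernoulli'_eq_zero_of_odd (n := 7) (by decide) (by norm_num)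
  have h9 := bernoulli'_eq_zero_of_odd (n := 9) (by decide) (by norm_num)
  have h11 := bernoulli'_eq_zero_of_odd (n := 11) (by decide) (by norm_num)
  have h13 := bernoulli'_eq_zero_of_odd (n := 13) (by decide) (by norm_num)
  have h15 := bernoulli'_eq_zero_of_odd (n := 15) (by decide) (by norm_num)
  have h17 := bernoulli'_eq_zero_of_odd (n := 17) (by decide) (by norm_num)
  norm_num [Finset.sum_range_succ, Nat.choose_eq_factorial_div_factorial, Nat.factorial,
    h5, h7, h9, h11, h13, h15, h17, bernoulli'_six, bernoulli'_eight, bernoulli'_ten, bernoulli'_twelve, bernoulli'_fourteen, bernoulli'_sixteen] at h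
  linarith

lemma bernoulli'_twenty : bernoulli' 20 = -174611 / 330 := by
  have h := sum_bernoulli' 21
  have h5 := bernoulli'_eq_zero_of_odd (n := 5) (by decide) (by norm_num)
  have h7 := bernoulli'_eq_zero_of_odd (n := 7) (by decide) (by norm_num)
  have h9 := bernoulli'_eq_zero_of_odd (n := 9) (by decide) (by norm_num)
  have h11 := bernoulli'_eq_zero_of_odd (n := 11) (by decide) (by norm_num)
  have h13 := bernoulli'_eq_zero_of_odd (n := 13) (by decide) (by norm_num)
  have h15 := bernoulli'_eq_zero_of_odd (n := 15) (by decide) (by norm_num)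
  have h17 := bernoulli'_eq_zero_of_odd (n := 17) (by decide) (by norm_num)
  have h19 := bernoulli'_eq_zero_of_odd (n := 19) (by decide) (by norm_num)
  norm_num [Finset.sum_range_succ, Nat.choose_eq_factorial_div_factorial, Nat.factorial,
    h5, h7, h9, h11, h13, h15, h17, h19, bernoulli'_six, bernoulli'_eight, bernoulli'_ten, bernoulli'_twelve, bernoulli'_fourteen, bernoulli'_sixteen, bernoulli'_eighteen] at h
  linarith

lemma entireXi_two_mul_nat {k : ℕ} (hk : k ≠ 0) : entireXi (2 * k) =
    ((-1 : ℝ) ^ (k + 1) * 2 ^ (2 * k) * k.factorial * (2 * k - 1) * bernoulli' (2 * k) /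
      (2 * k).factorial * Real.pi ^ k : ℝ) := by
  have hk1 : (1 : ℝ) ≤ k := by exact_mod_cast Nat.one_le_iff_ne_zero.mpr hk
  rw [entireXi_eq_Gammaℝ (by norm_num; linarith), riemannZeta_two_mul_nat hk,
    bernoulli_eq_bernoulli'_of_ne_one (by omega), Gammaℝ_def]
  obtain ⟨m, rfl⟩ : ∃ m, k = m + 1 := ⟨k - 1, by omega⟩
  have h1 : ((2 : ℂ) * ((m + 1 : ℕ) : ℂ)) / 2 = m + 1 := by push_cast; ring
  have hpi : (Real.pi : ℂ) ≠ 0 := by exact_mod_cast Real.pi_ne_zero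
  rw [neg_div, h1, Gamma_nat_eq_factorial, cpow_neg, ← Nat.cast_succ, cpow_natCast,
    Nat.factorial_succ m, Nat.succ_eq_add_one, show 2 * (m + 1) - 1 = 2 * m + 1 by omega]
  push_cast
  have h2 : (((2 * (m + 1)).factorial : ℕ) : ℂ) ≠ 0 := by
    exact_mod_cast Nat.factorial_ne_zero _
  field_simp
  ring

lemma tsum_one_div_pow_eight_le : ∑' n : ℕ, 1 / (n : ℝ) ^ (8 : ℝ) ≤ 1.004078 := by
  have h := hasSum_zeta_nat (k := 4) (by norm_num)
  rw [bernoulli_eq_bernoulli'_of_ne_one (by norm_num)] at h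
  norm_num [bernoulli'_eight, Nat.factorial] at h
  have h2 : ∀ n : ℕ, 1 / (n : ℝ) ^ (8 : ℝ) = ((n : ℝ) ^ 8)⁻¹ := fun n ↦ by
    rw [one_div]; norm_cast
  simp_rw [h2]
  rw [h.tsum_eq]
  have : Real.pi ^ 8 ≤ 3.1415927 ^ 8 := by
    gcongr
    exact (Real.pi_lt_d20.trans (by norm_num)).le
  norm_num at this ⊢
  linarith

lemma norm_Gamma_one_add_sq_mul (y : ℝ) :
    ‖Gamma ((1 : ℝ) + y * I)‖ ^ 2 * Real.sinh (Real.pi * y) = Real.pi * y := by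
  rcases eq_or_ne y 0 with rfl | hy
  · simp
  have h := Complex.Gamma_mul_Gamma_one_sub (y * I)
  have hyI : (y : ℂ) * I ≠ 0 := mul_ne_zero (ofReal_ne_zero.mpr hy) I_ne_zero
  have h1 : (1 : ℂ) - y * I = (starRingEnd ℂ) ((1 : ℝ) + y * I) := by
    simp only [map_add, map_mul, conj_ofReal, conj_I]
    push_cast
    ring
  have h2 : sin (Real.pi * (y * I)) = (Real.sinh (Real.pi * y) : ℝ) * I := by
    rw [← mul_assoc, ← ofReal_mul, sin_mul_I]
    simp
  have hs : Real.sinh (Real.pi * y) ≠ 0 := by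
    rw [Ne, Real.sinh_eq_zero]
    exact mul_ne_zero Real.pi_ne_zero hy
  have h3 : Gamma ((1 : ℝ) + y * I) = y * I * Gamma (y * I) := by
    rw [← Gamma_add_one _ hyI, ofReal_one, add_comm]
  have h4 : ((‖Gamma ((1 : ℝ) + y * I)‖ ^ 2 : ℝ) : ℂ) = y * I * (Real.pi / sin (Real.pi * (y * I))) := by
    rw [← h, h1, Gamma_conj, ← mul_assoc, ← h3, mul_conj, normSq_eq_norm_sq]
  rw [h2] at h4
  have : ((‖Gamma ((1 : ℝ) + y * I)‖ ^ 2 * Real.sinh (Real.pi * y) : ℝ) : ℂ) = (Real.pi * y : ℝ) := by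
    have hs' : ((Real.sinh (Real.pi * y) : ℝ) : ℂ) ≠ 0 := by exact_mod_cast hs
    rw [ofReal_mul, h4, ofReal_mul]
    generalize ((Real.sinh (Real.pi * y) : ℝ) : ℂ) = u at hs'
    have := I_ne_zero
    field_simp
  exact_mod_cast this

lemma norm_Gamma_one_pow_four_le (y : ℝ) :
    Real.pi ^ 2 * ‖Gamma ((1 : ℝ) + y * I)‖ ^ 4 ≤
      (1 + (Real.pi * y) ^ 2) * ‖Gamma ((1 / 2 : ℝ) + y * I)‖ ^ 4 := by
  have h1 := norm_Gamma_one_add_sq_mul y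
  have h2 := norm_Gamma_half_sq y
  have hc := Real.cosh_pos (Real.pi * y)
  have hcs := Real.cosh_sq (Real.pi * y)
  have e4 : ∀ x : ℝ, x ^ 4 = (x ^ 2) ^ 2 := fun x ↦ by ring
  rw [e4, e4, h2]
  rcases eq_or_ne y 0 with rfl | hy
  · simp
  have hs0 : Real.sinh (Real.pi * y) ≠ 0 := by
    rw [Ne, Real.sinh_eq_zero]
    exact mul_ne_zero Real.pi_ne_zero hy
  have hs : 0 < Real.sinh (Real.pi * y) ^ 2 := by positivity
  have hs2 : (Real.pi * y) ^ 2 ≤ Real.sinh (Real.pi * y) ^ 2 := by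
    rw [sq_le_sq, Real.abs_sinh]
    exact Real.self_le_sinh_iff.mpr (abs_nonneg _)
  rw [eq_div_of_mul_eq hs0 h1, div_pow, div_pow, hcs,
    mul_div_assoc', mul_div_assoc', div_le_div_iff₀ hs (by positivity)]
  nlinarith [mul_nonneg (sq_nonneg Real.pi) (sub_nonneg.mpr hs2)]

lemma norm_add_mul_I_sq (a y : ℝ) : ‖(a : ℂ) + y * I‖ ^ 2 = a ^ 2 + y ^ 2 := by
  rw [← normSq_eq_norm_sq, normSq_add_mul_I]

lemma norm_Gamma_add_one (a y : ℝ) (ha : 0 < a) : ‖Gamma ((a + 1 : ℝ) + y * I)‖ ^ 4 =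
    (a ^ 2 + y ^ 2) ^ 2 * ‖Gamma (a + y * I)‖ ^ 4 := by
  have h : (a : ℂ) + y * I ≠ 0 := fun h ↦ ha.ne' (by simpa using congrArg re h)
  rw [← norm_add_mul_I_sq, ofReal_add, ofReal_one, add_right_comm, Gamma_add_one _ h, norm_mul]
  ring

lemma norm_Gamma_four_pow_four_le (y : ℝ) :
    Real.pi ^ 2 * ((12.25 + y ^ 2) * (6.25 + y ^ 2) * (2.25 + y ^ 2) * (0.25 + y ^ 2)) ^ 2 *
        ‖Gamma ((4 : ℝ) + y * I)‖ ^ 4 ≤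
      (1 + 9.8697 * y ^ 2) * ((9 + y ^ 2) * (4 + y ^ 2) * (1 + y ^ 2)) ^ 2 *
        ‖Gamma ((4.5 : ℝ) + y * I)‖ ^ 4 := by
  have h := norm_Gamma_one_pow_four_le y
  have e1 := norm_Gamma_add_one 1 y (by norm_num)
  have e2 := norm_Gamma_add_one 2 y (by norm_num)
  have e3 := norm_Gamma_add_one 3 y (by norm_num)
  have f1 := norm_Gamma_add_one (1 / 2) y (by norm_num)
  have f2 := norm_Gamma_add_one (3 / 2) y (by norm_num)
  have f3 := norm_Gamma_add_one (5 / 2) y (by norm_num)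
  have f4 := norm_Gamma_add_one (7 / 2) y (by norm_num)
  norm_num only at e1 e2 e3 f1 f2 f3 f4 ⊢
  norm_num only at h
  rw [e3, e2, e1, f4, f3, f2, f1]
  have hpi : Real.pi ^ 2 ≤ 9.8697 := by
    nlinarith [Real.pi_lt_d20, Real.pi_pos]
  have h1 : (1 + (Real.pi * y) ^ 2) ≤ 1 + 98697 / 10000 * y ^ 2 := by
    rw [mul_pow]; nlinarith [sq_nonneg y]
  set A := ‖Gamma (((1 : ℝ) : ℂ) + y * I)‖ ^ 4
  set B := ‖Gamma (((1 / 2 : ℝ) : ℂ) + y * I)‖ ^ 4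
  have h2 : Real.pi ^ 2 * A ≤ (1 + 98697 / 10000 * y ^ 2) * B :=
    h.trans (mul_le_mul_of_nonneg_right h1 (by positivity))
  have := mul_le_mul_of_nonneg_left h2 (by positivity : 0 ≤
    ((49 / 4 + y ^ 2) * (25 / 4 + y ^ 2) * (9 / 4 + y ^ 2) * (1 / 4 + y ^ 2)) ^ 2 *
    ((9 + y ^ 2) * (4 + y ^ 2) * (1 + y ^ 2)) ^ 2)
  calc _ = _ := ?_
    _ ≤ _ := this
    _ = _ := ?_ <;> ring

lemma norm_entireXi_le_of_re_eq_eight {w : ℂ} (hw : w.re = 8) :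
    ‖entireXi w‖ ≤ 0.748 * ‖entireXi (w + 1)‖ := by
  set y := w.im / 2 with hy
  have hw2 : w = (8 : ℝ) + (2 * y : ℝ) * I := by
    rw [hy, mul_div_cancel₀ _ two_ne_zero, ← hw, re_add_im]
  have hσ : (1 : ℝ) < 8 := by norm_num
  set Z := ∑' n : ℕ, 1 / (n : ℝ) ^ (8 : ℝ)
  have hZ : Z ≤ 1.004078 := tsum_one_div_pow_eight_le
  have z1 : ‖riemannZeta w‖ ≤ Z := norm_riemannZeta_le hσ hw.ge
  have z2 : 1 ≤ ‖riemannZeta (w + 1)‖ * Z := one_le_norm_riemannZeta_mul hσ (by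
    rw [add_re, hw]; norm_num)
  have hZ0 : 0 ≤ Z := (norm_nonneg _).trans z1
  have e1 := entireXi_eq_Gammaℝ (w := w) (by rw [hw]; norm_num)
  have e2 := entireXi_eq_Gammaℝ (w := w + 1) (by rw [add_re, hw]; norm_num)
  have g1 := norm_Gammaℝ w
  have g2 := norm_Gammaℝ (w + 1)
  have i1 : (w + 1).re = 9 := by rw [add_re, hw]; norm_num
  have i2 : (w + 1).im = w.im := by simp
  rw [i1, i2, ← hy] at g2
  rw [hw, ← hy] at g1
  norm_num only at g1 g2
  have hG := norm_Gamma_four_pow_four_le y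
  norm_num only at hG
  set A := ‖Gamma (((4 : ℝ) : ℂ) + y * I)‖
  set B := ‖Gamma (((9 / 2 : ℝ) : ℂ) + y * I)‖
  have p : (Real.pi ^ (-4 : ℝ)) ^ 4 = Real.pi ^ 2 * (Real.pi ^ (-(9 / 2) : ℝ)) ^ 4 := by
    rw [← Real.rpow_natCast, ← Real.rpow_natCast, ← Real.rpow_natCast, ← Real.rpow_mul Real.pi_pos.le,
      ← Real.rpow_mul Real.pi_pos.le, ← Real.rpow_add Real.pi_pos]
    norm_num
  have n1 : ‖w - 1‖ ^ 2 = 49 + 4 * y ^ 2 := by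
    rw [hw2, show (((8 : ℝ) : ℂ) + (2 * y : ℝ) * I - 1) = ((7 : ℝ) : ℂ) + (2 * y : ℝ) * I by
      push_cast; ring, norm_add_mul_I_sq]
    ring
  have n2 : ‖w + 1‖ ^ 2 = 81 + 4 * y ^ 2 := by
    rw [hw2, show (((8 : ℝ) : ℂ) + (2 * y : ℝ) * I + 1) = ((9 : ℝ) : ℂ) + (2 * y : ℝ) * I by
      push_cast; ring, norm_add_mul_I_sq]
    ring
  rw [e1, e2, add_sub_cancel_right]
  simp only [norm_mul, g1, g2]
  set P := Real.pi ^ (-(9 / 2) : ℝ)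
  set Q := Real.pi ^ (-4 : ℝ)
  have hP : 0 < P := Real.rpow_pos_of_pos Real.pi_pos _
  have hQ : 0 < Q := Real.rpow_pos_of_pos Real.pi_pos _
  have hq : 0 ≤ y ^ 2 := sq_nonneg y
  have hA : 0 ≤ A := norm_nonneg _
  have hB : 0 ≤ B := norm_nonneg _
  have main : ‖w - 1‖ * Q * A * 1.004078 ^ 2 ≤ 0.748 * (‖w + 1‖ * P * B) := by
    refine le_of_pow_le_pow_left₀ four_ne_zero (by positivity) ?_
    rw [show (‖w - 1‖ * Q * A * 1.004078 ^ 2) ^ 4 =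
      (‖w - 1‖ ^ 2) ^ 2 * Q ^ 4 * A ^ 4 * 1.004078 ^ 8 by ring,
      show (0.748 * (‖w + 1‖ * P * B)) ^ 4 =
      0.748 ^ 4 * ((‖w + 1‖ ^ 2) ^ 2 * P ^ 4 * B ^ 4) by ring, p, n1, n2]
    generalize y ^ 2 = q at hG hq
    have hD : 0 < ((49 / 4 + q) * (25 / 4 + q) * (9 / 4 + q) * (1 / 4 + q)) ^ 2 := by positivity
    refine le_of_mul_le_mul_left ?_ hD
    have hpoly : 1.004078 ^ 8 * (49 + 4 * q) ^ 2 *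
        ((1 + 98697 / 10000 * q) * ((9 + q) * (4 + q) * (1 + q)) ^ 2) ≤ 0.748 ^ 4 * (81 + 4 * q) ^ 2 *
        ((49 / 4 + q) * (25 / 4 + q) * (9 / 4 + q) * (1 / 4 + q)) ^ 2 := by
      have h1 : 0 ≤ 594701 - 5473760 * q + 13039070 * q ^ 2 := by
        nlinarith [sq_nonneg (q - 5473760 / 26078140)]
      have h2 := mul_nonneg hq (sq_nonneg (q - 1 / 5))
      linarith [pow_nonneg hq 2, pow_nonneg hq 3, pow_nonneg hq 4, pow_nonneg hq 5,
        pow_nonneg hq 6, pow_nonneg hq 7, pow_nonneg hq 8, pow_nonneg hq 9, pow_nonneg hq 10]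
    have h1 := mul_le_mul_of_nonneg_left hG
      (by positivity : 0 ≤ 1.004078 ^ 8 * (49 + 4 * q) ^ 2 * P ^ 4)
    have h2 := mul_le_mul_of_nonneg_right hpoly (by positivity : 0 ≤ P ^ 4 * B ^ 4)
    linarith
  calc _ = ‖w‖ * (‖w - 1‖ * Q * A) * ‖riemannZeta w‖ := by ring
    _ ≤ ‖w‖ * (‖w - 1‖ * Q * A) * 1.004078 := by gcongr; exact z1.trans hZ
    _ ≤ ‖w‖ * (‖w - 1‖ * Q * A) * 1.004078 * (‖riemannZeta (w + 1)‖ * 1.004078) :=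
      le_mul_of_one_le_right (by positivity) (z2.trans (by gcongr))
    _ = ‖w‖ * (‖w - 1‖ * Q * A * 1.004078 ^ 2) * ‖riemannZeta (w + 1)‖ := by ring
    _ ≤ ‖w‖ * (0.748 * (‖w + 1‖ * P * B)) * ‖riemannZeta (w + 1)‖ := by gcongr
    _ = _ := by ring

lemma norm_entireXi_le_interp {w : ℂ} (h0 : 0 ≤ w.re) (h8 : w.re ≤ 8) :
    ‖entireXi w‖ ≤ 0.748 ^ (w.re / 8) * ‖entireXi (w + 1)‖ := by
  have hne : ∀ z : ℂ, 0 ≤ z.re → entireXi (z + 1) ≠ 0 := fun z hz ↦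
    entireXi_ne_zero (by simpa using hz)
  have hle : ∀ z : ℂ, 0 ≤ z.re → ‖entireXi z / entireXi (z + 1)‖ ≤ 1 := fun z hz ↦ by
    rw [norm_div]
    refine div_le_one_of_le₀ ?_ (norm_nonneg _)
    simpa using norm_entireXi_le_norm_add le_rfl (w := z) (by simpa using hz)
  have hd : DifferentiableOn ℂ (fun z ↦ entireXi z / entireXi (z + 1)) {z | 0 ≤ z.re} :=
    fun z hz ↦ by
      have hE := differentiable_entireXi
      refine DifferentiableAt.differentiableWithinAt ?_
      exact DifferentiableAt.div hE.differentiableAt (by fun_prop) (hne z hz)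
  have := HadamardThreeLines.norm_le_interp_of_mem_verticalClosedStrip'
    (f := fun z ↦ entireXi z / entireXi (z + 1)) (z := w) (a := 1) (b := 0.748) (l := 0) (u := 8)
    (by norm_num) ⟨h0, h8⟩ ?_ ?_ ?_ ?_
  · rw [norm_div, div_le_iff₀ (norm_pos_iff.mpr (hne w h0))] at this
    simpa using this
  · refine DifferentiableOn.diffContOnCl (hd.mono ?_)
    refine closure_minimal (fun z hz ↦ hz.1.le) ?_
    exact isClosed_le continuous_const continuous_re
  · refine ⟨1, ?_⟩
    rintro _ ⟨z, hz, rfl⟩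
    exact hle z hz.1
  · intro z hz
    exact hle z hz.ge
  · intro z hz
    rw [norm_div, div_le_iff₀ (norm_pos_iff.mpr (hne z (by rw [hz]; norm_num)))]
    exact norm_entireXi_le_of_re_eq_eight hz

lemma rpow_le_of_le_pow {x y a : ℝ} (hx : 0 ≤ x) (hy : 0 ≤ y) {m n : ℕ} (hn : n ≠ 0)
    (ha : a = m / n) (h : x ^ m ≤ y ^ n) : x ^ a ≤ y := by
  have hn' : (n : ℝ) ≠ 0 := by exact_mod_cast hn
  refine le_of_pow_le_pow_left₀ hn hy ?_
  rwa [← Real.rpow_natCast, ← Real.rpow_mul hx, ha, div_mul_cancel₀ _ hn', Real.rpow_natCast]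

lemma norm_entireXi_add_one_le_of_re_eq_half {s : ℂ} (hs : s.re = 1 / 2) :
    ‖entireXi (s + 1)‖ ≤ 0.9471 * ‖entireXi (s + 2)‖ := by
  have h := norm_entireXi_le_interp (w := s + 1) (by simp [hs]; norm_num) (by simp [hs]; norm_num)
  rw [show s + 1 + 1 = s + 2 by ring] at h
  refine h.trans (mul_le_mul_of_nonneg_right ?_ (norm_nonneg _))
  exact rpow_le_of_le_pow (m := 3) (n := 16) (by norm_num) (by norm_num) (by norm_num)
    (by simp [hs]; norm_num) (by norm_num)

lemma norm_entireXi_le_of_re_eq_half {s : ℂ} (hs : s.re = 1 / 2) :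
    ‖entireXi s‖ ≤ 0.93 * ‖entireXi (s + 2)‖ := by
  have h := norm_entireXi_le_interp (w := s + 1) (by simp [hs]; norm_num) (by simp [hs]; norm_num)
  have h1 := norm_entireXi_le_interp (w := s) (by simp [hs]) (by rw [hs]; norm_num)
  rw [show s + 1 + 1 = s + 2 by ring] at h
  have h2 := h1.trans (mul_le_mul_of_nonneg_left h (by positivity))
  rw [← mul_assoc, ← Real.rpow_add (by norm_num)] at h2
  refine h2.trans (mul_le_mul_of_nonneg_right ?_ (norm_nonneg _))
  exact rpow_le_of_le_pow (m := 1) (n := 4) (by norm_num) (by norm_num) (by norm_num)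
    (by simp [hs]; norm_num) (by norm_num)

lemma pos_re_mul_conj_of_norm_le {e₀ e₁ e₂ l a b q : ℂ} {m₀ m₁ : ℝ} (he : e₂ ≠ 0)
    (h₁ : ‖e₁‖ ≤ m₁ * ‖e₂‖) (h₀ : ‖e₀‖ ≤ m₀ * ‖e₂‖)
    (h : ‖q‖ * (‖a‖ * m₁ + ‖b‖ * m₀) < (l * (starRingEnd ℂ) q).re) :
    0 < ((l * e₂ - a * e₁ - b * e₀) * (starRingEnd ℂ) (e₂ * q)).re := by
  have he' : 0 < ‖e₂‖ := norm_pos_iff.mpr he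
  have e : (l * e₂ - a * e₁ - b * e₀) * (starRingEnd ℂ) (e₂ * q) =
      (‖e₂‖ ^ 2 : ℝ) * (l * (starRingEnd ℂ) q) -
        (a * e₁ + b * e₀) * (starRingEnd ℂ) (e₂ * q) := by
    rw [← normSq_eq_norm_sq, normSq_eq_conj_mul_self, map_mul]
    ring
  have h2 : ‖(a * e₁ + b * e₀) * (starRingEnd ℂ) (e₂ * q)‖ ≤
      ‖e₂‖ ^ 2 * (‖q‖ * (‖a‖ * m₁ + ‖b‖ * m₀)) := by
    rw [norm_mul, norm_conj, norm_mul]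
    calc _ ≤ (‖a‖ * ‖e₁‖ + ‖b‖ * ‖e₀‖) * (‖e₂‖ * ‖q‖) := by
          gcongr
          exact (norm_add_le _ _).trans (by rw [norm_mul, norm_mul])
      _ ≤ (‖a‖ * (m₁ * ‖e₂‖) + ‖b‖ * (m₀ * ‖e₂‖)) * (‖e₂‖ * ‖q‖) := by gcongr
      _ = _ := by ring
  rw [e, sub_re, re_ofReal_mul, sub_pos]
  exact (re_le_norm _).trans_lt (h2.trans_lt (mul_lt_mul_of_pos_left h (by positivity)))

lemma wengW_line_pos_of_large {s : ℂ} (hs : s.re = 1 / 2) (ht : (7.4 : ℝ) ^ 2 ≤ s.im ^ 2) :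
    0 < (wengW s * (starRingEnd ℂ) (entireXi (s + 2) * ((((Real.pi / 3 - 1 : ℝ) : ℂ) * s + 3) *
      (s ^ 2 - 7 / 3 * s + 131 / 10)))).re := by
  obtain ⟨hc1, -⟩ := pi_div_three_sub_one_mem
  rw [wengW]
  generalize Real.pi / 3 - 1 = c at hc1
  refine pos_re_mul_conj_of_norm_le (entireXi_ne_zero (by simp [hs]; norm_num))
    (norm_entireXi_add_one_le_of_re_eq_half hs) (norm_entireXi_le_of_re_eq_half hs) ?_
  set t := s.im with ht'
  have hst : s = (1 / 2 : ℝ) + t * I := by rw [← hs, ht', re_add_im]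
  have n0 : ‖(c : ℂ) * s + 3‖ ^ 2 = (c / 2 + 3) ^ 2 + c ^ 2 * t ^ 2 := by
    rw [hst, show (c : ℂ) * ((1 / 2 : ℝ) + t * I) + 3 = ((c / 2 + 3 : ℝ) : ℂ) + (c * t : ℝ) * I by
      push_cast; ring, norm_add_mul_I_sq, mul_pow]
  have n1 : ‖s - 1‖ ^ 2 = 1 / 4 + t ^ 2 := by
    rw [hst, show ((1 / 2 : ℝ) : ℂ) + t * I - 1 = ((-1 / 2 : ℝ) : ℂ) + t * I by
      push_cast; ring, norm_add_mul_I_sq]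
    ring
  have n2 : ‖s + 2‖ ^ 2 = 25 / 4 + t ^ 2 := by
    rw [hst, show ((1 / 2 : ℝ) : ℂ) + t * I + 2 = ((5 / 2 : ℝ) : ℂ) + t * I by
      push_cast; ring, norm_add_mul_I_sq]
    ring
  have n3 : ‖s - 3‖ ^ 2 = 25 / 4 + t ^ 2 := by
    rw [hst, show ((1 / 2 : ℝ) : ℂ) + t * I - 3 = ((-5 / 2 : ℝ) : ℂ) + t * I by
      push_cast; ring, norm_add_mul_I_sq]
    ring
  have e4 : s ^ 2 - 7 / 3 * s + 131 / 10 = ((731 / 60 - t ^ 2 : ℝ) : ℂ) + (-4 / 3 * t : ℝ) * I := by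
    rw [hst]
    push_cast
    linear_combination ((t : ℂ) ^ 2) * I_sq
  have n4 : ‖s ^ 2 - 7 / 3 * s + 131 / 10‖ ^ 2 = (731 / 60 - t ^ 2) ^ 2 + 16 / 9 * t ^ 2 := by
    rw [e4, norm_add_mul_I_sq]
    ring
  have r : ((s - 1) ^ 2 * (starRingEnd ℂ) (s ^ 2 - 7 / 3 * s + 131 / 10)).re =
      (1 / 4 - t ^ 2) * (731 / 60 - t ^ 2) + 4 / 3 * t ^ 2 := by
    rw [e4, show (s - 1) ^ 2 = ((1 / 4 - t ^ 2 : ℝ) : ℂ) + (-t : ℝ) * I by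
      rw [hst]; push_cast; linear_combination ((t : ℂ) ^ 2) * I_sq]
    simp only [map_add, map_mul, conj_ofReal, conj_I, mul_re, mul_im, add_re, add_im, ofReal_re,
      ofReal_im, I_re, I_im, neg_re, neg_im]
    ring
  have r' : ((((c : ℂ) * s + 3) * (s - 1) ^ 2) * (starRingEnd ℂ) (((c : ℂ) * s + 3) *
      (s ^ 2 - 7 / 3 * s + 131 / 10))).re =
      ‖(c : ℂ) * s + 3‖ ^ 2 * ((1 / 4 - t ^ 2) * (731 / 60 - t ^ 2) + 4 / 3 * t ^ 2) := by
    rw [← r, ← re_ofReal_mul, ← normSq_eq_norm_sq, normSq_eq_conj_mul_self, map_mul]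
    ring_nf
  have hn0 : 0 < ‖(c : ℂ) * s + 3‖ := by
    refine norm_pos_iff.mpr fun h ↦ ?_
    rw [h] at n0
    simp at n0
    nlinarith [mul_nonneg (sq_nonneg c) (sq_nonneg t)]
  simp only [r', norm_mul, Complex.norm_ofNat]
  set P := ‖s ^ 2 - 7 / 3 * s + 131 / 10‖
  set C := ‖(c : ℂ) * s + 3‖
  have hP : 0 ≤ P := norm_nonneg _
  rw [mul_assoc C, pow_two, mul_assoc C]
  refine mul_lt_mul_of_pos_left ?_ hn0
  generalize t ^ 2 = x at *
  have k1 : 2 * ‖s - 1‖ * ‖s - 3‖ ≤ 2 * x + 6.5 := by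
    linarith [two_mul_le_add_sq ‖s - 1‖ ‖s - 3‖]
  have k2 : ‖s + 2‖ * ‖s - 3‖ ≤ x + 6.25 := by
    linarith [two_mul_le_add_sq ‖s + 2‖ ‖s - 3‖]
  refine (mul_le_mul_of_nonneg_left (add_le_add (mul_le_mul_of_nonneg_right k1 (by norm_num))
    (mul_le_mul_of_nonneg_right k2 (by norm_num))) hP).trans_lt ?_
  obtain ⟨y, hy, rfl⟩ : ∃ y, 0 ≤ y ∧ x = 54.76 + y := ⟨x - 54.76, by linarith, by ring⟩
  refine lt_of_pow_lt_pow_left₀ 2 (mul_nonneg hn0.le ?_) ?_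
  · nlinarith
  rw [mul_pow, mul_pow, n4, n0]
  have hC : (0.0471 / 2 + 3) ^ 2 + 0.0471 ^ 2 * (54.76 + y) ≤
      (c / 2 + 3) ^ 2 + c ^ 2 * (54.76 + y) := by
    gcongr <;> linarith
  refine lt_of_lt_of_le ?_ (mul_le_mul_of_nonneg_right hC (sq_nonneg _))
  linarith [pow_nonneg hy 2, pow_nonneg hy 3, pow_nonneg hy 4, pow_nonneg hy 5]

/-- An everywhere convergent power series with nonnegative coefficients. -/
def HasNonnegCoeff (f : ℂ → ℂ) : Prop :=
  ∃ c : ℕ → ℝ, (∀ k, 0 ≤ c k) ∧ ∀ z, HasSum (fun k ↦ (c k : ℂ) * z ^ k) (f z)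

namespace HasNonnegCoeff

lemma exists_ofReal_eq {f : ℂ → ℂ} (hf : HasNonnegCoeff f) {r : ℝ} (hr : 0 ≤ r) :
    ∃ v : ℝ, 0 ≤ v ∧ f r = v ∧ ∀ z : ℂ, ‖z‖ ≤ r → ‖f z‖ ≤ v := by
  obtain ⟨c, hc, hs⟩ := hf
  have h := hasSum_re (hs r)
  have e : ∀ k, ((c k : ℂ) * (r : ℂ) ^ k).re = c k * r ^ k := fun k ↦ by norm_cast
  simp only [e] at h
  have h' := hasSum_ofReal.mpr h
  push_cast at h'
  refine ⟨(f r).re, h.nonneg fun k ↦ mul_nonneg (hc k) (pow_nonneg hr k), (hs r).unique h', ?_⟩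
  intro z hz
  rw [← (hs z).tsum_eq]
  refine tsum_of_norm_bounded h fun k ↦ ?_
  rw [norm_mul, norm_pow, norm_real, Real.norm_of_nonneg (hc k)]
  exact mul_le_mul_of_nonneg_left (pow_le_pow_left₀ (norm_nonneg z) hz k) (hc k)

lemma differentiable {f : ℂ → ℂ} (hf : HasNonnegCoeff f) : Differentiable ℂ f := by
  obtain ⟨c, hc, hs⟩ := hf
  intro z
  have hU : Metric.ball (0 : ℂ) (‖z‖ + 1) ∈ nhds z := Metric.isOpen_ball.mem_nhds (by simp)
  have hsum := (hs (‖z‖ + 1 : ℝ)).summable.norm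
  have e : f = fun w ↦ ∑' k, (c k : ℂ) * w ^ k := funext fun w ↦ (hs w).tsum_eq.symm
  rw [e]
  refine (differentiableOn_tsum_of_summable_norm hsum (fun k ↦ ?_) Metric.isOpen_ball
    fun k w hw ↦ ?_).differentiableAt hU
  · fun_prop
  · rw [norm_mul, norm_mul, norm_pow, norm_pow, norm_real (‖z‖ + 1),
      Real.norm_of_nonneg (by positivity : 0 ≤ ‖z‖ + 1)]
    exact mul_le_mul_of_nonneg_left (pow_le_pow_left₀ (norm_nonneg w)
      (mem_ball_zero_iff.mp hw).le k) (norm_nonneg _)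

/-- Divided differences at a nonnegative node preserve nonnegativity of the coefficients. -/
lemma exists_dividedDifference {f : ℂ → ℂ} (hf : HasNonnegCoeff f) {a : ℝ} (ha : 0 ≤ a) :
    ∃ g, HasNonnegCoeff g ∧ ∀ z, f z = f a + (z - a) * g z := by
  obtain ⟨v, -, hv, -⟩ := hf.exists_ofReal_eq ha
  obtain ⟨c, hc, hs⟩ := hf
  have hreal : ∀ r : ℝ, HasSum (fun k ↦ c k * r ^ k) (f r).re := fun r ↦ by
    have h := hasSum_re (hs r)
    have e : ∀ k, ((c k : ℂ) * (r : ℂ) ^ k).re = c k * r ^ k := fun k ↦ by norm_cast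
    simpa only [e] using h
  have hpos : ∀ m k, 0 ≤ c (k + m) * a ^ k := fun m k ↦ mul_nonneg (hc _) (pow_nonneg ha k)
  have hsum : ∀ m, Summable fun k ↦ c (k + m) * a ^ k := by
    intro m
    have h := (summable_nat_add_iff m).mpr (hreal (a + 1)).summable
    refine Summable.of_nonneg_of_le (hpos m) (fun k ↦ ?_) h
    refine mul_le_mul_of_nonneg_left ?_ (hc _)
    exact (pow_le_pow_left₀ ha (by linarith) k).trans
      (pow_le_pow_right₀ (by linarith) (Nat.le_add_right k m))
  set t : ℕ → ℝ := fun m ↦ ∑' k, c (k + m) * a ^ k with ht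
  have ht0 : ∀ m, 0 ≤ t m := fun m ↦ tsum_nonneg (hpos m)
  have hrec : ∀ m, t m = c m + a * t (m + 1) := by
    intro m
    rw [ht]
    simp only
    rw [(hsum m).tsum_eq_zero_add, ← tsum_mul_left]
    simp only [zero_add, pow_zero, mul_one]
    congr 1
    refine tsum_congr fun k ↦ ?_
    rw [show k + 1 + m = k + (m + 1) by ring, pow_succ]
    ring
  have hle : ∀ r : ℝ, a ≤ r → 1 ≤ r → ∀ m, t m * r ^ m ≤ (f r).re := by
    intro r har hr m
    rw [ht]
    simp only
    rw [← tsum_mul_right]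
    have h := hreal r
    have h2 := (summable_nat_add_iff m).mpr h.summable
    have h3 : Summable fun k ↦ c (k + m) * a ^ k * r ^ m := (hsum m).mul_right _
    refine (h3.tsum_le_tsum (fun k ↦ ?_) h2).trans ?_
    · rw [mul_assoc, pow_add]
      exact mul_le_mul_of_nonneg_left (mul_le_mul_of_nonneg_right (pow_le_pow_left₀ ha har k)
        (by positivity)) (hc _)
    · rw [← h.tsum_eq, ← h.summable.sum_add_tsum_nat_add m]
      exact le_add_of_nonneg_left (Finset.sum_nonneg fun k _ ↦ mul_nonneg (hc k) (by positivity))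
  have hsummable : ∀ z : ℂ, Summable fun k ↦ (t k : ℂ) * z ^ k := by
    intro z
    set R : ℝ := 2 * ‖z‖ + a + 1 with hR
    have hz := norm_nonneg z
    have hR1 : 1 ≤ R := by linarith
    refine Summable.of_norm_bounded (g := fun k ↦ (f R).re * (1 / 2) ^ k)
      ((summable_geometric_two).mul_left _) fun k ↦ ?_
    rw [norm_mul, norm_pow, norm_real, Real.norm_of_nonneg (ht0 k)]
    refine le_trans ?_ (mul_le_mul_of_nonneg_right (hle R (by linarith) hR1 k) (by positivity))
    rw [mul_assoc, ← mul_pow]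
    exact mul_le_mul_of_nonneg_left (pow_le_pow_left₀ hz (by linarith) k) (ht0 k)
  refine ⟨fun z ↦ ∑' k, (t (k + 1) : ℂ) * z ^ k, ⟨fun k ↦ t (k + 1), fun k ↦ ht0 _, fun z ↦ ?_⟩,
    fun z ↦ ?_⟩
  all_goals
    have hsh : Summable fun k ↦ (t (k + 1) : ℂ) * z ^ k := by
      by_cases hz : z = 0
      · refine summable_of_ne_finset_zero (s := {0}) fun k hk ↦ ?_
        rw [hz, zero_pow (by simpa using hk), mul_zero]
      · have := ((summable_nat_add_iff 1).mpr (hsummable z)).mul_left z⁻¹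
        refine this.congr fun k ↦ ?_
        rw [pow_succ]
        field_simp
  · exact hsh.hasSum
  · have e0 : f a = t 0 := by
      rw [← (hs a).tsum_eq, ht]
      push_cast
      simp
    have h1 : f z = ∑' k, (t k : ℂ) * z ^ k - a * ∑' k, (t (k + 1) : ℂ) * z ^ k := by
      rw [← (hs z).tsum_eq, ← tsum_mul_left, ← (hsummable z).tsum_sub (hsh.mul_left _)]
      refine tsum_congr fun k ↦ ?_
      rw [hrec k]
      push_cast
      ring
    rw [h1, (hsummable z).tsum_eq_zero_add, e0]
    have : ∀ k, (t (k + 1) : ℂ) * z ^ (k + 1) = z * ((t (k + 1) : ℂ) * z ^ k) := fun k ↦ by ring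
    simp only [this, tsum_mul_left]
    ring

/-- Newton interpolation at nonnegative nodes. -/
lemma exists_newton {f : ℂ → ℂ} (hf : HasNonnegCoeff f) {a : ℕ → ℝ} (ha : ∀ n, 0 ≤ a n) :
    ∃ (g : ℕ → ℂ → ℂ) (d : ℕ → ℝ), g 0 = f ∧ (∀ n, Differentiable ℂ (g n)) ∧ (∀ n, 0 ≤ d n) ∧
      (∀ n z, g n z = d n + (z - a n) * g (n + 1) z) ∧
      ∀ n (z : ℂ), ‖z‖ ≤ a n → ‖g n z‖ ≤ d n := by
  choose! S hS hS' using fun (f : ℂ → ℂ) (b : ℝ) (h : HasNonnegCoeff f ∧ 0 ≤ b) ↦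
    h.1.exists_dividedDifference h.2
  let g : ℕ → ℂ → ℂ := fun n ↦ Nat.rec f (fun n h ↦ S h (a n)) n
  have hg : ∀ n, HasNonnegCoeff (g n) := fun n ↦ by
    induction n with
    | zero => exact hf
    | succ n ih => exact hS (g n) (a n) ⟨ih, ha n⟩
  choose d hd0 hd hdn using fun n ↦ (hg n).exists_ofReal_eq (ha n)
  refine ⟨g, d, rfl, fun n ↦ (hg n).differentiable, hd0, fun n z ↦ ?_, hdn⟩
  rw [hS' (g n) (a n) ⟨hg n, ha n⟩ z, hd n]

end HasNonnegCoeff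

/-- Newton interpolation of the completed zeta function at the even integers `2, 4, 6, …`. -/
lemma exists_newton_entireXi : ∃ (g : ℕ → ℂ → ℂ) (d : ℕ → ℝ),
    (∀ u, entireXi (1 / 2 + u) = 1 + (u ^ 2 - 1 / 4) * g 0 (u ^ 2)) ∧
    (∀ n, Differentiable ℂ (g n)) ∧ (∀ n, 0 ≤ d n) ∧
    (∀ (n : ℕ) z, g n z = d n + (z - ((2 * n + 3 / 2 : ℝ) ^ 2 : ℝ)) * g (n + 1) z) ∧
      ∀ (n : ℕ) (z : ℂ), ‖z‖ ≤ (2 * n + 3 / 2 : ℝ) ^ 2 → ‖g n z‖ ≤ d n := by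
  obtain ⟨c, hc, hs, -⟩ := exists_coeff
  have hroot : ∀ z : ℂ, ∃ u, u ^ 2 = z := fun z ↦ IsAlgClosed.exists_pow_nat_eq z two_pos
  choose u hu using hroot
  have hf : HasNonnegCoeff fun z ↦ completedRiemannZeta₀ (1 / 2 + u z) := by
    refine ⟨c, hc, fun z ↦ ?_⟩
    have h := hs (u z)
    simp only [pow_mul, hu] at h
    exact h
  obtain ⟨g, d, h0, h1, h2, h3, h4⟩ := hf.exists_newton (a := fun n ↦ (2 * n + 3 / 2 : ℝ) ^ 2)
    fun n ↦ sq_nonneg _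
  refine ⟨g, d, fun w ↦ ?_, h1, h2, h3, h4⟩
  have e : completedRiemannZeta₀ (1 / 2 + w) = g 0 (w ^ 2) := by
    rw [h0]
    refine (hs w).unique ?_
    have h := hs (u (w ^ 2))
    simp only [pow_mul, hu] at h
    simpa only [pow_mul] using h
  rw [entireXi, e]
  ring

lemma bernoulli'_twentytwo : bernoulli' 22 = 854513 / 138 := by
  have h := sum_bernoulli' 23
  have h5 := bernoulli'_eq_zero_of_odd (n := 5) (by decide) (by norm_num)
  have h7 := bernoulli'_eq_zero_of_odd (n := 7) (by decide) (by norm_num)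
  have h9 := bernoulli'_eq_zero_of_odd (n := 9) (by decide) (by norm_num)
  have h11 := bernoulli'_eq_zero_of_odd (n := 11) (by decide) (by norm_num)
  have h13 := bernoulli'_eq_zero_of_odd (n := 13) (by decide) (by norm_num)
  have h15 := bernoulli'_eq_zero_of_odd (n := 15) (by decide) (by norm_num)
  have h17 := bernoulli'_eq_zero_of_odd (n := 17) (by decide) (by norm_num)
  have h19 := bernoulli'_eq_zero_of_odd (n := 19) (by decide) (by norm_num)
  have h21 := bernoulli'_eq_zero_of_odd (n := 21) (by decide) (by norm_num)
  norm_num [Finset.sum_range_succ, Nat.choose_eq_factorial_div_factorial, Nat.factorial,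
    h5, h7, h9, h11, h13, h15, h17, h19, h21, bernoulli'_six, bernoulli'_eight, bernoulli'_ten,
    bernoulli'_twelve, bernoulli'_fourteen, bernoulli'_sixteen, bernoulli'_eighteen,
    bernoulli'_twenty] at h
  linarith

set_option maxHeartbeats 2000000 in
/-- Decimal enclosures of the first Newton coefficients of the completed zeta function. -/
lemma newton_coeff_mem {g : ℕ → ℂ → ℂ} {d : ℕ → ℝ}
    (h0 : ∀ u, entireXi (1 / 2 + u) = 1 + (u ^ 2 - 1 / 4) * g 0 (u ^ 2))
    (h3 : ∀ (n : ℕ) z, g n z = d n + (z - ((2 * n + 3 / 2 : ℝ) ^ 2 : ℝ)) * g (n + 1) z) :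
    |d 0 - 0.0235988| ≤ 0.00000002441 ∧
    |d 1 - 0.000273016| ≤ 0.0000000002192 ∧
    |d 2 - 0.00000207378| ≤ 0.000000000002778 ∧
    |d 3 - 0.0000000116702| ≤ 0.00000000000002399 ∧
    |d 4 - 0.0000000000520122| ≤ 0.00000000000000002357 ∧
    |d 5 - 0.000000000000191545| ≤ 0.0000000000000000001877 ∧
    |d 6 - 0.000000000000000600274| ≤ 0.0000000000000000000004598 ∧
    |d 7 - 0.00000000000000000163575| ≤ 0.000000000000000000000003202 ∧
    |d 8 - 0.00000000000000000000394055| ≤ 0.0000000000000000000000000003430 ∧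
    |d 9 - 0.00000000000000000000000850236| ≤ 0.0000000000000000000000000000002524 ∧
    d 10 ≤ 0.00000000000000000000000001661 := by
  have e0 : (1/3 : ℝ) * Real.pi ^ 1 = 1 + 2 * d 0 := by
    have h := h0 (3/2)
    rw [show (1 / 2 + 3/2 : ℂ) = 2 * ((1 : ℕ) : ℂ) by norm_num,
      entireXi_two_mul_nat (by norm_num), h3 0] at h
    norm_num [Nat.factorial, bernoulli'_two] at h
    have h' : (((1/3 : ℝ) * Real.pi ^ 1 : ℝ) : ℂ) = ((1 + 2 * d 0 : ℝ) : ℂ) := by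
      push_cast
      linear_combination h
    exact_mod_cast h'
  have e1 : (2/15 : ℝ) * Real.pi ^ 2 = 1 + 12 * (d 0 + 10 * d 1) := by
    have h := h0 (7/2)
    rw [show (1 / 2 + 7/2 : ℂ) = 2 * ((2 : ℕ) : ℂ) by norm_num,
      entireXi_two_mul_nat (by norm_num), h3 0, h3 1] at h
    norm_num [Nat.factorial, bernoulli'_four] at h
    have h' : (((2/15 : ℝ) * Real.pi ^ 2 : ℝ) : ℂ) = ((1 + 12 * (d 0 + 10 * d 1) : ℝ) : ℂ) := by
      push_cast
      linear_combination h
    exact_mod_cast h'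
  have e2 : (4/63 : ℝ) * Real.pi ^ 3 = 1 + 30 * (d 0 + 28 * (d 1 + 18 * d 2)) := by
    have h := h0 (11/2)
    rw [show (1 / 2 + 11/2 : ℂ) = 2 * ((3 : ℕ) : ℂ) by norm_num,
      entireXi_two_mul_nat (by norm_num), h3 0, h3 1, h3 2] at h
    norm_num [Nat.factorial, bernoulli'_six] at h
    have h' : (((4/63 : ℝ) * Real.pi ^ 3 : ℝ) : ℂ) = ((1 + 30 * (d 0 + 28 * (d 1 + 18 * d 2)) : ℝ) : ℂ) := by
      push_cast
      linear_combination h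
    exact_mod_cast h'
  have e3 : (8/225 : ℝ) * Real.pi ^ 4 = 1 + 56 * (d 0 + 54 * (d 1 + 44 * (d 2 + 26 * d 3))) := by
    have h := h0 (15/2)
    rw [show (1 / 2 + 15/2 : ℂ) = 2 * ((4 : ℕ) : ℂ) by norm_num,
      entireXi_two_mul_nat (by norm_num), h3 0, h3 1, h3 2, h3 3] at h
    norm_num [Nat.factorial, bernoulli'_eight] at h
    have h' : (((8/225 : ℝ) * Real.pi ^ 4 : ℝ) : ℂ) = ((1 + 56 * (d 0 + 54 * (d 1 + 44 * (d 2 + 26 * d 3))) : ℝ) : ℂ) := by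
      push_cast
      linear_combination h
    exact_mod_cast h'
  have e4 : (16/693 : ℝ) * Real.pi ^ 5 = 1 + 90 * (d 0 + 88 * (d 1 + 78 * (d 2 + 60 * (d 3 + 34 * d 4)))) := by
    have h := h0 (19/2)
    rw [show (1 / 2 + 19/2 : ℂ) = 2 * ((5 : ℕ) : ℂ) by norm_num,
      entireXi_two_mul_nat (by norm_num), h3 0, h3 1, h3 2, h3 3, h3 4] at h
    norm_num [Nat.factorial, bernoulli'_ten] at h
    have h' : (((16/693 : ℝ) * Real.pi ^ 5 : ℝ) : ℂ) = ((1 + 90 * (d 0 + 88 * (d 1 + 78 * (d 2 + 60 * (d 3 + 34 * d 4)))) : ℝ) : ℂ) := by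
      push_cast
      linear_combination h
    exact_mod_cast h'
  have e5 : (22112/1289925 : ℝ) * Real.pi ^ 6 = 1 + 132 * (d 0 + 130 * (d 1 + 120 * (d 2 + 102 * (d 3 + 76 * (d 4 + 42 * d 5))))) := by
    have h := h0 (23/2)
    rw [show (1 / 2 + 23/2 : ℂ) = 2 * ((6 : ℕ) : ℂ) by norm_num,
      entireXi_two_mul_nat (by norm_num), h3 0, h3 1, h3 2, h3 3, h3 4, h3 5] at h
    norm_num [Nat.factorial, bernoulli'_twelve] at h
    have h' : (((22112/1289925 : ℝ) * Real.pi ^ 6 : ℝ) : ℂ) = ((1 + 132 * (d 0 + 130 * (d 1 + 120 * (d 2 + 102 * (d 3 + 76 * (d 4 + 42 * d 5))))) : ℝ) : ℂ) := by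
      push_cast
      linear_combination h
    exact_mod_cast h'
  have e6 : (64/4455 : ℝ) * Real.pi ^ 7 = 1 + 182 * (d 0 + 180 * (d 1 + 170 * (d 2 + 152 * (d 3 + 126 * (d 4 + 92 * (d 5 + 50 * d 6)))))) := by
    have h := h0 (27/2)
    rw [show (1 / 2 + 27/2 : ℂ) = 2 * ((7 : ℕ) : ℂ) by norm_num,
      entireXi_two_mul_nat (by norm_num), h3 0, h3 1, h3 2, h3 3, h3 4, h3 5, h3 6] at h
    norm_num [Nat.factorial, bernoulli'_fourteen] at h
    have h' : (((64/4455 : ℝ) * Real.pi ^ 7 : ℝ) : ℂ) = ((1 + 182 * (d 0 + 180 * (d 1 + 170 * (d 2 + 152 * (d 3 + 126 * (d 4 + 92 * (d 5 + 50 * d 6)))))) : ℝ) : ℂ) := by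
      push_cast
      linear_combination h
    exact_mod_cast h'
  have e7 : (462976/34459425 : ℝ) * Real.pi ^ 8 = 1 + 240 * (d 0 + 238 * (d 1 + 228 * (d 2 + 210 * (d 3 + 184 * (d 4 + 150 * (d 5 + 108 * (d 6 + 58 * d 7))))))) := by
    have h := h0 (31/2)
    rw [show (1 / 2 + 31/2 : ℂ) = 2 * ((8 : ℕ) : ℂ) by norm_num,
      entireXi_two_mul_nat (by norm_num), h3 0, h3 1, h3 2, h3 3, h3 4, h3 5, h3 6, h3 7] at h
    norm_num [Nat.factorial, bernoulli'_sixteen] at h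
    have h' : (((462976/34459425 : ℝ) * Real.pi ^ 8 : ℝ) : ℂ) = ((1 + 240 * (d 0 + 238 * (d 1 + 228 * (d 2 + 210 * (d 3 + 184 * (d 4 + 150 * (d 5 + 108 * (d 6 + 58 * d 7))))))) : ℝ) : ℂ) := by
      push_cast
      linear_combination h
    exact_mod_cast h'
  have e8 : (11229952/808782975 : ℝ) * Real.pi ^ 9 = 1 + 306 * (d 0 + 304 * (d 1 + 294 * (d 2 + 276 * (d 3 + 250 * (d 4 + 216 * (d 5 + 174 * (d 6 + 124 * (d 7 + 66 * d 8)))))))) := by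
    have h := h0 (35/2)
    rw [show (1 / 2 + 35/2 : ℂ) = 2 * ((9 : ℕ) : ℂ) by norm_num,
      entireXi_two_mul_nat (by norm_num), h3 0, h3 1, h3 2, h3 3, h3 4, h3 5, h3 6, h3 7, h3 8] at h
    norm_num [Nat.factorial, bernoulli'_eighteen] at h
    have h' : (((11229952/808782975 : ℝ) * Real.pi ^ 9 : ℝ) : ℂ) = ((1 + 306 * (d 0 + 304 * (d 1 + 294 * (d 2 + 276 * (d 3 + 250 * (d 4 + 216 * (d 5 + 174 * (d 6 + 124 * (d 7 + 66 * d 8)))))))) : ℝ) : ℂ) := by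
      push_cast
      linear_combination h
    exact_mod_cast h'
  have e9 : (89400832/5685805125 : ℝ) * Real.pi ^ 10 = 1 + 380 * (d 0 + 378 * (d 1 + 368 * (d 2 + 350 * (d 3 + 324 * (d 4 + 290 * (d 5 + 248 * (d 6 + 198 * (d 7 + 140 * (d 8 + 74 * d 9))))))))) := by
    have h := h0 (39/2)
    rw [show (1 / 2 + 39/2 : ℂ) = 2 * ((10 : ℕ) : ℂ) by norm_num,
      entireXi_two_mul_nat (by norm_num), h3 0, h3 1, h3 2, h3 3, h3 4, h3 5, h3 6, h3 7, h3 8, h3 9] at h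
    norm_num [Nat.factorial, bernoulli'_twenty] at h
    have h' : (((89400832/5685805125 : ℝ) * Real.pi ^ 10 : ℝ) : ℂ) = ((1 + 380 * (d 0 + 378 * (d 1 + 368 * (d 2 + 350 * (d 3 + 324 * (d 4 + 290 * (d 5 + 248 * (d 6 + 198 * (d 7 + 140 * (d 8 + 74 * d 9))))))))) : ℝ) : ℂ) := by
      push_cast
      linear_combination h
    exact_mod_cast h'
  have e10 : (79547392/4106936925 : ℝ) * Real.pi ^ 11 = 1 + 462 * (d 0 + 460 * (d 1 + 450 * (d 2 + 432 * (d 3 + 406 * (d 4 + 372 * (d 5 + 330 * (d 6 + 280 * (d 7 + 222 * (d 8 + 156 * (d 9 + 82 * d 10)))))))))) := by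
    have h := h0 (43/2)
    rw [show (1 / 2 + 43/2 : ℂ) = 2 * ((11 : ℕ) : ℂ) by norm_num,
      entireXi_two_mul_nat (by norm_num), h3 0, h3 1, h3 2, h3 3, h3 4, h3 5, h3 6, h3 7, h3 8, h3 9, h3 10] at h
    norm_num [Nat.factorial, bernoulli'_twentytwo] at h
    have h' : (((79547392/4106936925 : ℝ) * Real.pi ^ 11 : ℝ) : ℂ) = ((1 + 462 * (d 0 + 460 * (d 1 + 450 * (d 2 + 432 * (d 3 + 406 * (d 4 + 372 * (d 5 + 330 * (d 6 + 280 * (d 7 + 222 * (d 8 + 156 * (d 9 + 82 * d 10)))))))))) : ℝ) : ℂ) := by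
      push_cast
      linear_combination h
    exact_mod_cast h'
  have p1 := Real.pi_gt_d20
  have p1' := Real.pi_lt_d20
  have p2 : (9.869604401089358618817 : ℝ) ≤ Real.pi ^ 2 :=
    le_trans (by norm_num) (pow_le_pow_left₀ (by norm_num) p1.le 2)
  have p2' : Real.pi ^ 2 ≤ (9.869604401089358618881 : ℝ) :=
    (pow_le_pow_left₀ Real.pi_pos.le p1'.le 2).trans (by norm_num)
  have p3 : (31.00627668029982017539 : ℝ) ≤ Real.pi ^ 3 :=
    le_trans (by norm_num) (pow_le_pow_left₀ (by norm_num) p1.le 3)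
  have p3' : Real.pi ^ 3 ≤ (31.00627668029982017570 : ℝ) :=
    (pow_le_pow_left₀ Real.pi_pos.le p1'.le 3).trans (by norm_num)
  have p4 : (97.40909103400243723611 : ℝ) ≤ Real.pi ^ 4 :=
    le_trans (by norm_num) (pow_le_pow_left₀ (by norm_num) p1.le 4)
  have p4' : Real.pi ^ 4 ≤ (97.40909103400243723736 : ℝ) :=
    (pow_le_pow_left₀ Real.pi_pos.le p1'.le 4).trans (by norm_num)
  have p5 : (306.0196847852814532614 : ℝ) ≤ Real.pi ^ 5 :=
    le_trans (by norm_num) (pow_le_pow_left₀ (by norm_num) p1.le 5)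
  have p5' : Real.pi ^ 5 ≤ (306.0196847852814532664 : ℝ) :=
    (pow_le_pow_left₀ Real.pi_pos.le p1'.le 5).trans (by norm_num)
  have p6 : (961.3891935753044370253 : ℝ) ≤ Real.pi ^ 6 :=
    le_trans (by norm_num) (pow_le_pow_left₀ (by norm_num) p1.le 6)
  have p6' : Real.pi ^ 6 ≤ (961.3891935753044370438 : ℝ) :=
    (pow_le_pow_left₀ Real.pi_pos.le p1'.le 6).trans (by norm_num)
  have p7 : (3020.293227776792067496 : ℝ) ≤ Real.pi ^ 7 :=
    le_trans (by norm_num) (pow_le_pow_left₀ (by norm_num) p1.le 7)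
  have p7' : Real.pi ^ 7 ≤ (3020.293227776792067564 : ℝ) :=
    (pow_le_pow_left₀ Real.pi_pos.le p1'.le 7).trans (by norm_num)
  have p8 : (9488.531016070574007064 : ℝ) ≤ Real.pi ^ 8 :=
    le_trans (by norm_num) (pow_le_pow_left₀ (by norm_num) p1.le 8)
  have p8' : Real.pi ^ 8 ≤ (9488.531016070574007307 : ℝ) :=
    (pow_le_pow_left₀ Real.pi_pos.le p1'.le 8).trans (by norm_num)
  have p9 : (29809.09933344621166628 : ℝ) ≤ Real.pi ^ 9 :=
    le_trans (by norm_num) (pow_le_pow_left₀ (by norm_num) p1.le 9)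
  have p9' : Real.pi ^ 9 ≤ (29809.09933344621166714 : ℝ) :=
    (pow_le_pow_left₀ Real.pi_pos.le p1'.le 9).trans (by norm_num)
  have p10 : (93648.04747608302097292 : ℝ) ≤ Real.pi ^ 10 :=
    le_trans (by norm_num) (pow_le_pow_left₀ (by norm_num) p1.le 10)
  have p10' : Real.pi ^ 10 ≤ (93648.04747608302097591 : ℝ) :=
    (pow_le_pow_left₀ Real.pi_pos.le p1'.le 10).trans (by norm_num)
  have p11 : (294204.0179738905971029 : ℝ) ≤ Real.pi ^ 11 :=
    le_trans (by norm_num) (pow_le_pow_left₀ (by norm_num) p1.le 11)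
  have p11' : Real.pi ^ 11 ≤ (294204.0179738905971133 : ℝ) :=
    (pow_le_pow_left₀ Real.pi_pos.le p1'.le 11).trans (by norm_num)
  have b0 : (0.023598775598298873 : ℝ) ≤ d 0 ∧ d 0 ≤ 0.023598775598298874 := by
    constructor <;> linarith
  have b1 : (0.00027301621915828884 : ℝ) ≤ d 1 ∧ d 1 ≤ 0.00027301621915828895 := by
    constructor <;> linarith [b0.1, b0.2]
  have b2 : (0.0000020737827775234710 : ℝ) ≤ d 2 ∧ d 2 ≤ 0.0000020737827775234792 := by
    constructor <;> linarith [b0.1, b0.2, b1.1, b1.2]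
  have b3 : (0.000000011670223986105166 : ℝ) ≤ d 3 ∧ d 3 ≤ 0.000000011670223986105595 := by
    constructor <;> linarith [b0.1, b0.2, b1.1, b1.2, b2.1, b2.2]
  have b4 : (0.000000000052012223565848521 : ℝ) ≤ d 4 ∧ d 4 ≤ 0.000000000052012223565865922 := by
    constructor <;> linarith [b0.1, b0.2, b1.1, b1.2, b2.1, b2.2, b3.1, b3.2]
  have b5 : (0.00000000000019154518762655419 : ℝ) ≤ d 5 ∧ d 5 ≤ 0.00000000000019154518762713111 := by
    constructor <;> linarith [b0.1, b0.2, b1.1, b1.2, b2.1, b2.2, b3.1, b3.2, b4.1, b4.2]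
  have b6 : (0.00000000000000060027354028869736 : ℝ) ≤ d 6 ∧ d 6 ≤ 0.00000000000000060027354030485955 := by
    constructor <;> linarith [b0.1, b0.2, b1.1, b1.2, b2.1, b2.2, b3.1, b3.2, b4.1, b4.2, b5.1, b5.2]
  have b7 : (0.0000000000000000016357532008512173 : ℝ) ≤ d 7 ∧ d 7 ≤ 0.0000000000000000016357532012432174 := by
    constructor <;> linarith [b0.1, b0.2, b1.1, b1.2, b2.1, b2.2, b3.1, b3.2, b4.1, b4.2, b5.1, b5.2, b6.1, b6.2]
  have b8 : (0.0000000000000000000039405496570828110 : ℝ) ≤ d 8 ∧ d 8 ≤ 0.0000000000000000000039405496654647506 := by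
    constructor <;> linarith [b0.1, b0.2, b1.1, b1.2, b2.1, b2.2, b3.1, b3.2, b4.1, b4.2, b5.1, b5.2, b6.1, b6.2, b7.1, b7.2]
  have b9 : (0.0000000000000000000000085023600921245613 : ℝ) ≤ d 9 ∧ d 9 ≤ 0.0000000000000000000000085023602523724401 := by
    constructor <;> linarith [b0.1, b0.2, b1.1, b1.2, b2.1, b2.2, b3.1, b3.2, b4.1, b4.2, b5.1, b5.2, b6.1, b6.2, b7.1, b7.2, b8.1, b8.2]
  have b10 : (0.000000000000000000000000016605855922448395 : ℝ) ≤ d 10 ∧ d 10 ≤ 0.000000000000000000000000016605858692690301 := by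
    constructor <;> linarith [b0.1, b0.2, b1.1, b1.2, b2.1, b2.2, b3.1, b3.2, b4.1, b4.2, b5.1, b5.2, b6.1, b6.2, b7.1, b7.2, b8.1, b8.2, b9.1, b9.2]
  refine ⟨abs_le.mpr ⟨by linarith only [b0.1], by linarith only [b0.2]⟩,
    abs_le.mpr ⟨by linarith only [b1.1], by linarith only [b1.2]⟩,
    abs_le.mpr ⟨by linarith only [b2.1], by linarith only [b2.2]⟩,
    abs_le.mpr ⟨by linarith only [b3.1], by linarith only [b3.2]⟩,
    abs_le.mpr ⟨by linarith only [b4.1], by linarith only [b4.2]⟩,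
    abs_le.mpr ⟨by linarith only [b5.1], by linarith only [b5.2]⟩,
    abs_le.mpr ⟨by linarith only [b6.1], by linarith only [b6.2]⟩,
    abs_le.mpr ⟨by linarith only [b7.1], by linarith only [b7.2]⟩,
    abs_le.mpr ⟨by linarith only [b8.1], by linarith only [b8.2]⟩,
    abs_le.mpr ⟨by linarith only [b9.1], by linarith only [b9.2]⟩, b10.2.trans (by norm_num)⟩

/-- A polynomial approximation, in terms of `(w - 1 / 2) ^ 2`, of the entire xi function at `w`. -/
noncomputable def xiPoly (z : ℂ) : ℂ :=
  ((0.994242 : ℝ) : ℂ) + z * (((0.02297194 : ℝ) : ℂ) + z * (((0.000246921 : ℝ) : ℂ) + z * (((0.00000166248 : ℝ) : ℂ) + z * (((0.0000000081048 : ℝ) : ℂ) + z * (((0.000000000025999 : ℝ) : ℂ) + z * (((0.00000000000013351 : ℝ) : ℂ) + z * (((-0.000000000000000207 : ℝ) : ℂ) + z * (((0.00000000000000000249 : ℝ) : ℂ) + z * (((-0.000000000000000000005 : ℝ) : ℂ) + z * (((0.000000000000000000000009 : ℝ) : ℂ)))))))))))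

/-- An error bound for `xiPoly` on the disc of radius `r`. -/
noncomputable def xiErr (r : ℝ) : ℝ :=
  (r + 1 / 4) * (0.00000002441 + (r + 9/4) * (0.0000000002192 + (r + 49/4) * (0.000000000002778 + (r + 121/4) * (0.00000000000002399 + (r + 225/4) * (0.00000000000000002357 + (r + 361/4) * (0.0000000000000000001877 + (r + 529/4) * (0.0000000000000000000004598 + (r + 729/4) * (0.000000000000000000000003202 + (r + 961/4) * (0.0000000000000000000000000003430 + (r + 1225/4) * (0.0000000000000000000000000000002524 + (r + 1521/4) * (0.00000000000000000000000001661))))))))))) +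
  (0.000000444 + r * (0.00000000133 + r * (0.000000000442 + r * (0.00000000000408 + r * (0.00000000000000819 + r * (0.000000000000000335 + r * (0.00000000000000000221 + r * (0.000000000000000000297 + r * (0.00000000000000000000211 + r * (0.00000000000000000000000819 + r * (0.000000000000000000000000498)))))))))))

lemma norm_horner_sub_le {G G' Q z : ℂ} {d D δ e a r : ℝ} (h : G = d + (z - a) * G')
    (hd : |d - D| ≤ δ) (hq : ‖G' - Q‖ ≤ e) (hz : ‖z‖ ≤ r) (ha : 0 ≤ a) :
    ‖G - (D + (z - a) * Q)‖ ≤ δ + (r + a) * e := by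
  have e1 : G - (D + (z - a) * Q) = ((d - D : ℝ) : ℂ) + (z - a) * (G' - Q) := by
    rw [h]
    push_cast
    ring
  have h2 : ‖z - a‖ ≤ r + a := (norm_sub_le _ _).trans (by
    rw [norm_real, Real.norm_of_nonneg ha]
    linarith)
  rw [e1]
  refine (norm_add_le _ _).trans (add_le_add (by rw [norm_real, Real.norm_eq_abs]; exact hd) ?_)
  rw [norm_mul]
  exact mul_le_mul h2 hq (norm_nonneg _) ((norm_nonneg _).trans h2)

lemma norm_entireXi_sub_xiPoly_le {u : ℂ} {r : ℝ} (hu : ‖u ^ 2‖ ≤ r) (hr : r ≤ 400) :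
    ‖entireXi (1 / 2 + u) - xiPoly (u ^ 2)‖ ≤ xiErr r := by
  obtain ⟨g, d, h0, -, -, h3, h4⟩ := exists_newton_entireXi
  obtain ⟨b0, b1, b2, b3, b4, b5, b6, b7, b8, b9, b10⟩ := newton_coeff_mem h0 h3
  have hE := h0 u
  generalize u ^ 2 = z at *
  have k10 : ‖g 10 z - 0‖ ≤ 0.00000000000000000000000001661 := by
    rw [sub_zero]
    exact (h4 10 z (hu.trans (hr.trans (by norm_num)))).trans b10
  have k9 := norm_horner_sub_le (h3 9 z) b9 k10 hu (sq_nonneg _)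
  have k8 := norm_horner_sub_le (h3 8 z) b8 k9 hu (sq_nonneg _)
  have k7 := norm_horner_sub_le (h3 7 z) b7 k8 hu (sq_nonneg _)
  have k6 := norm_horner_sub_le (h3 6 z) b6 k7 hu (sq_nonneg _)
  have k5 := norm_horner_sub_le (h3 5 z) b5 k6 hu (sq_nonneg _)
  have k4 := norm_horner_sub_le (h3 4 z) b4 k5 hu (sq_nonneg _)
  have k3 := norm_horner_sub_le (h3 3 z) b3 k4 hu (sq_nonneg _)
  have k2 := norm_horner_sub_le (h3 2 z) b2 k3 hu (sq_nonneg _)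
  have k1 := norm_horner_sub_le (h3 1 z) b1 k2 hu (sq_nonneg _)
  have k0 := norm_horner_sub_le (h3 0 z) b0 k1 hu (sq_nonneg _)
  have k := norm_horner_sub_le (G := entireXi (1 / 2 + u)) (d := 1) (D := 1) (δ := 0) (a := 1 / 4)
    (by rw [hE]; push_cast; ring) (by simp) k0 hu (by norm_num)
  have m10 : ‖((-12441/25000000000000000000000000000 : ℝ) : ℂ) - 0‖ ≤ 0.000000000000000000000000498 := by
    rw [sub_zero, norm_real, Real.norm_eq_abs, abs_le]
    norm_num
  have m9 := norm_horner_sub_le (d := -81839/10000000000000000000000000000) (D := 0) (δ := 0.00000000000000000000000819) (a := 0) (z := z) rfl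
    (by rw [abs_le]; norm_num) m10 hu le_rfl
  have m8 := norm_horner_sub_le (d := 843860259/400000000000000000000000000000) (D := 0) (δ := 0.00000000000000000000211) (a := 0) (z := z) rfl
    (by rw [abs_le]; norm_num) m9 hu le_rfl
  have m7 := norm_horner_sub_le (d := -11860577357/40000000000000000000000000000) (D := 0) (δ := 0.000000000000000000297) (a := 0) (z := z) rfl
    (by rw [abs_le]; norm_num) m8 hu le_rfl
  have m6 := norm_horner_sub_le (d := 7064495702247/3200000000000000000000000000000) (D := 0) (δ := 0.00000000000000000221) (a := 0) (z := z) rfl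
    (by rw [abs_le]; norm_num) m7 hu le_rfl
  have m5 := norm_horner_sub_le (d := -428070594294941/1280000000000000000000000000000) (D := 0) (δ := 0.000000000000000335) (a := 0) (z := z) rfl
    (by rw [abs_le]; norm_num) m6 hu le_rfl
  have m4 := norm_horner_sub_le (d := 419316394223675687/51200000000000000000000000000000) (D := 0) (δ := 0.00000000000000819) (a := 0) (z := z) rfl
    (by rw [abs_le]; norm_num) m5 hu le_rfl
  have m3 := norm_horner_sub_le (d := -41707700890351449549/10240000000000000000000000000000) (D := 0) (δ := 0.00000000000408) (a := 0) (z := z) rfl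
    (by rw [abs_le]; norm_num) m4 hu le_rfl
  have m2 := norm_horner_sub_le (d := -723647441542318124428061/1638400000000000000000000000000000) (D := 0) (δ := 0.000000000442) (a := 0) (z := z) rfl
    (by rw [abs_le]; norm_num) m3 hu le_rfl
  have m1 := norm_horner_sub_le (d := -174157662202555460372131/131072000000000000000000000000000) (D := 0) (δ := 0.00000000133) (a := 0) (z := z) rfl
    (by rw [abs_le]; norm_num) m2 hu le_rfl
  have m0 := norm_horner_sub_le (d := -18589599372670260995635201/41943040000000000000000000000000) (D := 0) (δ := 0.000000444) (a := 0) (z := z) rfl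
    (by rw [abs_le]; norm_num) m1 hu le_rfl
  have hkm := (norm_add_le _ _).trans (add_le_add k m0)
  refine le_trans (le_of_eq ?_) (hkm.trans (le_of_eq ?_))
  · congr 1
    rw [xiPoly]
    push_cast
    ring
  · rw [xiErr]
    norm_num

noncomputable def xiRe0 (x : ℝ) : ℝ :=
  0.994242 + x * ((-0.02297194) + x * (0.000246921 + x * ((-0.00000166248) + x * (0.0000000081048 + x * ((-0.000000000025999) + x * (0.00000000000013351 + x * (0.000000000000000207 + x * (0.00000000000000000249 + x * (0.000000000000000000005 + x * (0.000000000000000000000009))))))))))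

noncomputable def xiRe1 (x : ℝ) : ℝ :=
  1.017462531610932305485009 + x * ((-0.02447863131314812103671) + x * (0.000272431061674759543605 + x * ((-0.00000189499695146644884) + x * (0.00000000934025265764373 + x * ((-0.000000000034623175792804) + x * (0.00000000000011911311373 + x * ((-0.00000000000000007684884) + x * (0.000000000000000001768605 + x * (0.00000000000000000000329 + x * (0.000000000000000000000009))))))))))

noncomputable def xiIm1 (x : ℝ) : ℝ :=
  0.04694160397998926175018 + x * ((-0.00102139061797824233026) + x * (0.000010435405884339619536 + x * ((-0.00000006806333782317768) + x * (0.00000000028897603001164 + x * ((-0.00000000000153749071164) + x * ((-0.00000000000000154574232) + x * ((-0.000000000000000035899536) + x * ((-0.00000000000000000007974) + x * ((-0.00000000000000000000018))))))))))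

noncomputable def xiRe2 (x : ℝ) : ℝ :=
  1.090188996715403355357184 + x * ((-0.02931187146090934042624) + x * (0.00035611332708166729728 + x * ((-0.00000266533039638675456) + x * (0.00000001381021991159808 + x * ((-0.000000000059152175351296) + x * (0.00000000000012502055488 + x * ((-0.00000000000000076572576) + x * (0.00000000000000000012768 + x * ((-0.00000000000000000000184) + x * (0.000000000000000000000009))))))))))

noncomputable def xiIm2 (x : ℝ) : ℝ :=
  0.10011686384877511901184 + x * ((-0.00225630284178427215872) + x * (0.000023803710794122395648 + x * ((-0.00000015794284763283456) + x * (0.00000000074522113743872 + x * ((-0.00000000000292990483968) + x * (0.00000000000000407762304 + x * ((-0.000000000000000051505152) + x * ((-0.00000000000000000009792) + x * ((-0.00000000000000000000036))))))))))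

lemma xiPoly_sq_zero (t : ℝ) : xiPoly (((0 : ℝ) + t * I) ^ 2) =
    (xiRe0 (t ^ 2) : ℂ) + (t * 0 : ℝ) * I := by
  have h : (t : ℂ) ^ 2 = -(t * I) ^ 2 := by
    rw [mul_pow, I_sq]
    ring
  rw [xiPoly, xiRe0]
  push_cast
  rw [h]
  generalize (t : ℂ) * I = w
  ring

lemma xiPoly_sq_one (t : ℝ) : xiPoly (((1 : ℝ) + t * I) ^ 2) =
    (xiRe1 (t ^ 2) : ℂ) + (t * xiIm1 (t ^ 2) : ℝ) * I := by
  have h : (t : ℂ) ^ 2 = -(t * I) ^ 2 := by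
    rw [mul_pow, I_sq]
    ring
  rw [xiPoly, xiRe1, xiIm1]
  push_cast
  rw [mul_right_comm, h]
  generalize (t : ℂ) * I = w
  ring

lemma xiPoly_sq_two (t : ℝ) : xiPoly (((2 : ℝ) + t * I) ^ 2) =
    (xiRe2 (t ^ 2) : ℂ) + (t * xiIm2 (t ^ 2) : ℝ) * I := by
  have h : (t : ℂ) ^ 2 = -(t * I) ^ 2 := by
    rw [mul_pow, I_sq]
    ring
  rw [xiPoly, xiRe2, xiIm2]
  push_cast
  rw [mul_right_comm, h]
  generalize (t : ℂ) * I = w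
  ring

lemma re_mul_conj_ge_of_norm_sub_le {l p v v' T T' : ℂ} {L Q η V τ M : ℝ} (hl : ‖l‖ ≤ L)
    (hp : ‖p‖ ≤ Q) (hv : ‖v - v'‖ ≤ η) (hv' : ‖v'‖ ≤ V) (hT : ‖T - T'‖ ≤ τ) (hM : ‖T‖ ≤ M) :
    ((l * v' - T') * (starRingEnd ℂ) (v' * p)).re - Q * (L * (η * (2 * V + η)) + M * η + τ * V) ≤
      ((l * v - T) * (starRingEnd ℂ) (v * p)).re := by
  have hL := (norm_nonneg _).trans hl
  have hη := (norm_nonneg _).trans hv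
  have hV := (norm_nonneg _).trans hv'
  have hτ := (norm_nonneg _).trans hT
  have hM' := (norm_nonneg _).trans hM
  have hQ := (norm_nonneg _).trans hp
  have e : (l * v' - T') * (starRingEnd ℂ) (v' * p) - (l * v - T) * (starRingEnd ℂ) (v * p) =
      (starRingEnd ℂ) p * (T * (starRingEnd ℂ) (v - v') + (T - T') * (starRingEnd ℂ) v' -
        l * ((v - v') * (starRingEnd ℂ) v' + v' * (starRingEnd ℂ) (v - v') +
          (v - v') * (starRingEnd ℂ) (v - v'))) := by
    simp only [map_mul, map_sub]
    ring
  have h := re_le_norm ((l * v' - T') * (starRingEnd ℂ) (v' * p) -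
    (l * v - T) * (starRingEnd ℂ) (v * p))
  rw [sub_re] at h
  have b : ‖(l * v' - T') * (starRingEnd ℂ) (v' * p) - (l * v - T) * (starRingEnd ℂ) (v * p)‖ ≤
      Q * (M * η + τ * V + L * (η * V + V * η + η * η)) := by
    rw [e, norm_mul, norm_conj]
    refine mul_le_mul hp ?_ (norm_nonneg _) hQ
    refine (norm_sub_le _ _).trans (add_le_add ((norm_add_le _ _).trans (add_le_add ?_ ?_)) ?_)
    · rw [norm_mul, norm_conj]
      gcongr
    · rw [norm_mul, norm_conj]
      gcongr
    · rw [norm_mul]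
      refine mul_le_mul hl ?_ (norm_nonneg _) hL
      refine (norm_add₃_le).trans (add_le_add (add_le_add ?_ ?_) ?_)
      all_goals
        rw [norm_mul, norm_conj]
        gcongr
  linarith

/-- The approximation to the quantity in `wengW_line_pos_of_large` obtained from `xiPoly`,
as a function of the squared ordinate. -/
noncomputable def wengApprox (x : ℝ) : ℝ :=
  let vr := 3.0236 * xiRe2 x - x * (0.0472 * xiIm2 x)
  let vi := 3.0236 * xiIm2 x + 0.0472 * xiRe2 x
  let dr := (1 / 4 - x) * vr + x * vi -
    ((5 / 2 - 2 * x) * xiRe1 x + 6 * x * xiIm1 x - (x + 25 / 4) * xiRe0 x)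
  let di := (1 / 4 - x) * vi - vr - ((5 / 2 - 2 * x) * xiIm1 x - 6 * xiRe1 x)
  dr * ((731 / 60 - x) * vr + 4 / 3 * x * vi) + x * (di * ((731 / 60 - x) * vi - 4 / 3 * vr))

set_option maxHeartbeats 1000000 in
lemma wengW_line_pos_of_le {s : ℂ} (hs : s.re = 1 / 2) {X K Q U S ε₀ ε₁ ε₂ : ℝ}
    (hx : s.im ^ 2 ≤ X) (hX : X ≤ 100) (hε₀ : xiErr X ≤ ε₀) (hε₁ : xiErr (X + 1) ≤ ε₁)
    (hε₂ : xiErr (X + 4) ≤ ε₂) (hK0 : 0 ≤ K) (hQ0 : 0 ≤ Q) (hU0 : 0 ≤ U) (hS0 : 0 ≤ S)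
    (hK : xiRe2 (s.im ^ 2) ^ 2 + s.im ^ 2 * xiIm2 (s.im ^ 2) ^ 2 ≤ K ^ 2)
    (hQ : (731 / 60 - s.im ^ 2) ^ 2 + 16 / 9 * s.im ^ 2 ≤ Q ^ 2)
    (hU : 3.0236 ^ 2 + 0.0472 ^ 2 * X ≤ U ^ 2) (hS : 1 / 4 + X ≤ S ^ 2)
    (hG : Q * ((X + 1 / 4) * ((U * ε₂ + 0.000003 * S * (K + ε₂)) *
      (2 * (U * K) + (U * ε₂ + 0.000003 * S * (K + ε₂)))) +
      ((2 * X + 6.5) * (0.9471 * (K + ε₂)) + (X + 6.25) * (0.93 * (K + ε₂))) *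
        (U * ε₂ + 0.000003 * S * (K + ε₂)) +
      ((2 * X + 6.5) * ε₁ + (X + 6.25) * ε₀) * (U * K)) < wengApprox (s.im ^ 2)) :
    0 < (wengW s * (starRingEnd ℂ) (entireXi (s + 2) *
      ((((Real.pi / 3 - 1 : ℝ) : ℂ) * s + 3) * (s ^ 2 - 7 / 3 * s + 131 / 10)))).re := by
  have b1 := norm_entireXi_add_one_le_of_re_eq_half hs
  have b0 := norm_entireXi_le_of_re_eq_half hs
  obtain ⟨hc1, hc2⟩ := pi_div_three_sub_one_mem
  set c : ℝ := Real.pi / 3 - 1 with hc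
  set t := s.im with ht
  have hst : s = ((1 / 2 : ℝ) : ℂ) + t * I := by rw [← hs, re_add_im]
  have hX0 : 0 ≤ X := (sq_nonneg t).trans hx
  have nk : ∀ k : ℝ, ‖((k : ℂ) + t * I) ^ 2‖ ≤ X + k ^ 2 := fun k ↦ by
    rw [norm_pow, norm_add_mul_I_sq]
    linarith
  have d0 : ‖entireXi s - xiRe0 (t ^ 2)‖ ≤ ε₀ := by
    have h := norm_entireXi_sub_xiPoly_le ((nk 0).trans_eq (by ring : _ = X)) (by linarith)
    rw [xiPoly_sq_zero] at h
    refine le_trans (le_of_eq ?_) (h.trans hε₀)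
    congr 2
    · rw [hst]
      push_cast
      ring_nf
    · push_cast
      ring
  have d1 : ‖entireXi (s + 1) - ((xiRe1 (t ^ 2) : ℂ) + (t * xiIm1 (t ^ 2) : ℝ) * I)‖ ≤ ε₁ := by
    have h := norm_entireXi_sub_xiPoly_le ((nk 1).trans_eq (by ring : _ = X + 1)) (by linarith)
    rw [xiPoly_sq_one] at h
    refine le_trans (le_of_eq ?_) (h.trans hε₁)
    congr 2
    rw [hst]
    push_cast
    ring_nf
  have d2 : ‖entireXi (s + 2) - ((xiRe2 (t ^ 2) : ℂ) + (t * xiIm2 (t ^ 2) : ℝ) * I)‖ ≤ ε₂ := by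
    have h := norm_entireXi_sub_xiPoly_le ((nk 2).trans_eq (by ring : _ = X + 4)) (by linarith)
    rw [xiPoly_sq_two] at h
    refine le_trans (le_of_eq ?_) (h.trans hε₂)
    congr 2
    rw [hst]
    push_cast
    ring_nf
  set P₂ : ℂ := (xiRe2 (t ^ 2) : ℂ) + (t * xiIm2 (t ^ 2) : ℝ) * I with hP₂
  set P₁ : ℂ := (xiRe1 (t ^ 2) : ℂ) + (t * xiIm1 (t ^ 2) : ℝ) * I with hP₁
  have hε₂0 := (norm_nonneg _).trans d2
  have nP : ‖P₂‖ ≤ K := by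
    refine le_of_sq_le_sq ?_ hK0
    rw [hP₂, norm_add_mul_I_sq]
    linarith
  have nE : ‖entireXi (s + 2)‖ ≤ K + ε₂ := by
    have := norm_le_norm_add_norm_sub P₂ (entireXi (s + 2))
    rw [norm_sub_rev] at this
    linarith
  have nu : ‖((0.0472 : ℝ) : ℂ) * s + 3‖ ≤ U := by
    refine le_of_sq_le_sq ?_ hU0
    rw [hst, show ((0.0472 : ℝ) : ℂ) * ((1 / 2 : ℝ) + t * I) + 3 =
      ((3.0236 : ℝ) : ℂ) + (0.0472 * t : ℝ) * I by push_cast; ring, norm_add_mul_I_sq]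
    linarith
  have ns : ‖s‖ ≤ S := by
    refine le_of_sq_le_sq ?_ hS0
    rw [hst, norm_add_mul_I_sq]
    linarith
  have nd : ‖((c : ℂ) * s + 3) - (((0.0472 : ℝ) : ℂ) * s + 3)‖ ≤ 0.000003 * S := by
    rw [show ((c : ℂ) * s + 3) - (((0.0472 : ℝ) : ℂ) * s + 3) = ((c - 0.0472 : ℝ) : ℂ) * s by
      push_cast; ring, norm_mul, norm_real, Real.norm_eq_abs]
    refine mul_le_mul (abs_le.mpr ⟨by linarith, by linarith⟩) ns (norm_nonneg _) (by norm_num)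
  have n1 : ‖s - 1‖ ^ 2 = 1 / 4 + t ^ 2 := by
    rw [hst, show ((1 / 2 : ℝ) : ℂ) + t * I - 1 = ((-1 / 2 : ℝ) : ℂ) + t * I by
      push_cast; ring, norm_add_mul_I_sq]
    ring
  have n2 : ‖s + 2‖ ^ 2 = 25 / 4 + t ^ 2 := by
    rw [hst, show ((1 / 2 : ℝ) : ℂ) + t * I + 2 = ((5 / 2 : ℝ) : ℂ) + t * I by
      push_cast; ring, norm_add_mul_I_sq]
    ring
  have n3 : ‖s - 3‖ ^ 2 = 25 / 4 + t ^ 2 := by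
    rw [hst, show ((1 / 2 : ℝ) : ℂ) + t * I - 3 = ((-5 / 2 : ℝ) : ℂ) + t * I by
      push_cast; ring, norm_add_mul_I_sq]
    ring
  have na : ‖2 * (s - 1) * (s - 3)‖ ≤ 2 * X + 6.5 := by
    rw [norm_mul, norm_mul, Complex.norm_ofNat]
    linarith [two_mul_le_add_sq ‖s - 1‖ ‖s - 3‖]
  have nb : ‖(s + 2) * (s - 3)‖ ≤ X + 6.25 := by
    rw [norm_mul]
    linarith [two_mul_le_add_sq ‖s + 2‖ ‖s - 3‖]
  have nl : ‖(s - 1) ^ 2‖ ≤ X + 1 / 4 := by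
    rw [norm_pow]
    linarith
  have e4 : s ^ 2 - 7 / 3 * s + 131 / 10 = ((731 / 60 - t ^ 2 : ℝ) : ℂ) + (-4 / 3 * t : ℝ) * I := by
    rw [hst]
    push_cast
    linear_combination ((t : ℂ) ^ 2) * I_sq
  have np : ‖s ^ 2 - 7 / 3 * s + 131 / 10‖ ≤ Q := by
    refine le_of_sq_le_sq ?_ hQ0
    rw [e4, norm_add_mul_I_sq]
    linarith
  have hv : ‖((c : ℂ) * s + 3) * entireXi (s + 2) - (((0.0472 : ℝ) : ℂ) * s + 3) * P₂‖ ≤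
      U * ε₂ + 0.000003 * S * (K + ε₂) := by
    rw [show ((c : ℂ) * s + 3) * entireXi (s + 2) - (((0.0472 : ℝ) : ℂ) * s + 3) * P₂ =
      (((0.0472 : ℝ) : ℂ) * s + 3) * (entireXi (s + 2) - P₂) +
      (((c : ℂ) * s + 3) - (((0.0472 : ℝ) : ℂ) * s + 3)) * entireXi (s + 2) by ring]
    refine (norm_add_le _ _).trans (add_le_add ?_ ?_)
    · rw [norm_mul]
      gcongr
    · rw [norm_mul]
      gcongr
  have hv' : ‖(((0.0472 : ℝ) : ℂ) * s + 3) * P₂‖ ≤ U * K := by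
    rw [norm_mul]
    gcongr
  have hT : ‖(2 * (s - 1) * (s - 3) * entireXi (s + 1) + (s + 2) * (s - 3) * entireXi s) -
      (2 * (s - 1) * (s - 3) * P₁ + (s + 2) * (s - 3) * xiRe0 (t ^ 2))‖ ≤
      (2 * X + 6.5) * ε₁ + (X + 6.25) * ε₀ := by
    rw [show (2 * (s - 1) * (s - 3) * entireXi (s + 1) + (s + 2) * (s - 3) * entireXi s) -
      (2 * (s - 1) * (s - 3) * P₁ + (s + 2) * (s - 3) * xiRe0 (t ^ 2)) =
      2 * (s - 1) * (s - 3) * (entireXi (s + 1) - P₁) +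
        (s + 2) * (s - 3) * (entireXi s - xiRe0 (t ^ 2)) by ring]
    refine (norm_add_le _ _).trans (add_le_add ?_ ?_)
    · rw [norm_mul]
      gcongr
    · rw [norm_mul]
      gcongr
  have hM : ‖2 * (s - 1) * (s - 3) * entireXi (s + 1) + (s + 2) * (s - 3) * entireXi s‖ ≤
      (2 * X + 6.5) * (0.9471 * (K + ε₂)) + (X + 6.25) * (0.93 * (K + ε₂)) := by
    refine (norm_add_le _ _).trans (add_le_add ?_ ?_)
    · rw [norm_mul]
      exact mul_le_mul na (b1.trans (by linarith)) (norm_nonneg _) (by linarith)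
    · rw [norm_mul]
      exact mul_le_mul nb (b0.trans (by linarith)) (norm_nonneg _) (by linarith)
  have key := re_mul_conj_ge_of_norm_sub_le nl np hv hv' hT hM
  have eG : (((s - 1) ^ 2 * ((((0.0472 : ℝ) : ℂ) * s + 3) * P₂) -
      (2 * (s - 1) * (s - 3) * P₁ + (s + 2) * (s - 3) * xiRe0 (t ^ 2))) *
      (starRingEnd ℂ) ((((0.0472 : ℝ) : ℂ) * s + 3) * P₂ * (s ^ 2 - 7 / 3 * s + 131 / 10))).re =
      wengApprox (t ^ 2) := by
    rw [e4, hP₂, hP₁, wengApprox, hst]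
    generalize xiRe2 (t ^ 2) = α₂
    generalize xiRe1 (t ^ 2) = α₁
    generalize xiRe0 (t ^ 2) = α₀
    generalize xiIm2 (t ^ 2) = β₂
    generalize xiIm1 (t ^ 2) = β₁
    rw [show (((1 / 2 : ℝ) : ℂ) + t * I - 1) ^ 2 = ((1 / 4 - t ^ 2 : ℝ) : ℂ) + (-t : ℝ) * I by
      push_cast; linear_combination ((t : ℂ) ^ 2) * I_sq,
      show 2 * (((1 / 2 : ℝ) : ℂ) + t * I - 1) * ((1 / 2 : ℝ) + t * I - 3) =
        ((5 / 2 - 2 * t ^ 2 : ℝ) : ℂ) + (-6 * t : ℝ) * I by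
      push_cast; linear_combination (2 * (t : ℂ) ^ 2) * I_sq,
      show (((1 / 2 : ℝ) : ℂ) + t * I + 2) * ((1 / 2 : ℝ) + t * I - 3) =
        ((-(t ^ 2 + 25 / 4) : ℝ) : ℂ) by
      push_cast; linear_combination ((t : ℂ) ^ 2) * I_sq,
      show ((0.0472 : ℝ) : ℂ) * ((1 / 2 : ℝ) + t * I) + 3 =
      ((3.0236 : ℝ) : ℂ) + (0.0472 * t : ℝ) * I by push_cast; ring]
    simp only [map_add, map_mul, conj_ofReal, conj_I, mul_re, mul_im, add_re, add_im,
      sub_re, sub_im, ofReal_re, ofReal_im, I_re, I_im, neg_re, neg_im]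
    ring
  rw [eG] at key
  refine lt_of_lt_of_le (sub_pos.mpr hG) (key.trans (le_of_eq ?_))
  rw [wengW]
  congr 1
  rw [← hc]
  simp only [map_mul]
  ring

lemma wengApprox_ge {x : ℝ} (hx : 0 ≤ x) :
    180.495 + x * ((-30.08791) + x * (1.5570581 + x * ((-0.00639541) + x * ((-0.0008210417) + x * (0.000023705702 + x * ((-0.00000036403306) + x * (0.000000003839958 + x * ((-0.00000000003110978) + x * (0.0000000000002034259 + x * ((-0.000000000000001095) + x * (0.0000000000000000050421 + x * ((-0.00000000000000000002004) + x * (0.00000000000000000000007784 + x * ((-0.0000000000000000000000001716) + x * (0.00000000000000000000000000119 + x * (0.0000000000000000000000000000018 + x * (0.000000000000000000000000000000021 + x * (0 + x * (0 + x * (0 + x * (0 + x * ((-0.00000000000000000000000000000000000000001) + x * (0))))))))))))))))))))))) ≤ wengApprox x := by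
  have h : wengApprox x = (180.495 + x * ((-30.08791) + x * (1.5570581 + x * ((-0.00639541) + x * ((-0.0008210417) + x * (0.000023705702 + x * ((-0.00000036403306) + x * (0.000000003839958 + x * ((-0.00000000003110978) + x * (0.0000000000002034259 + x * ((-0.000000000000001095) + x * (0.0000000000000000050421 + x * ((-0.00000000000000000002004) + x * (0.00000000000000000000007784 + x * ((-0.0000000000000000000000001716) + x * (0.00000000000000000000000000119 + x * (0.0000000000000000000000000000018 + x * (0.000000000000000000000000000000021 + x * (0 + x * (0 + x * (0 + x * (0 + x * ((-0.00000000000000000000000000000000000000001) + x * (0)))))))))))))))))))))))) +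
      ((0.002126897888645418273984261338149486273450988632939692032 / 3) + x * ((0.00002952840420189190456952385992913524380239719236108288 / 3) + x * ((0.000000251930480336731533304213921936251123703875400368128 / 3) + x * ((0.00000000684808316957627907930007249568362019341347586048 / 3) + x * ((0.00000000013579522694104758583468830391952700358664093696 / 3) + x * (0.000000000000799948587163156876211041585582584189170294784 + x * ((0.000000000000004203937331031653510956845176877707798272 / 3) + x * ((0.000000000000000735731972331596067902530120391187232519168 / 3) + x * ((0.00000000000000000952742200545302590718247694780158820864 / 3) + x * ((0.00000000000000000020067061454230601712699683805496414592 / 3) + x * ((0.000000000000000000001607922131494521315072830593197431152 / 3) + x * ((0.00000000000000000000024621324865759249023167898178609072 / 3) + x * ((0.000000000000000000000001837349872137300602095540689873328 / 3) + x * ((0.0000000000000000000000000157265046919952366571888134944 / 3) + x * ((0.00000000000000000000000000010646760280728624082893604528 / 3) + x * ((0.000000000000000000000000000007901317702755434737645704512 / 3) + x * ((0.00000000000000000000000000000014526619465357805565177904 / 3) + x * (0.000000000000000000000000000000000354245940475179091963776 + x * ((0.00000000000000000000000000000000015076500949334686254136 / 3) + x * ((0.00000000000000000000000000000000000048374453323329915184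 / 3) + x * (0.000000000000000000000000000000000000000169171104452702234 + x * (0.00000000000000000000000000000000000000000020084985370012 + x * (0.000000000000000000000000000000000000000009999905216466016 + x * (0.00000000000000000000000000000000000000000000000018045504)))))))))))))))))))))))) := by
    simp only [wengApprox, xiRe0, xiRe1, xiRe2, xiIm1, xiIm2]
    ring
  rw [h]
  exact le_add_of_nonneg_right (by positivity)

lemma xiRe2_sq_add_le {x : ℝ} (hx : 0 ≤ x) :
    xiRe2 x ^ 2 + x * xiIm2 x ^ 2 ≤ 1.1885121 + x * ((-0.053887573) + x * (0.00118385955 + x * ((-0.000016830915) + x * (0.0000001741376 + x * ((-0.0000000014083313) + x * (0.000000000009211501 + x * ((-0.0000000000000502841) + x * (0.00000000000000023665 + x * ((-0.0000000000000000009693) + x * (0.0000000000000000000035153 + x * ((-0.00000000000000000000001056) + x * (0.0000000000000000000000000391 + x * ((-0.000000000000000000000000000019) + x * (0.00000000000000000000000000000071 + x * (0.000000000000000000000000000000003 + x * (0.00000000000000000000000000000000002 + x * (0.0000000000000000000000000000000000001 + x * (0.00000000000000000000000000000000000001 + x * (0.0000000000000000000000000000000000000001 + x * (0.000000000000000000000000000000000000000001))))))))))))))))))))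 := by
  have h : 1.1885121 + x * ((-0.053887573) + x * (0.00118385955 + x * ((-0.000016830915) + x * (0.0000001741376 + x * ((-0.0000000014083313) + x * (0.000000000009211501 + x * ((-0.0000000000000502841) + x * (0.00000000000000023665 + x * ((-0.0000000000000000009693) + x * (0.0000000000000000000035153 + x * ((-0.00000000000000000000001056) + x * (0.0000000000000000000000000391 + x * ((-0.000000000000000000000000000019) + x * (0.00000000000000000000000000000071 + x * (0.000000000000000000000000000000003 + x * (0.00000000000000000000000000000000002 + x * (0.0000000000000000000000000000000000001 + x * (0.00000000000000000000000000000000000001 + x * (0.0000000000000000000000000000000000000001 + x * (0.000000000000000000000000000000000000000001)))))))))))))))))))) = xiRe2 x ^ 2 + x * xiIm2 x ^ 2 +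
      (0.000000051440662252064438746449154710967779590144 + x * (0.00000000005272506222622228131600217995395203072 + x * (0.00000000000874787495786877819353730174257463296 + x * (0.00000000000062018775916399721073359332724178944 + x * (0.00000000000000049991816161529187423117406896128 + x * (0.000000000000000087863693682663562859266676097024 + x * (0.00000000000000000081182575471066446543731032064 + x * (0.00000000000000000001534642284637894290840748032 + x * (0.00000000000000000000025730093166807857011621888 + x * (0.00000000000000000000000829574150695418431799296 + x * (0.000000000000000000000000099065630108222339416064 + x * (0.00000000000000000000000000452314182727694483456 + x * (0.00000000000000000000000000000283386636464283648 + x * (0.00000000000000000000000000000015343408708001792 + x * (0.00000000000000000000000000000000827869197748224 + x * (0.000000000000000000000000000000000756600057396224 + x * (0.00000000000000000000000000000000000776457665408 + x * (0.00000000000000000000000000000000000006758089024 + x * (0.00000000000000000000000000000000000000992381376 + x * (0.00000000000000000000000000000000000000009990352 + x * (0.000000000000000000000000000000000000000000999919))))))))))))))))))))) := by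
    simp only [xiRe2, xiIm2]
    ring
  rw [h]
  exact le_add_of_nonneg_right (by positivity)

lemma bernstein_zero_ge {x : ℝ} (h0 : 0 ≤ x) (h1 : x ≤ 25) :
    6.646 ≤ 180.495 + x * ((-30.08791) + x * (1.5570581 + x * ((-0.00639541) + x * ((-0.0008210417) + x * (0.000023705702 + x * ((-0.00000036403306) + x * (0.000000003839958 + x * ((-0.00000000003110978) + x * (0.0000000000002034259 + x * ((-0.000000000000001095) + x * (0.0000000000000000050421 + x * ((-0.00000000000000000002004) + x * (0.00000000000000000000007784 + x * ((-0.0000000000000000000000001716) + x * (0.00000000000000000000000000119 + x * (0.0000000000000000000000000000018 + x * (0.000000000000000000000000000000021 + x * (0 + x * (0 + x * (0 + x * (0 + x * ((-0.00000000000000000000000000000000000000001) + x * (0))))))))))))))))))))))) := by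
  obtain ⟨y, rfl⟩ : ∃ y, x = 0 + 25 * y := ⟨(x - 0) / 25, by ring⟩
  have hy : 0 ≤ y := by linarith
  have hw : 0 ≤ 1 - y := by linarith
  have h : 180.495 + (0 + 25 * y) * ((-30.08791) + (0 + 25 * y) * (1.5570581 + (0 + 25 * y) * ((-0.00639541) + (0 + 25 * y) * ((-0.0008210417) + (0 + 25 * y) * (0.000023705702 + (0 + 25 * y) * ((-0.00000036403306) + (0 + 25 * y) * (0.000000003839958 + (0 + 25 * y) * ((-0.00000000003110978) + (0 + 25 * y) * (0.0000000000002034259 + (0 + 25 * y) * ((-0.000000000000001095) + (0 + 25 * y) * (0.0000000000000000050421 + (0 + 25 * y) * ((-0.00000000000000000002004) + (0 + 25 * y) * (0.00000000000000000000007784 + (0 + 25 * y) * ((-0.0000000000000000000000001716) + (0 + 25 * y) * (0.00000000000000000000000000119 + (0 + 25 * y) * (0.0000000000000000000000000000018 + (0 + 25 * y) * (0.000000000000000000000000000000021 + (0 + 25 * y) * (0 + (0 + 25 * y) * (0 + (0 + 25 * y) * (0 + (0 + 25 * y) * (0 + (0 + 25 * y) * ((-0.00000000000000000000000000000000000000001)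 + (0 + 25 * y) * (0))))))))))))))))))))))) = 6.646 + (173.849 * (1 - y) ^ 23 + 3246.32925 * y * (1 - y) ^ 22 + 28408.6078125 * y ^ 2 * (1 - y) ^ 21 + 154465.35803125 * y ^ 3 * (1 - y) ^ 20 + 583092.9505859375 * y ^ 4 * (1 - y) ^ 19 + 1616974.46406640625 * y ^ 5 * (1 - y) ^ 18 + 3400846.7920537109375 * y ^ 6 * (1 - y) ^ 17 + 5538430.69567626953125 * y ^ 7 * (1 - y) ^ 16 + 7150202.4766336669921875 * y ^ 8 * (1 - y) ^ 15 + 7744741.5947124481201171875 * y ^ 9 * (1 - y) ^ 14 + 8101535.80707830810546875 * y ^ 10 * (1 - y) ^ 13 + 9732860.7045933704376220703125 * y ^ 11 * (1 - y) ^ 12 + 13021577.891396732330322265625 * y ^ 12 * (1 - y) ^ 11 + 16224614.25601371860504150390625 * y ^ 13 * (1 - y) ^ 10 + 16880257.76305260360240936279296875 * y ^ 14 * (1 - y) ^ 9 + 14153094.50275755403935909271240234375 * y ^ 15 * (1 - y) ^ 8 + 9468743.584985714264214038848876953125 * y ^ 16 * (1 - y) ^ 7 + 5022203.277691428181715309619903564453125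 * y ^ 17 * (1 - y) ^ 6 + 2088802.89470333874784409999847412109375 * y ^ 18 * (1 - y) ^ 5 + 667969.629920467617921531200408935546875 * y ^ 19 * (1 - y) ^ 4 + 158800.9179263439737260341644287109375 * y ^ 20 * (1 - y) ^ 3 + 26470.457276186632923781871795654296875 * y ^ 21 * (1 - y) ^ 2 + 2763.89815115281284306547604501247406005859375 * y ^ 22 * (1 - y) + 136.16339090985056463978253304958343505859375 * y ^ 23) := by
    ring
  rw [h]
  generalize 1 - y = w at hw
  exact le_add_of_nonneg_right (by positivity)

lemma bernstein_zero_le {x : ℝ} (h0 : 0 ≤ x) (h1 : x ≤ 25) :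
    1.1885121 + x * ((-0.053887573) + x * (0.00118385955 + x * ((-0.000016830915) + x * (0.0000001741376 + x * ((-0.0000000014083313) + x * (0.000000000009211501 + x * ((-0.0000000000000502841) + x * (0.00000000000000023665 + x * ((-0.0000000000000000009693) + x * (0.0000000000000000000035153 + x * ((-0.00000000000000000000001056) + x * (0.0000000000000000000000000391 + x * ((-0.000000000000000000000000000019) + x * (0.00000000000000000000000000000071 + x * (0.000000000000000000000000000000003 + x * (0.00000000000000000000000000000000002 + x * (0.0000000000000000000000000000000000001 + x * (0.00000000000000000000000000000000000001 + x * (0.0000000000000000000000000000000000000001 + x * (0.000000000000000000000000000000000000000001)))))))))))))))))))) ≤ 1.0905 ^ 2 := by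
  obtain ⟨y, rfl⟩ : ∃ y, x = 0 + 25 * y := ⟨(x - 0) / 25, by ring⟩
  have hy : 0 ≤ y := by linarith
  have hw : 0 ≤ 1 - y := by linarith
  have h : 1.0905 ^ 2 = 1.1885121 + (0 + 25 * y) * ((-0.053887573) + (0 + 25 * y) * (0.00118385955 + (0 + 25 * y) * ((-0.000016830915) + (0 + 25 * y) * (0.0000001741376 + (0 + 25 * y) * ((-0.0000000014083313) + (0 + 25 * y) * (0.000000000009211501 + (0 + 25 * y) * ((-0.0000000000000502841) + (0 + 25 * y) * (0.00000000000000023665 + (0 + 25 * y) * ((-0.0000000000000000009693) + (0 + 25 * y) * (0.0000000000000000000035153 + (0 + 25 * y) * ((-0.00000000000000000000001056) + (0 + 25 * y) * (0.0000000000000000000000000391 + (0 + 25 * y) * ((-0.000000000000000000000000000019) + (0 + 25 * y) * (0.00000000000000000000000000000071 + (0 + 25 * y) * (0.000000000000000000000000000000003 + (0 + 25 * y) * (0.00000000000000000000000000000000002 + (0 + 25 * y) * (0.0000000000000000000000000000000000001 + (0 + 25 * y) * (0.00000000000000000000000000000000000001 + (0 + 25 * y) * (0.0000000000000000000000000000000000000001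 + (0 + 25 * y) * (0.000000000000000000000000000000000000000001)))))))))))))))))))) + (0.00067815 * (1 - y) ^ 20 + 1.360752325 * y * (1 - y) ^ 19 + 24.98553345625 * y ^ 2 * (1 - y) ^ 18 + 218.087028684375 * y ^ 3 * (1 - y) ^ 17 + 1199.908212503125 * y ^ 4 * (1 - y) ^ 16 + 4663.1425784103515625 * y ^ 5 * (1 - y) ^ 15 + 13598.140997228662109375 * y ^ 6 * (1 - y) ^ 14 + 30854.1630272116455078125 * y ^ 7 * (1 - y) ^ 13 + 55741.46700454317626953125 * y ^ 8 * (1 - y) ^ 12 + 81365.7331701854766845703125 * y ^ 9 * (1 - y) ^ 11 + 96807.7742423434505462646484375 * y ^ 10 * (1 - y) ^ 10 + 94269.510271021428680419921875 * y ^ 11 * (1 - y) ^ 9 + 75131.4058757944113254547119140625 * y ^ 12 * (1 - y) ^ 8 + 48805.379420383614814281463623046875 * y ^ 13 * (1 - y) ^ 7 + 25615.02586210845706760883331298828125 * y ^ 14 * (1 - y) ^ 6 + 10703.447117932296086847782135009765625 * y ^ 15 * (1 - y) ^ 5 + 3479.6835072784505940973758697509765625 * y ^ 16 * (1 - y) ^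 4 + 848.6865740721129073761403560638427734375 * y ^ 17 * (1 - y) ^ 3 + 146.15583247763734781183302402496337890625 * y ^ 18 * (1 - y) ^ 2 + 15.8524999792357237427495419979095458984375 * y ^ 19 * (1 - y) + 0.814694321916698312270455062389373779296875 * y ^ 20) := by
    ring
  rw [h]
  generalize 1 - y = w at hw
  exact le_add_of_nonneg_right (by positivity)

lemma wengW_line_pos_zero {s : ℂ} (hs : s.re = 1 / 2) (h0 : 0 ≤ s.im ^ 2) (h1 : s.im ^ 2 ≤ 25) :
    0 < (wengW s * (starRingEnd ℂ) (entireXi (s + 2) *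
      ((((Real.pi / 3 - 1 : ℝ) : ℂ) * s + 3) * (s ^ 2 - 7 / 3 * s + 131 / 10)))).re := by
  have hx := sq_nonneg s.im
  refine wengW_line_pos_of_le hs (K := 1.0905) (Q := 14.447) (U := 3.0328) (S := 5.025)
    (ε₀ := 0.0002579) (ε₁ := 0.0003025) (ε₂ := 0.0004778) h1 (by norm_num) (by norm_num [xiErr]) (by norm_num [xiErr])
    (by norm_num [xiErr]) (by norm_num) (by norm_num) (by norm_num) (by norm_num)
    ((xiRe2_sq_add_le hx).trans (bernstein_zero_le h0 h1)) ?_ (by norm_num) (by norm_num) ?_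
  · nlinarith [mul_nonneg (sub_nonneg.mpr h0) (sub_nonneg.mpr h1)]
  · exact lt_of_lt_of_le (by norm_num) ((bernstein_zero_ge h0 h1).trans (wengApprox_ge hx))

lemma bernstein_one_ge {x : ℝ} (h0 : 25 ≤ x) (h1 : x ≤ 42) :
    112.77 ≤ 180.495 + x * ((-30.08791) + x * (1.5570581 + x * ((-0.00639541) + x * ((-0.0008210417) + x * (0.000023705702 + x * ((-0.00000036403306) + x * (0.000000003839958 + x * ((-0.00000000003110978) + x * (0.0000000000002034259 + x * ((-0.000000000000001095) + x * (0.0000000000000000050421 + x * ((-0.00000000000000000002004) + x * (0.00000000000000000000007784 + x * ((-0.0000000000000000000000001716) + x * (0.00000000000000000000000000119 + x * (0.0000000000000000000000000000018 + x * (0.000000000000000000000000000000021 + x * (0 + x * (0 + x * (0 + x * (0 + x * ((-0.00000000000000000000000000000000000000001) + x * (0))))))))))))))))))))))) := by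
  obtain ⟨y, rfl⟩ : ∃ y, x = 25 + 17 * y := ⟨(x - 25) / 17, by ring⟩
  have hy : 0 ≤ y := by linarith
  have hw : 0 ≤ 1 - y := by linarith
  have h : 180.495 + (25 + 17 * y) * ((-30.08791) + (25 + 17 * y) * (1.5570581 + (25 + 17 * y) * ((-0.00639541) + (25 + 17 * y) * ((-0.0008210417) + (25 + 17 * y) * (0.000023705702 + (25 + 17 * y) * ((-0.00000036403306) + (25 + 17 * y) * (0.000000003839958 + (25 + 17 * y) * ((-0.00000000003110978) + (25 + 17 * y) * (0.0000000000002034259 + (25 + 17 * y) * ((-0.000000000000001095) + (25 + 17 * y) * (0.0000000000000000050421 + (25 + 17 * y) * ((-0.00000000000000000002004) + (25 + 17 * y) * (0.00000000000000000000007784 + (25 + 17 * y) * ((-0.0000000000000000000000001716) + (25 + 17 * y) * (0.00000000000000000000000000119 + (25 + 17 * y) * (0.0000000000000000000000000000018 + (25 + 17 * y) * (0.000000000000000000000000000000021 + (25 + 17 * y) * (0 + (25 + 17 * y) * (0 + (25 + 17 * y) * (0 + (25 + 17 * y) * (0 + (25 + 17 * y) * ((-0.00000000000000000000000000000000000000001)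 + (25 + 17 * y) * (0))))))))))))))))))))))) = 112.77 + (30.03939090985056463978253304958343505859375 * (1 - y) ^ 23 + 941.05068197271308439667336642742156982421875 * y * (1 - y) ^ 22 + 13155.87928071772955250926315784454345703125 * y ^ 2 * (1 - y) ^ 21 + 112016.179785303635196634568274021148681640625 * y ^ 3 * (1 - y) ^ 20 + 660823.3655171399216450445353984832763671875 * y ^ 4 * (1 - y) ^ 19 + 2896899.0728583085582196044027805328369140625 * y ^ 5 * (1 - y) ^ 18 + 9853136.560314100151152726612091064453125 * y ^ 6 * (1 - y) ^ 17 + 26755953.68469906605719681991863250732421875 * y ^ 7 * (1 - y) ^ 16 + 59156997.11207472417023960805145263671875 * y ^ 8 * (1 - y) ^ 15 + 107962934.39081597794756450660975341796875 * y ^ 9 * (1 - y) ^ 14 + 164171904.17569750170787810970482421875 * y ^ 10 * (1 - y) ^ 13 + 209266462.635605401219990610791453515625 * y ^ 11 * (1 - y) ^ 12 + 224328298.1071695356293319931606991875 * y ^ 12 * (1 - y) ^ 11 + 202376479.8288006566958171289566636725 * y ^ 13 * (1 - y) ^ 10 + 153374735.5603839764739193189376407136 * y ^ 14 * (1 - y)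 ^ 9 + 97214831.66898700294923622956231173016 * y ^ 15 * (1 - y) ^ 8 + 51146107.9281655171831305509722808165056 * y ^ 16 * (1 - y) ^ 7 + 22080282.530326396709850648311749916110592 * y ^ 17 * (1 - y) ^ 6 + 7691087.681717777616665904014619183777792 * y ^ 18 * (1 - y) ^ 5 + 2108535.5072745168864383214801749423982592 * y ^ 19 * (1 - y) ^ 4 + 438082.8284862308650406090083663183683190784 * y ^ 20 * (1 - y) ^ 3 + 64841.937138892642503823510121291136290258944 * y ^ 21 * (1 - y) ^ 2 + 6092.38150278703385388726169215413712884596736 * y ^ 22 * (1 - y) + 273.13272742231787617651947369658369846542336 * y ^ 23) := by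
    ring
  rw [h]
  generalize 1 - y = w at hw
  exact le_add_of_nonneg_right (by positivity)

lemma bernstein_one_le {x : ℝ} (h0 : 25 ≤ x) (h1 : x ≤ 42) :
    1.1885121 + x * ((-0.053887573) + x * (0.00118385955 + x * ((-0.000016830915) + x * (0.0000001741376 + x * ((-0.0000000014083313) + x * (0.000000000009211501 + x * ((-0.0000000000000502841) + x * (0.00000000000000023665 + x * ((-0.0000000000000000009693) + x * (0.0000000000000000000035153 + x * ((-0.00000000000000000000001056) + x * (0.0000000000000000000000000391 + x * ((-0.000000000000000000000000000019) + x * (0.00000000000000000000000000000071 + x * (0.000000000000000000000000000000003 + x * (0.00000000000000000000000000000000002 + x * (0.0000000000000000000000000000000000001 + x * (0.00000000000000000000000000000000000001 + x * (0.0000000000000000000000000000000000000001 + x * (0.000000000000000000000000000000000000000001)))))))))))))))))))) ≤ 0.61209 ^ 2 := by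
  obtain ⟨y, rfl⟩ : ∃ y, x = 25 + 17 * y := ⟨(x - 25) / 17, by ring⟩
  have hy : 0 ≤ y := by linarith
  have hw : 0 ≤ 1 - y := by linarith
  have h : 0.61209 ^ 2 = 1.1885121 + (25 + 17 * y) * ((-0.053887573) + (25 + 17 * y) * (0.00118385955 + (25 + 17 * y) * ((-0.000016830915) + (25 + 17 * y) * (0.0000001741376 + (25 + 17 * y) * ((-0.0000000014083313) + (25 + 17 * y) * (0.000000000009211501 + (25 + 17 * y) * ((-0.0000000000000502841) + (25 + 17 * y) * (0.00000000000000023665 + (25 + 17 * y) * ((-0.0000000000000000009693) + (25 + 17 * y) * (0.0000000000000000000035153 + (25 + 17 * y) * ((-0.00000000000000000000001056) + (25 + 17 * y) * (0.0000000000000000000000000391 + (25 + 17 * y) * ((-0.000000000000000000000000000019) + (25 + 17 * y) * (0.00000000000000000000000000000071 + (25 + 17 * y) * (0.000000000000000000000000000000003 + (25 + 17 * y) * (0.00000000000000000000000000000000002 + (25 + 17 * y) * (0.0000000000000000000000000000000000001 + (25 + 17 * y) * (0.00000000000000000000000000000000000001 + (25 + 17 * y) * (0.0000000000000000000000000000000000000001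 + (25 + 17 * y) * (0.000000000000000000000000000000000000000001)))))))))))))))))))) + (0.000158240016698312270455062389373779296875 * (1 - y) ^ 20 + 0.3033075925207711472176015377044677734375 * y * (1 - y) ^ 19 + 5.61729612112155450247228145599365234375 * y ^ 2 * (1 - y) ^ 18 + 49.45519190589179443322122097015380859375 * y ^ 3 * (1 - y) ^ 17 + 274.42512884426457966565191745758056640625 * y ^ 4 * (1 - y) ^ 16 + 1075.4434594686273044525058746337890625 * y ^ 5 * (1 - y) ^ 15 + 3161.968013653625135818242431640625 * y ^ 6 * (1 - y) ^ 14 + 7232.62270318720907707547706298828125 * y ^ 7 * (1 - y) ^ 13 + 13170.417258123185682184839412841796875 * y ^ 8 * (1 - y) ^ 12 + 19374.7941024579139197564476478515625 * y ^ 9 * (1 - y) ^ 11 + 23228.22604168680063660793808839375 * y ^ 10 * (1 - y) ^ 10 + 22788.92285041469476325723862727625 * y ^ 11 * (1 - y) ^ 9 + 18296.07789463232823004122237653085 * y ^ 12 * (1 - y) ^ 8 + 11970.880021704477155614979782794896 * y ^ 13 * (1 - y) ^ 7 + 6327.23318763107493028955931723209216 * y ^ 14 * (1 - y) ^ 6 +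 2662.213879809605704959156361422856704 * y ^ 15 * (1 - y) ^ 5 + 871.3641089443003778794671730110052096 * y ^ 16 * (1 - y) ^ 4 + 213.9386074187646512054544975429336588288 * y ^ 17 * (1 - y) ^ 3 + 37.08361079135144912274732566024580431872 * y ^ 18 * (1 - y) ^ 2 + 4.0479080645702270964828501532635746271232 * y ^ 19 * (1 - y) + 0.209333356206094569706516478714812352692224 * y ^ 20) := by
    ring
  rw [h]
  generalize 1 - y = w at hw
  exact le_add_of_nonneg_right (by positivity)

lemma wengW_line_pos_one {s : ℂ} (hs : s.re = 1 / 2) (h0 : 25 ≤ s.im ^ 2) (h1 : s.im ^ 2 ≤ 42) :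
    0 < (wengW s * (starRingEnd ℂ) (entireXi (s + 2) *
      ((((Real.pi / 3 - 1 : ℝ) : ℂ) * s + 3) * (s ^ 2 - 7 / 3 * s + 131 / 10)))).re := by
  have hx := sq_nonneg s.im
  refine wengW_line_pos_of_le hs (K := 0.61209) (Q := 31.0439) (U := 3.0391) (S := 6.5)
    (ε₀ := 0.002574) (ε₁ := 0.002886) (ε₂ := 0.004024) h1 (by norm_num) (by norm_num [xiErr]) (by norm_num [xiErr])
    (by norm_num [xiErr]) (by norm_num) (by norm_num) (by norm_num) (by norm_num)
    ((xiRe2_sq_add_le hx).trans (bernstein_one_le h0 h1)) ?_ (by norm_num) (by norm_num) ?_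
  · nlinarith [mul_nonneg (sub_nonneg.mpr h0) (sub_nonneg.mpr h1)]
  · exact lt_of_lt_of_le (by norm_num) ((bernstein_one_ge h0 h1).trans (wengApprox_ge hx))

lemma bernstein_two_ge {x : ℝ} (h0 : 42 ≤ x) (h1 : x ≤ 51) :
    296.38 ≤ 180.495 + x * ((-30.08791) + x * (1.5570581 + x * ((-0.00639541) + x * ((-0.0008210417) + x * (0.000023705702 + x * ((-0.00000036403306) + x * (0.000000003839958 + x * ((-0.00000000003110978) + x * (0.0000000000002034259 + x * ((-0.000000000000001095) + x * (0.0000000000000000050421 + x * ((-0.00000000000000000002004) + x * (0.00000000000000000000007784 + x * ((-0.0000000000000000000000001716) + x * (0.00000000000000000000000000119 + x * (0.0000000000000000000000000000018 + x * (0.000000000000000000000000000000021 + x * (0 + x * (0 + x * (0 + x * (0 + x * ((-0.00000000000000000000000000000000000000001) + x * (0))))))))))))))))))))))) := by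
  obtain ⟨y, rfl⟩ : ∃ y, x = 42 + 9 * y := ⟨(x - 42) / 9, by ring⟩
  have hy : 0 ≤ y := by linarith
  have hw : 0 ≤ 1 - y := by linarith
  have h : 180.495 + (42 + 9 * y) * ((-30.08791) + (42 + 9 * y) * (1.5570581 + (42 + 9 * y) * ((-0.00639541) + (42 + 9 * y) * ((-0.0008210417) + (42 + 9 * y) * (0.000023705702 + (42 + 9 * y) * ((-0.00000036403306) + (42 + 9 * y) * (0.000000003839958 + (42 + 9 * y) * ((-0.00000000003110978) + (42 + 9 * y) * (0.0000000000002034259 + (42 + 9 * y) * ((-0.000000000000001095) + (42 + 9 * y) * (0.0000000000000000050421 + (42 + 9 * y) * ((-0.00000000000000000002004) + (42 + 9 * y) * (0.00000000000000000000007784 + (42 + 9 * y) * ((-0.0000000000000000000000001716) + (42 + 9 * y) * (0.00000000000000000000000000119 + (42 + 9 * y) * (0.0000000000000000000000000000018 + (42 + 9 * y) * (0.000000000000000000000000000000021 + (42 + 9 * y) * (0 + (42 + 9 * y) * (0 + (42 + 9 * y) * (0 + (42 + 9 * y) * (0 + (42 + 9 * y) * ((-0.00000000000000000000000000000000000000001)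 + (42 + 9 * y) * (0))))))))))))))))))))))) = 296.38 + (89.52272742231787617651947369658369846542336 * (1 - y) ^ 23 + 2159.43691020369325109254647300998926604173312 * y * (1 - y) ^ 22 + 24833.7324134492577498818466297384113541742592 * y ^ 2 * (1 - y) ^ 21 + 181219.61155742240069887157825117411353715277824 * y ^ 3 * (1 - y) ^ 20 + 942118.1842971444223973596897209407082746478592 * y ^ 4 * (1 - y) ^ 19 + 3713452.60560097466958346776863568600557627113472 * y ^ 5 * (1 - y) ^ 18 + 11529966.90059368794162667397522467248481883848704 * y ^ 6 * (1 - y) ^ 17 + 28921369.2299946192796593016575953826092218810368 * y ^ 7 * (1 - y) ^ 16 + 59629616.77721745206528304527025389401867130339328 * y ^ 8 * (1 - y) ^ 15 + 102270908.2474518085587739478010642755475486834688 * y ^ 9 * (1 - y) ^ 14 + 147095126.00050707499092217129918870217159420616704 * y ^ 10 * (1 - y) ^ 13 + 178314673.80274727584798592538733492675954581004288 * y ^ 11 * (1 - y) ^ 12 + 182634892.1653119457033783885466502795212905513984 * y ^ 12 * (1 - y) ^ 11 + 158060284.80477201293119189170510175090358678061056 * y ^ 13 * (1 - y) ^ 10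 + 115320978.7970532549036289103914149032868449561344 * y ^ 14 * (1 - y) ^ 9 + 70587024.60736155332651664491826297084853183200768 * y ^ 15 * (1 - y) ^ 8 + 35961427.64659592937805028065427807066101431796416 * y ^ 16 * (1 - y) ^ 7 + 15070491.0777322153972322190129232352642764403904 * y ^ 17 * (1 - y) ^ 6 + 5107016.00557322294240197729100152803572838739472 * y ^ 18 * (1 - y) ^ 5 + 1364843.4336663283730088549689052648706469588824 * y ^ 19 * (1 - y) ^ 4 + 276927.99332298170717412074724489955905892568996 * y ^ 20 * (1 - y) ^ 3 + 40095.23333883635171063101769356317564766137392 * y ^ 21 * (1 - y) ^ 2 + 3690.68962324132607770301666390481242362100275 * y ^ 22 * (1 - y) + 162.32410355612695384088550399016738688171399 * y ^ 23) := by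
    ring
  rw [h]
  generalize 1 - y = w at hw
  exact le_add_of_nonneg_right (by positivity)

lemma bernstein_two_le {x : ℝ} (h0 : 42 ≤ x) (h1 : x ≤ 51) :
    1.1885121 + x * ((-0.053887573) + x * (0.00118385955 + x * ((-0.000016830915) + x * (0.0000001741376 + x * ((-0.0000000014083313) + x * (0.000000000009211501 + x * ((-0.0000000000000502841) + x * (0.00000000000000023665 + x * ((-0.0000000000000000009693) + x * (0.0000000000000000000035153 + x * ((-0.00000000000000000000001056) + x * (0.0000000000000000000000000391 + x * ((-0.000000000000000000000000000019) + x * (0.00000000000000000000000000000071 + x * (0.000000000000000000000000000000003 + x * (0.00000000000000000000000000000000002 + x * (0.0000000000000000000000000000000000001 + x * (0.00000000000000000000000000000000000001 + x * (0.0000000000000000000000000000000000000001 + x * (0.000000000000000000000000000000000000000001)))))))))))))))))))) ≤ 0.40668 ^ 2 := by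
  obtain ⟨y, rfl⟩ : ∃ y, x = 42 + 9 * y := ⟨(x - 42) / 9, by ring⟩
  have hy : 0 ≤ y := by linarith
  have hw : 0 ≤ 1 - y := by linarith
  have h : 0.40668 ^ 2 = 1.1885121 + (42 + 9 * y) * ((-0.053887573) + (42 + 9 * y) * (0.00118385955 + (42 + 9 * y) * ((-0.000016830915) + (42 + 9 * y) * (0.0000001741376 + (42 + 9 * y) * ((-0.0000000014083313) + (42 + 9 * y) * (0.000000000009211501 + (42 + 9 * y) * ((-0.0000000000000502841) + (42 + 9 * y) * (0.00000000000000023665 + (42 + 9 * y) * ((-0.0000000000000000009693) + (42 + 9 * y) * (0.0000000000000000000035153 + (42 + 9 * y) * ((-0.00000000000000000000001056) + (42 + 9 * y) * (0.0000000000000000000000000391 + (42 + 9 * y) * ((-0.000000000000000000000000000019) + (42 + 9 * y) * (0.00000000000000000000000000000071 + (42 + 9 * y) * (0.000000000000000000000000000000003 + (42 + 9 * y) * (0.00000000000000000000000000000000002 + (42 + 9 * y) * (0.0000000000000000000000000000000000001 + (42 + 9 * y) * (0.00000000000000000000000000000000000001 + (42 + 9 * y) * (0.0000000000000000000000000000000000000001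 + (42 + 9 * y) * (0.000000000000000000000000000000000000000001)))))))))))))))))))) + (0.000067810506094569706516478714812352692224 * (1 - y) ^ 20 + 0.07481688870806661053193632660766186799104 * y * (1 - y) ^ 19 + 1.39369680188243682036248485536524545818624 * y ^ 2 * (1 - y) ^ 18 + 12.37225564981482979349108765443752043610112 * y ^ 3 * (1 - y) ^ 17 + 69.26155674028062508791973328633282802843648 * y ^ 4 * (1 - y) ^ 16 + 273.875818083184496027481322292239757420003328 * y ^ 5 * (1 - y) ^ 15 + 812.51453615896491048299225100254367132942336 * y ^ 6 * (1 - y) ^ 14 + 1875.26498005491279740164613926095047991853056 * y ^ 7 * (1 - y) ^ 13 + 3445.34774045931604528603612682198589482323968 * y ^ 8 * (1 - y) ^ 12 + 5113.33423235929634586853421205757395906097152 * y ^ 9 * (1 - y) ^ 11 + 6184.143981891224775783238608956779194935648256 * y ^ 10 * (1 - y) ^ 10 + 6119.89876171295171791400693539941914955537408 * y ^ 11 * (1 - y) ^ 9 + 4955.57602852283475509698484156116264389305088 * y ^ 12 * (1 - y) ^ 8 + 3269.90889324748462655349895790813609418038784 * y ^ 13 * (1 - y) ^ 7 + 1742.82520661435179007355753462650684151868416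 * y ^ 14 * (1 - y) ^ 6 + 739.383620289155903686059894171689231232943872 * y ^ 15 * (1 - y) ^ 5 + 243.98861107944739917035871002321453894140008 * y ^ 16 * (1 - y) ^ 4 + 60.38901230189956655175129553534433705269608 * y ^ 17 * (1 - y) ^ 3 + 10.55128504850133011501146764226246998206664 * y ^ 18 * (1 - y) ^ 2 + 1.16081807499079325970262168808693757607626 * y ^ 19 * (1 - y) + 0.060497535088981180536114881951527981318899 * y ^ 20) := by
    ring
  rw [h]
  generalize 1 - y = w at hw
  exact le_add_of_nonneg_right (by positivity)

lemma wengW_line_pos_two {s : ℂ} (hs : s.re = 1 / 2) (h0 : 42 ≤ s.im ^ 2) (h1 : s.im ^ 2 ≤ 51) :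
    0 < (wengW s * (starRingEnd ℂ) (entireXi (s + 2) *
      ((((Real.pi / 3 - 1 : ℝ) : ℂ) * s + 3) * (s ^ 2 - 7 / 3 * s + 131 / 10)))).re := by
  have hx := sq_nonneg s.im
  refine wengW_line_pos_of_le hs (K := 0.40668) (Q := 39.9679) (U := 3.0424) (S := 7.159)
    (ε₀ := 0.006788) (ε₁ := 0.007505) (ε₂ := 0.01007) h1 (by norm_num) (by norm_num [xiErr]) (by norm_num [xiErr])
    (by norm_num [xiErr]) (by norm_num) (by norm_num) (by norm_num) (by norm_num)
    ((xiRe2_sq_add_le hx).trans (bernstein_two_le h0 h1)) ?_ (by norm_num) (by norm_num) ?_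
  · nlinarith [mul_nonneg (sub_nonneg.mpr h0) (sub_nonneg.mpr h1)]
  · exact lt_of_lt_of_le (by norm_num) ((bernstein_two_ge h0 h1).trans (wengApprox_ge hx))

lemma bernstein_three_ge {x : ℝ} (h0 : 51 ≤ x) (h1 : x ≤ 54.76) :
    398.89 ≤ 180.495 + x * ((-30.08791) + x * (1.5570581 + x * ((-0.00639541) + x * ((-0.0008210417) + x * (0.000023705702 + x * ((-0.00000036403306) + x * (0.000000003839958 + x * ((-0.00000000003110978) + x * (0.0000000000002034259 + x * ((-0.000000000000001095) + x * (0.0000000000000000050421 + x * ((-0.00000000000000000002004) + x * (0.00000000000000000000007784 + x * ((-0.0000000000000000000000001716) + x * (0.00000000000000000000000000119 + x * (0.0000000000000000000000000000018 + x * (0.000000000000000000000000000000021 + x * (0 + x * (0 + x * (0 + x * (0 + x * ((-0.00000000000000000000000000000000000000001) + x * (0))))))))))))))))))))))) := by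
  obtain ⟨y, rfl⟩ : ∃ y, x = 51 + 3.76 * y := ⟨(x - 51) / 3.76, by ring⟩
  have hy : 0 ≤ y := by linarith
  have hw : 0 ≤ 1 - y := by linarith
  have h : 180.495 + (51 + 3.76 * y) * ((-30.08791) + (51 + 3.76 * y) * (1.5570581 + (51 + 3.76 * y) * ((-0.00639541) + (51 + 3.76 * y) * ((-0.0008210417) + (51 + 3.76 * y) * (0.000023705702 + (51 + 3.76 * y) * ((-0.00000036403306) + (51 + 3.76 * y) * (0.000000003839958 + (51 + 3.76 * y) * ((-0.00000000003110978) + (51 + 3.76 * y) * (0.0000000000002034259 + (51 + 3.76 * y) * ((-0.000000000000001095) + (51 + 3.76 * y) * (0.0000000000000000050421 + (51 + 3.76 * y) * ((-0.00000000000000000002004) + (51 + 3.76 * y) * (0.00000000000000000000007784 + (51 + 3.76 * y) * ((-0.0000000000000000000000001716) + (51 + 3.76 * y) * (0.00000000000000000000000000119 + (51 + 3.76 * y) * (0.0000000000000000000000000000018 + (51 + 3.76 * y) * (0.000000000000000000000000000000021 + (51 + 3.76 * y) * (0 + (51 + 3.76 * y) * (0 + (51 + 3.76 * y) * (0 + (51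 + 3.76 * y) * (0 + (51 + 3.76 * y) * ((-0.00000000000000000000000000000000000000001) + (51 + 3.76 * y) * (0))))))))))))))))))))))) = 398.89 + (59.81410355612695384088550399016738688171399 * (1 - y) ^ 23 + 1393.5905475849724845621927838613588876922723828 * y * (1 - y) ^ 22 + 15520.449064618764704455737194985023943630300837744 * y ^ 2 * (1 - y) ^ 21 + 109940.6885371752076254904205253582570290542303253536 * y ^ 3 * (1 - y) ^ 20 + 555995.038256832430053695384840160437935518853107337856 * y ^ 4 * (1 - y) ^ 19 + 2135942.075861811740811066660554963997747027788823158230016 * y ^ 5 * (1 - y) ^ 18 + 6475062.27277177571823485530810018678889174692111532071718912 * y ^ 6 * (1 - y) ^ 17 + 15882969.8130067486323087465807492210594590739828248329189113856 * y ^ 7 * (1 - y) ^ 16 + 32070614.54510722456294694911604741503867964607439722402683486208 * y ^ 8 * (1 - y) ^ 15 + 53940506.2306532531921785441652522627792490777968913253336758878208 * y ^ 9 * (1 - y) ^ 14 + 76176297.3026882324071947292604367090791788607346942032649407382421504 * y ^ 10 * (1 - y) ^ 13 + 90775630.405114626899655989484911331475941563980698886040352367122055168 * y ^ 11 * (1 -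 y) ^ 12 + 91494253.31036282837795511508584090884038817570368735517836497662146248704 * y ^ 12 * (1 - y) ^ 11 + 78000447.021449685951608227662149023029829224780412678507481164692269826048 * y ^ 13 * (1 - y) ^ 10 + 56112001.41602424781549217184237639737671502492864441423800307077833029582848 * y ^ 14 * (1 - y) ^ 9 + 33894529.88298165542827476912854890031430396257899402550225937400877490745901056 * y ^ 15 * (1 - y) ^ 8 + 17055366.3184706647954996841693064872003116744321776542417910197787811778146598912 * y ^ 16 * (1 - y) ^ 7 + 7065016.109510908880678144547467672961297785294345630676544919757163743212591906816 * y ^ 17 * (1 - y) ^ 6 + 2368312.3259051513651156001859750363118052134497662442364793351226634378360039407616 * y ^ 18 * (1 - y) ^ 5 + 626540.128192116850165508476612322399338746529480856567018433278819687319039425642496 * y ^ 19 * (1 - y) ^ 4 + 125927.626533056011873850752751369240109265304580319205579575799814210548200277534572544 * y ^ 20 * (1 - y) ^ 3 + 18072.39618089502982699907445794735085845311489531495414186170581143974019198996948451328 * y ^ 21 * (1 - y) ^ 2 + 1649.9405547451476326075335959153917652786240024657828172319314220515582461900135778484224 * y ^ 22 * (1 - y) + 72.0178064707380395068679566959131692546909254204175985363689292888467564170817698791424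 * y ^ 23) := by
    ring
  rw [h]
  generalize 1 - y = w at hw
  exact le_add_of_nonneg_right (by positivity)

lemma bernstein_three_le {x : ℝ} (h0 : 51 ≤ x) (h1 : x ≤ 54.76) :
    1.1885121 + x * ((-0.053887573) + x * (0.00118385955 + x * ((-0.000016830915) + x * (0.0000001741376 + x * ((-0.0000000014083313) + x * (0.000000000009211501 + x * ((-0.0000000000000502841) + x * (0.00000000000000023665 + x * ((-0.0000000000000000009693) + x * (0.0000000000000000000035153 + x * ((-0.00000000000000000000001056) + x * (0.0000000000000000000000000391 + x * ((-0.000000000000000000000000000019) + x * (0.00000000000000000000000000000071 + x * (0.000000000000000000000000000000003 + x * (0.00000000000000000000000000000000002 + x * (0.0000000000000000000000000000000000001 + x * (0.00000000000000000000000000000000000001 + x * (0.0000000000000000000000000000000000000001 + x * (0.000000000000000000000000000000000000000001)))))))))))))))))))) ≤ 0.32394 ^ 2 := by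
  obtain ⟨y, rfl⟩ : ∃ y, x = 51 + 3.76 * y := ⟨(x - 51) / 3.76, by ring⟩
  have hy : 0 ≤ y := by linarith
  have hw : 0 ≤ 1 - y := by linarith
  have h : 0.32394 ^ 2 = 1.1885121 + (51 + 3.76 * y) * ((-0.053887573) + (51 + 3.76 * y) * (0.00118385955 + (51 + 3.76 * y) * ((-0.000016830915) + (51 + 3.76 * y) * (0.0000001741376 + (51 + 3.76 * y) * ((-0.0000000014083313) + (51 + 3.76 * y) * (0.000000000009211501 + (51 + 3.76 * y) * ((-0.0000000000000502841) + (51 + 3.76 * y) * (0.00000000000000023665 + (51 + 3.76 * y) * ((-0.0000000000000000009693) + (51 + 3.76 * y) * (0.0000000000000000000035153 + (51 + 3.76 * y) * ((-0.00000000000000000000001056) + (51 + 3.76 * y) * (0.0000000000000000000000000391 + (51 + 3.76 * y) * ((-0.000000000000000000000000000019) + (51 + 3.76 * y) * (0.00000000000000000000000000000071 + (51 + 3.76 * y) * (0.000000000000000000000000000000003 + (51 + 3.76 * y) * (0.00000000000000000000000000000000002 + (51 + 3.76 * y) * (0.0000000000000000000000000000000000001 + (51 + 3.76 * y) * (0.00000000000000000000000000000000000001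 + (51 + 3.76 * y) * (0.0000000000000000000000000000000000000001 + (51 + 3.76 * y) * (0.000000000000000000000000000000000000000001)))))))))))))))))))) + (0.000046036288981180536114881951527981318899 * (1 - y) ^ 20 + 0.0214472454158460684816289252025617273929208 * y * (1 - y) ^ 19 + 0.397053084944548923547442936843482155493932496 * y ^ 2 * (1 - y) ^ 18 + 3.53206131206183753866616078423847689299602036096 * y ^ 3 * (1 - y) ^ 17 + 19.8552509464134769753924548888852686689660693111168 * y ^ 4 * (1 - y) ^ 16 + 78.9032175222129395259061960219090994121791699896221696 * y ^ 5 * (1 - y) ^ 15 + 235.34160466447882270549086803345545258026199159708565504 * y ^ 6 * (1 - y) ^ 14 + 546.1921350586297778839342653019926369398317701765584519168 * y ^ 7 * (1 - y) ^ 13 + 1009.205522247698356500231274978711279924802838297337548177408 * y ^ 8 * (1 - y) ^ 12 + 1506.40117565777843871991958119456524311787323553143782951092224 * y ^ 9 * (1 - y) ^ 11 + 1832.39312423168575433987193552198233592219948741615007190109650944 * y ^ 10 * (1 - y) ^ 10 + 1823.853687146357048679467610083149597689315921484408576658934595584 * y ^ 11 * (1 - y) ^ 9 + 1485.40526985676414604757490733297317126838003996661971636926124392448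 * y ^ 12 * (1 - y) ^ 8 + 985.7934113151728405079727804244711934925020107978607028071467348656128 * y ^ 13 * (1 - y) ^ 7 + 528.439250081107861036158821113212346566759723808043122435564498157830144 * y ^ 14 * (1 - y) ^ 6 + 225.471409327930892231934432362488829344899409923154609112943605906612944896 * y ^ 15 * (1 - y) ^ 5 + 74.8272010374569664368215102705421395270105931124006913980969730733441548288 * y ^ 16 * (1 - y) ^ 4 + 18.625281069934110709896523848646415182324488616755620722092353461642934091776 * y ^ 17 * (1 - y) ^ 3 + 3.27258523309090465255869614022868358970650086569058417652312974485494553378816 * y ^ 18 * (1 - y) ^ 2 + 0.3620557743320250514688224790136009007277836637549267616826113534728187924185088 * y ^ 19 * (1 - y) + 0.0189740098959381194639753268916475399572410437152742753394844719651021922316058624 * y ^ 20) := by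
    ring
  rw [h]
  generalize 1 - y = w at hw
  exact le_add_of_nonneg_right (by positivity)

lemma wengW_line_pos_three {s : ℂ} (hs : s.re = 1 / 2) (h0 : 51 ≤ s.im ^ 2) (h1 : s.im ^ 2 ≤ 54.76) :
    0 < (wengW s * (starRingEnd ℂ) (entireXi (s + 2) *
      ((((Real.pi / 3 - 1 : ℝ) : ℂ) * s + 3) * (s ^ 2 - 7 / 3 * s + 131 / 10)))).re := by
  have hx := sq_nonneg s.im
  refine wengW_line_pos_of_le hs (K := 0.32394) (Q := 43.7054) (U := 3.0438) (S := 7.417)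
    (ε₀ := 0.009836) (ε₁ := 0.01083) (ε₂ := 0.01433) h1 (by norm_num) (by norm_num [xiErr]) (by norm_num [xiErr])
    (by norm_num [xiErr]) (by norm_num) (by norm_num) (by norm_num) (by norm_num)
    ((xiRe2_sq_add_le hx).trans (bernstein_three_le h0 h1)) ?_ (by norm_num) (by norm_num) ?_
  · nlinarith [mul_nonneg (sub_nonneg.mpr h0) (sub_nonneg.mpr h1)]
  · exact lt_of_lt_of_le (by norm_num) ((bernstein_three_ge h0 h1).trans (wengApprox_ge hx))

lemma wengW_line_pos {s : ℂ} (hs : s.re = 1 / 2) :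
    0 < (wengW s * (starRingEnd ℂ) (entireXi (s + 2) *
      ((((Real.pi / 3 - 1 : ℝ) : ℂ) * s + 3) * (s ^ 2 - 7 / 3 * s + 131 / 10)))).re := by
  rcases le_total (s.im ^ 2) 25 with h | h
  · exact wengW_line_pos_zero hs (sq_nonneg _) h
  rcases le_total (s.im ^ 2) 42 with h' | h'
  · exact wengW_line_pos_one hs h h'
  rcases le_total (s.im ^ 2) 51 with h | h
  · exact wengW_line_pos_two hs h' h
  rcases le_total (s.im ^ 2) (54.76) with h' | h'
  · exact wengW_line_pos_three hs h h'
  · exact wengW_line_pos_of_large hs (by linarith)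

lemma HasDerivAt.const_add_id_mul {p : ℂ → ℂ} {p' z : ℂ} (h : HasDerivAt p p' z) (c : ℂ) :
    HasDerivAt (fun z ↦ c + z * p z) (p z + z * p') z := by
  simpa using ((hasDerivAt_id' z).mul h).const_add c

/-- The derivative of `xiPoly` on the real axis. -/
noncomputable def xiPolyDeriv (x : ℝ) : ℝ :=
  0.02297194 + x * (0.000493842 + x * (0.00000498744 + x * (0.0000000324192 + x * (0.000000000129995 +
    x * (0.00000000000080106 + x * (-0.000000000000001449 + x * (0.00000000000000001992 + x * (-0.000000000000000000045 + x * 0.00000000000000000000009))))))))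

lemma hasDerivAt_xiPoly (x : ℝ) : HasDerivAt xiPoly (xiPolyDeriv x) (x : ℂ) := by
  have h := ((((((((((hasDerivAt_const (x : ℂ) (((0.000000000000000000000009 : ℝ) : ℂ))).const_add_id_mul
    ((-0.000000000000000000005 : ℝ) : ℂ)).const_add_id_mul ((0.00000000000000000249 : ℝ) : ℂ)).const_add_id_mul
    ((-0.000000000000000207 : ℝ) : ℂ)).const_add_id_mul ((0.00000000000013351 : ℝ) : ℂ)).const_add_id_mul
    ((0.000000000025999 : ℝ) : ℂ)).const_add_id_mul ((0.0000000081048 : ℝ) : ℂ)).const_add_id_mul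
    ((0.00000166248 : ℝ) : ℂ)).const_add_id_mul ((0.000246921 : ℝ) : ℂ)).const_add_id_mul
    ((0.02297194 : ℝ) : ℂ)).const_add_id_mul ((0.994242 : ℝ) : ℂ)
  refine HasDerivAt.congr_deriv h ?_
  rw [xiPolyDeriv]
  push_cast
  ring

lemma abs_deriv_entireXi_sub_le {u : ℝ} (hu : 0 ≤ u) (hu' : u ≤ 19) :
    |(deriv entireXi (1 / 2 + u)).re - 2 * u * xiPolyDeriv (u ^ 2)| ≤ xiErr ((u + 1) ^ 2) := by
  have h1 : HasDerivAt (fun w : ℂ ↦ entireXi (1 / 2 + w)) (deriv entireXi (1 / 2 + u)) (u : ℂ) :=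
    ((differentiable_entireXi _).hasDerivAt.comp_const_add (1 / 2) (u : ℂ))
  have h2 : HasDerivAt (fun w : ℂ ↦ xiPoly (w ^ 2)) ((2 * u * xiPolyDeriv (u ^ 2) : ℝ) : ℂ) (u : ℂ) := by
    have h3 := hasDerivAt_xiPoly (u ^ 2)
    push_cast at h3
    refine (HasDerivAt.comp (u : ℂ) h3 (hasDerivAt_pow 2 (u : ℂ))).congr_deriv ?_
    push_cast
    ring
  have h4 := h1.sub h2
  have hd : Differentiable ℂ ((fun w : ℂ ↦ entireXi (1 / 2 + w)) - fun w : ℂ ↦ xiPoly (w ^ 2)) := by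
    have := differentiable_entireXi
    unfold xiPoly
    fun_prop
  have h5 := norm_deriv_le_of_forall_mem_sphere_norm_le (c := (u : ℂ)) one_pos hd.diffContOnCl
    (C := xiErr ((u + 1) ^ 2)) (fun z hz ↦ by
      have hz' : ‖z‖ ≤ u + 1 := by
        have := norm_sub_norm_le z u
        rw [mem_sphere_iff_norm] at hz
        rw [norm_real, Real.norm_of_nonneg hu] at this
        linarith
      refine norm_entireXi_sub_xiPoly_le ?_ (by nlinarith)
      rw [norm_pow]
      gcongr)
  rw [h4.deriv, div_one] at h5
  have h6 := (abs_re_le_norm _).trans h5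
  rwa [sub_re, ofReal_re] at h6

lemma abs_entireXi_re_sub_le {u : ℝ} (hu : u ^ 2 ≤ 400) :
    |(entireXi (1 / 2 + u)).re - xiRe0 (-u ^ 2)| ≤ xiErr (u ^ 2) := by
  have h := norm_entireXi_sub_xiPoly_le (u := (u : ℂ)) (r := u ^ 2) (by simp) hu
  have e : xiPoly ((u : ℂ) ^ 2) = (xiRe0 (-u ^ 2) : ℝ) := by
    rw [xiPoly, xiRe0]
    push_cast
    ring
  rw [e] at h
  have h6 := (abs_re_le_norm _).trans h
  rwa [sub_re, ofReal_re] at h6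

lemma ofReal_re_entireXi (x : ℝ) : ((entireXi x).re : ℂ) = entireXi x :=
  conj_eq_iff_re.mp (by rw [← entireXi_conj, conj_ofReal])

lemma deriv_wengY_half : deriv wengY (1 / 2) =
    2 * (2 * deriv entireXi 1 * wengV (1 / 2) + deriv wengV (1 / 2)) := by
  have hf : HasDerivAt (fun s ↦ entireXi (2 * s) * wengV s)
      (2 * deriv entireXi 1 * wengV (1 / 2) + deriv wengV (1 / 2)) ((1 / 2 : ℂ)) := by
    have h1 : HasDerivAt (fun s : ℂ ↦ entireXi (2 * s)) (deriv entireXi 1 * (2 * 1)) (1 / 2) := by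
      have h := (differentiable_entireXi (2 * (1 / 2))).hasDerivAt.comp (1 / 2 : ℂ)
        ((hasDerivAt_id' _).const_mul (2 : ℂ))
      rwa [mul_one_div_cancel two_ne_zero] at h
    refine (h1.mul (differentiable_wengV _).hasDerivAt).congr_deriv ?_
    rw [mul_one_div_cancel two_ne_zero, entireXi_one]
    ring
  have hg : HasDerivAt (fun s ↦ entireXi (2 * (1 - s)) * wengV (1 - s))
      (-(2 * deriv entireXi 1 * wengV (1 / 2) + deriv wengV (1 / 2))) ((1 / 2 : ℂ)) := by
    have h2 : (1 : ℂ) - 1 / 2 = 1 / 2 := by norm_num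
    refine (HasDerivAt.comp (1 / 2 : ℂ) (h₂ := fun s ↦ entireXi (2 * s) * wengV s)
      (h2.symm ▸ hf) ((hasDerivAt_id' _).const_sub 1)).congr_deriv ?_
    ring_nf
  rw [funext wengY_eq]
  refine (hf.sub hg).deriv.trans ?_
  ring

lemma re_deriv_wengY_half_neg : (deriv wengY (1 / 2)).re < 0 := by
  obtain ⟨hc1, hc2⟩ := pi_div_three_sub_one_mem
  have a0 := abs_le.mp (abs_entireXi_re_sub_le (u := 0) (by norm_num))
  have a1 := abs_le.mp (abs_entireXi_re_sub_le (u := 1) (by norm_num))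
  have a2 := abs_le.mp (abs_entireXi_re_sub_le (u := 2) (by norm_num))
  have d0 := abs_le.mp (abs_deriv_entireXi_sub_le (u := 0) (by norm_num) (by norm_num))
  have d1 := abs_le.mp (abs_deriv_entireXi_sub_le (u := 1) (by norm_num) (by norm_num))
  have d2 := abs_le.mp (abs_deriv_entireXi_sub_le (u := 2) (by norm_num) (by norm_num))
  have dh := abs_le.mp (abs_deriv_entireXi_sub_le (u := 1 / 2) (by norm_num) (by norm_num))
  have r0 := ofReal_re_entireXi (1 / 2)
  have r1 := ofReal_re_entireXi (3 / 2)
  have r2 := ofReal_re_entireXi (5 / 2)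
  norm_num [xiErr, xiRe0, xiPolyDeriv] at a0 a1 a2 d0 d1 d2 dh r0 r1 r2
  have hV : wengW (1 / 2) = 3 / 2 * wengV (1 / 2) := by
    rw [wengW_eq]
    norm_num
  have hV' : deriv wengW (1 / 2) = wengV (1 / 2) + 3 / 2 * deriv wengV (1 / 2) := by
    have h := ((hasDerivAt_id' (1 / 2 : ℂ)).add_const 1).mul (differentiable_wengV (1 / 2)).hasDerivAt
    rw [funext wengW_eq]
    refine h.deriv.trans ?_
    norm_num
  have hE : ∀ k : ℂ, HasDerivAt (fun s ↦ entireXi (s + k)) (deriv entireXi (1 / 2 + k)) (1 / 2) :=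
    fun k ↦ (differentiable_entireXi _).hasDerivAt.comp_add_const (1 / 2) k
  have hW := ((((hasDerivAt_id' (1 / 2 : ℂ)).const_mul ((Real.pi / 3 - 1 : ℝ) : ℂ)).add_const 3).mul
    (((hasDerivAt_id' (1 / 2 : ℂ)).sub_const 1).pow 2)).mul (hE 2)
  have hW := (hW.sub ((((hasDerivAt_id' (1 / 2 : ℂ)).sub_const 1).const_mul 2).mul
    ((hasDerivAt_id' (1 / 2 : ℂ)).sub_const 3) |>.mul (hE 1))).sub
    ((((hasDerivAt_id' (1 / 2 : ℂ)).add_const 2).mul ((hasDerivAt_id' (1 / 2 : ℂ)).sub_const 3)).mul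
      (differentiable_entireXi _).hasDerivAt)
  have hw : wengW (1 / 2) = ((((Real.pi / 3 - 1) / 2 + 3) / 4 * (entireXi (5 / 2)).re -
      5 / 2 * (entireXi (3 / 2)).re + 25 / 4 * (entireXi (1 / 2)).re : ℝ) : ℂ) := by
    rw [wengW]
    norm_num
    rw [r0, r1, r2]
    ring
  have hW : deriv wengW (1 / 2) = (((-3 - (Real.pi / 3 - 1) / 4) * (entireXi (5 / 2)).re + 6 * (entireXi (3 / 2)).re : ℝ) : ℂ) +
      ((((Real.pi / 3 - 1) / 2 + 3) / 4 : ℝ) * deriv entireXi (5 / 2) - (5 / 2 : ℝ) * deriv entireXi (3 / 2) +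
        (25 / 4 : ℝ) * deriv entireXi (1 / 2)) := by
    refine hW.deriv.trans ?_
    norm_num
    rw [r1, r2]
    ring
  rw [deriv_wengY_half, show deriv wengV (1 / 2) = (2 / 3 : ℝ) * (deriv wengW (1 / 2) - (2 / 3 : ℝ) * wengW (1 / 2)) by
    rw [hV', hV]; push_cast; ring, show wengV (1 / 2) = (2 / 3 : ℝ) * wengW (1 / 2) by
    rw [hV]; push_cast; ring, hW, hw]
  generalize Real.pi / 3 - 1 = c at *
  generalize (entireXi (1 / 2)).re = e0 at *
  generalize (entireXi (3 / 2)).re = e1 at *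
  generalize (entireXi (5 / 2)).re = e2 at *
  have h2 : (2 : ℂ) = ((2 : ℝ) : ℂ) := by norm_num
  rw [h2]
  simp only [← ofReal_mul, mul_re, mul_im, add_re, add_im, sub_re, sub_im,
    ofReal_re, ofReal_im]
  generalize (deriv entireXi (1 / 2)).re = f0 at *
  generalize (deriv entireXi (3 / 2)).re = f1 at *
  generalize (deriv entireXi (5 / 2)).re = f2 at *
  generalize (deriv entireXi 1).re = f at *
  have he2 : 1.09018 ≤ e2 ∧ e2 ≤ 1.0902 := ⟨by linarith, by linarith⟩
  have hf2 : 0.1001 ≤ f2 ∧ f2 ≤ 0.1002 := ⟨by linarith, by linarith⟩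
  have hf : 0.02309 ≤ f ∧ f ≤ 0.0231 := ⟨by linarith, by linarith⟩
  have h1 : c * e2 ≤ 0.0472 * 1.0902 := mul_le_mul (by linarith) he2.2 (by linarith) (by norm_num)
  have h1' : 0.047197 * 1.09018 ≤ c * e2 := mul_le_mul hc1.le he2.1 (by norm_num) (by linarith)
  have h3 : c * f2 ≤ 0.0472 * 0.1002 := mul_le_mul (by linarith) hf2.2 (by linarith) (by norm_num)
  have h4 : f * ((c / 2 + 3) / 4 * e2 - 5 / 2 * e1 + 25 / 4 * e0) ≤ 0.0231 * 4.495 :=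
    mul_le_mul hf.2 (by linarith) (by linarith) (by norm_num)
  linarith

/-- The Riemann Hypothesis for Weng's zeta of `(G₂, P_short)` (Suzuki–Weng):
all zeros lie on `Re s = 1/2`. -/
theorem wengG2Pshort_riemann_hypothesis (s : ℂ)
    (hs : s ∉ ({-2, -1, 0, 1/2, 1, 2, 3} : Set ℂ)) (hzero : wengG2Pshort s = 0) :
    s.re = 1/2 := by
  refine re_eq_half_of_wengG2Pshort_eq_zero (fun z hz hz1 ↦ wengY_ne_zero_of_line
    (p := fun s ↦ s ^ 2 - 7 / 3 * s + 131 / 10) (D := 20) (by fun_prop) (fun z hz ↦ ?_)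
    (fun z ↦ ?_) (fun z hz ↦ ?_) (fun z hz h ↦ ?_) re_deriv_wengY_half_neg hz hz1) hs hzero
  · have e : (1 - z) ^ 2 - 7 / 3 * (1 - z) + 131 / 10 = z ^ 2 + (1 / 3 : ℝ) * z + (353 / 30 : ℝ) := by
      push_cast
      ring
    simp only [e]
    refine norm_add₃_le.trans ?_
    rw [norm_pow, norm_mul, norm_real, norm_real, Real.norm_of_nonneg (by norm_num),
      Real.norm_of_nonneg (by norm_num)]
    nlinarith
  · simp [map_div₀, map_ofNat]
  · have h := wengW_line_pos hz
    rwa [← mul_assoc (entireXi (z + 2))] at h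
  · have h1 := congrArg re h
    have h2 := congrArg im h
    simp [pow_two] at h1 h2
    have h3 : z.im * (z.re + 1 / 6) = 0 := by linarith
    rcases mul_eq_zero.mp h3 with h3 | h3
    · rw [h3] at h1
      nlinarith [sq_nonneg z.re]
    · linarith
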